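/- Assume ERH. Then every fundamental discriminant D < 0 such that the exponent E(D) of the class group Cl(D) of ℚ(√D) is at most 8 satisfies |D| ≤ 8.9·10^35. -/

import Mathlib

open NumberField

/-- `D` is a fundamental discriminant: either `D ≡ 1 (mod 4)` and `D` is squarefree,
or `D = 4m` for a squarefree integer `m ≡ 2` or `3 (mod 4)`. (We exclude the degenerate
case `D = 1`, so that `D` is the discriminant of a quadratic number field.) -/
def IsFundamentalDiscriminant (D : ℤ) : Prop :=
  D ≠ 1 ∧ ((D % 4 = 1 ∧ Squarefree D) ∨
    ∃ m : ℤ, D = 4 * m ∧ Squarefree m ∧ (m % 4 = 2 ∨ m % 4 = 3))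

/-- The extended Riemann hypothesis (for Dirichlet L-functions): no Dirichlet L-function
has a zero `s` with `1/2 < Re s < 1`. -/
def ERH : Prop :=
  ∀ (n : ℕ) [NeZero n] (χ : DirichletCharacter ℂ n) (s : ℂ),
    1 / 2 < s.re → s.re < 1 → DirichletCharacter.LFunction χ s ≠ 0

section

open Complex MeasureTheory Set Filter Topology HurwitzZeta

theorem exists_norm_mellin_le {f : ℝ → ℂ} (hf : ∀ s, MellinConvergent f s) (a b : ℝ) :
    ∃ C, ∀ s : ℂ, a ≤ s.re → s.re ≤ b → ‖mellin f s‖ ≤ C := by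
  have key : ∀ c : ℝ, IntegrableOn (fun t : ℝ ↦ t ^ (c - 1) * ‖f t‖) (Ioi 0) := by
    intro c
    refine IntegrableOn.congr_fun (f := fun t : ℝ ↦ ‖(t : ℂ) ^ ((c : ℂ) - 1) • f t‖) (hf c).norm
      (fun t ht ↦ ?_) measurableSet_Ioi
    simp only [norm_smul]
    rw [norm_cpow_eq_rpow_re_of_pos ht]
    simp
  refine ⟨∫ t in Ioi (0 : ℝ), (t ^ (a - 1) * ‖f t‖ + t ^ (b - 1) * ‖f t‖), fun s ha hb ↦ ?_⟩
  refine norm_integral_le_of_norm_le ((key a).add (key b)) ?_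
  refine (ae_restrict_iff' measurableSet_Ioi).mpr (Eventually.of_forall fun t ht ↦ ?_)
  have ht : 0 < t := ht
  rw [norm_smul, norm_cpow_eq_rpow_re_of_pos ht, ← add_mul]
  refine mul_le_mul_of_nonneg_right ?_ (norm_nonneg _)
  simp only [sub_re, one_re]
  have h1 := Real.rpow_nonneg ht.le (a - 1)
  have h2 := Real.rpow_nonneg ht.le (b - 1)
  rcases le_total t 1 with h | h
  · linarith [Real.rpow_le_rpow_of_exponent_ge ht h (by linarith : a - 1 ≤ s.re - 1)]
  · linarith [Real.rpow_le_rpow_of_exponent_le h (by linarith : s.re - 1 ≤ b - 1)]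

theorem IsStrongFEPair.exists_norm_Λ_le {P : WeakFEPair ℂ} (hP : IsStrongFEPair P) (a b : ℝ) :
    ∃ C, ∀ s : ℂ, a ≤ s.re → s.re ≤ b → ‖P.Λ s‖ ≤ C := by
  obtain ⟨C, hC⟩ := exists_norm_mellin_le (fun s ↦ (hP.hasMellin s).1) a b
  exact ⟨C, fun s h1 h2 ↦ hP.Λ_eq ▸ hC s h1 h2⟩

theorem exists_norm_completedRiemannZeta₀_le (a b : ℝ) :
    ∃ C, ∀ s : ℂ, a ≤ s.re → s.re ≤ b → ‖completedRiemannZeta₀ s‖ ≤ C := by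
  have hP := (hurwitzEvenFEPair 0).isStrongFEPair_toStrongFEPair
  obtain ⟨C, hC⟩ := exists_norm_mellin_le (fun s ↦ (hP.hasMellin s).1) (a / 2) (b / 2)
  refine ⟨C / 2, fun s h1 h2 ↦ ?_⟩
  have := hC (s / 2) (by simp; linarith) (by simp; linarith)
  rw [completedRiemannZeta₀, completedHurwitzZetaEven₀, norm_div, WeakFEPair.Λ₀]
  rw [Complex.norm_two]
  exact div_le_div_of_nonneg_right this zero_le_two

theorem exists_norm_completedHurwitzZetaOdd_le (x : UnitAddCircle) (a b : ℝ) :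
    ∃ C, ∀ s : ℂ, a ≤ s.re → s.re ≤ b → ‖completedHurwitzZetaOdd x s‖ ≤ C := by
  obtain ⟨C, hC⟩ := (isStrong_hurwitzOddFEPair x).exists_norm_Λ_le ((a + 1) / 2) ((b + 1) / 2)
  refine ⟨C / 2, fun s h1 h2 ↦ ?_⟩
  have := hC ((s + 1) / 2) (by simp; linarith) (by simp; linarith)
  rw [completedHurwitzZetaOdd, norm_div]
  rw [Complex.norm_two]
  exact div_le_div_of_nonneg_right this zero_le_two

theorem DirichletCharacter.Odd.exists_norm_completedLFunction_le {N : ℕ} [NeZero N]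
    {χ : DirichletCharacter ℂ N} (hχ : χ.Odd) (a b : ℝ) :
    ∃ C, ∀ s : ℂ, a ≤ s.re → s.re ≤ b → ‖DirichletCharacter.completedLFunction χ s‖ ≤ C := by
  choose C hC using fun j : ZMod N ↦ exists_norm_completedHurwitzZetaOdd_le (ZMod.toAddCircle j) a b
  have hN : (0 : ℝ) < N := by exact_mod_cast Nat.pos_of_ne_zero (NeZero.ne N)
  refine ⟨((N : ℝ) ^ (-a) + (N : ℝ) ^ (-b)) * ∑ j, ‖χ j‖ * C j, fun s h1 h2 ↦ ?_⟩
  rw [DirichletCharacter.completedLFunction, ZMod.completedLFunction_def_odd hχ.to_fun, norm_mul]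
  refine mul_le_mul ?_ ?_ (norm_nonneg _) (by positivity)
  · rw [show (N : ℂ) = ((N : ℝ) : ℂ) by simp, norm_cpow_eq_rpow_re_of_pos hN, neg_re]
    have h1 := Real.rpow_nonneg hN.le (-a)
    have hb := Real.rpow_nonneg hN.le (-b)
    have h1N : (1 : ℝ) ≤ N := by exact_mod_cast Nat.one_le_iff_ne_zero.mpr (NeZero.ne N)
    linarith [Real.rpow_le_rpow_of_exponent_le h1N (by linarith : -s.re ≤ -a)]
  · refine (norm_sum_le _ _).trans (Finset.sum_le_sum fun j _ ↦ ?_)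
    rw [norm_mul]
    exact mul_le_mul_of_nonneg_left (hC j s h1 h2) (norm_nonneg _)

end

section

open Complex MeasureTheory Set Filter Topology Metric ComplexConjugate Bornology

theorem exists_eqOn_mul_exp_ball {f : ℂ → ℂ} {c : ℂ} {r : ℝ} (hr : 0 < r)
    (hf : DifferentiableOn ℂ f (ball c r)) (hne : ∀ z ∈ ball c r, f z ≠ 0) :
    ∃ F : ℂ → ℂ, DifferentiableOn ℂ F (ball c r) ∧ F c = 0 ∧
      ∀ z ∈ ball c r, f z = f c * exp (F z) := by
  have hlog : DifferentiableOn ℂ (fun z ↦ deriv f z / f z) (ball c r) :=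
    (hf.deriv isOpen_ball).div hf hne
  obtain ⟨F, hF⟩ := hlog.isExactOn_ball.with_val_at c 0
  have hF' := hF.2
  refine ⟨F, fun z hz ↦ (hF' z hz).differentiableAt.differentiableWithinAt, hF.1, fun z hz ↦ ?_⟩
  have hder : ∀ w ∈ ball c r, HasDerivAt (fun w ↦ f w * exp (-F w)) 0 w := by
    intro w hw
    have h1 := (hf.differentiableAt (isOpen_ball.mem_nhds hw)).hasDerivAt
    have h2 := h1.mul ((hF' w hw).neg.cexp)
    refine h2.congr_deriv ?_
    simp only [Pi.neg_apply]
    field_simp [hne w hw]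
    ring
  have hconst : f z * exp (-F z) = f c * exp (-F c) := by
    refine (convex_ball c r).is_const_of_fderivWithin_eq_zero (𝕜 := ℂ)
      (fun w hw ↦ (hder w hw).differentiableAt.differentiableWithinAt) (fun w hw ↦ ?_) hz
      (mem_ball_self hr)
    rw [fderivWithin_of_isOpen isOpen_ball hw]
    ext
    simpa using (hder w hw).deriv
  rw [hF.1, neg_zero, exp_zero, mul_one] at hconst
  rw [← hconst, mul_assoc, ← exp_add, neg_add_cancel, exp_zero, mul_one]

theorem norm_ge_of_norm_le_on_ball {f : ℂ → ℂ} {c : ℂ} {r m : ℝ} (hr : 0 < r) (hm : 0 < m)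
    (hf : DifferentiableOn ℂ f (ball c r)) (hne : ∀ z ∈ ball c r, f z ≠ 0)
    (hup : ∀ z ∈ ball c r, ‖f z‖ ≤ ‖f c‖ * Real.exp m) {z : ℂ} (hz : z ∈ ball c r) :
    ‖f c‖ * Real.exp (-(2 * m * r / (r - ‖z - c‖))) ≤ ‖f z‖ := by
  obtain ⟨F, hF, hF0, hFe⟩ := exists_eqOn_mul_exp_ball hr hf hne
  have hc := hne c (mem_ball_self hr)
  have hmaps : MapsTo (fun w ↦ w + c) (ball (0 : ℂ) r) (ball c r) := fun w hw ↦ by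
    simpa [dist_eq_norm] using hw
  have hzc : ‖z - c‖ < r := by simpa [dist_eq_norm] using hz
  have key := borelCaratheodory_zero (f := fun w ↦ F (w + c)) (z := z - c) hm
    (hF.comp (by fun_prop) hmaps) (fun w hw ↦ ?_) hr (by simpa using hzc) (by simpa using hF0)
  · rw [sub_add_cancel] at key
    rw [hFe z hz, norm_mul, norm_exp]
    refine mul_le_mul_of_nonneg_left (Real.exp_le_exp.mpr ?_) (norm_nonneg _)
    have h1 : -(F z).re ≤ ‖F z‖ := (neg_le_abs _).trans (abs_re_le_norm _)
    have h2 : 2 * m * ‖z - c‖ / (r - ‖z - c‖) ≤ 2 * m * r / (r - ‖z - c‖) := by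
      have : 0 < r - ‖z - c‖ := by linarith
      gcongr
    linarith
  · have h := hup _ (hmaps hw)
    rw [hFe _ (hmaps hw), norm_mul, norm_exp] at h
    exact Real.exp_le_exp.mp (le_of_mul_le_mul_left h (norm_pos_iff.mpr hc))

theorem exists_exp_le_norm_of_strip {Ξ : ℂ → ℂ} {C : ℝ} (hC : 0 < C) (hd : Differentiable ℂ Ξ)
    (hne : ∀ s : ℂ, 1 / 2 < s.re → Ξ s ≠ 0)
    (hup : ∀ s : ℂ, -1 ≤ s.re → s.re ≤ 7 → ‖Ξ s‖ ≤ Real.exp (C * (1 + |s.im|)))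
    (hlow : ∀ t : ℝ, Real.exp (-(C * (1 + |t|))) ≤ ‖Ξ (7 / 2 + t * I)‖) {δ : ℝ} (hδ : 0 < δ) :
    ∃ C', 0 < C' ∧ ∀ s : ℂ, 1 / 2 + δ ≤ s.re → s.re ≤ 13 / 2 - δ →
      Real.exp (-(C' * (1 + |s.im|))) ≤ ‖Ξ s‖ := by
  refine ⟨C + 2 * (5 * C) * 3 / δ, by positivity, fun s hs1 hs2 ↦ ?_⟩
  set c : ℂ := 7 / 2 + s.im * I with hcdef
  have hcre : c.re = 7 / 2 := by simp [hcdef]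
  have hcim : c.im = s.im := by simp [hcdef]
  have hball : ∀ z ∈ ball c 3, 1 / 2 < z.re ∧ z.re < 13 / 2 ∧ |z.im| ≤ |s.im| + 3 := by
    intro z hz
    have hz : ‖z - c‖ < 3 := by simpa [dist_eq_norm] using hz
    have h1 := abs_le.mp (abs_re_le_norm (z - c))
    have h2 := abs_le.mp (abs_im_le_norm (z - c))
    rw [sub_re, hcre] at h1
    rw [sub_im, hcim] at h2
    refine ⟨by linarith, by linarith, ?_⟩
    rw [abs_le]
    constructor <;> linarith [neg_abs_le s.im, le_abs_self s.im]
  have hcpos := hlow s.im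
  have hdist : ‖s - c‖ ≤ 3 - δ := by
    have : s - c = ((s.re - 7 / 2 : ℝ) : ℂ) := by
      apply Complex.ext <;> simp [hcdef]
    rw [this, norm_real, Real.norm_eq_abs, abs_le]
    constructor <;> linarith
  have hm : 0 < 5 * C * (1 + |s.im|) := by positivity
  have key := norm_ge_of_norm_le_on_ball (z := s) three_pos hm hd.differentiableOn
    (fun z hz ↦ hne z (hball z hz).1) (fun z hz ↦ ?_)
    (by simpa [dist_eq_norm] using hdist.trans_lt (by linarith))
  · refine le_trans ?_ key
    refine le_trans ?_ (mul_le_mul_of_nonneg_right hcpos (Real.exp_pos _).le)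
    rw [← Real.exp_add, Real.exp_le_exp]
    have h3 : 2 * (5 * C * (1 + |s.im|)) * 3 / (3 - ‖s - c‖) ≤
        2 * (5 * C * (1 + |s.im|)) * 3 / δ := by
      gcongr
      linarith
    have h4 : (C + 2 * (5 * C) * 3 / δ) * (1 + |s.im|) =
      C * (1 + |s.im|) + 2 * (5 * C * (1 + |s.im|)) * 3 / δ := by ring
    linarith
  · obtain ⟨h1, h2, h3⟩ := hball z hz
    refine (hup z (by linarith) (by linarith)).trans ?_
    refine le_trans ?_ (mul_le_mul_of_nonneg_right hcpos (Real.exp_pos _).le)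
    rw [← Real.exp_add, Real.exp_le_exp]
    nlinarith [abs_nonneg s.im]

theorem norm_sub_le_norm_add_of_symm {Ξ : ℂ → ℂ} {C : ℝ} (hC : 0 < C) (hd : Differentiable ℂ Ξ)
    (hsymm : ∀ s, ‖Ξ (1 - conj s)‖ = ‖Ξ s‖)
    (hne : ∀ s : ℂ, 1 / 2 < s.re → Ξ s ≠ 0)
    (hup : ∀ s : ℂ, -1 ≤ s.re → s.re ≤ 7 → ‖Ξ s‖ ≤ Real.exp (C * (1 + |s.im|)))
    (hlow : ∀ t : ℝ, Real.exp (-(C * (1 + |t|))) ≤ ‖Ξ (7 / 2 + t * I)‖)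
    {h : ℝ} (h0 : 0 < h) (h1 : h ≤ 1 / 2)
    (hratio : ∃ C', ∀ s : ℂ, 7 / 2 ≤ s.re → ‖Ξ (s - h)‖ ≤ C' * ‖Ξ (s + h)‖)
    {s : ℂ} (hs : 1 / 2 ≤ s.re) : ‖Ξ (s - h)‖ ≤ ‖Ξ (s + h)‖ := by
  obtain ⟨C₁, hC₁, hlow₁⟩ := exists_exp_le_norm_of_strip hC hd hne hup hlow h0
  obtain ⟨C₂, hC₂⟩ := hratio
  set q : ℂ → ℂ := fun z ↦ Ξ (1 / 2 + z - h) / Ξ (1 / 2 + z + h) with hq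
  have hden : ∀ z : ℂ, 0 ≤ z.re → Ξ (1 / 2 + z + h) ≠ 0 := fun z hz ↦ hne _ (by
    simp only [add_re, ofReal_re]; norm_num; linarith)
  have hright : ∀ z : ℂ, 3 ≤ z.re → ‖q z‖ ≤ C₂ := by
    intro z hz
    rw [hq, norm_div, div_le_iff₀ (norm_pos_iff.mpr (hden z (by linarith)))]
    exact hC₂ _ (by simp only [add_re]; norm_num; linarith)
  have key : ‖q (s - 1 / 2)‖ ≤ 1 := by
    refine PhragmenLindelof.right_half_plane_of_bounded_on_real (C := 1) ?_ ?_ ?_ ?_ ?_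
    · refine DifferentiableOn.diffContOnCl (fun z hz ↦ ?_)
      have hz : 0 ≤ z.re := by
        have := closure_minimal (s := {z : ℂ | 0 < z.re}) (t := {z : ℂ | 0 ≤ z.re})
          (fun w (hw : 0 < w.re) ↦ hw.le) (isClosed_le continuous_const continuous_re) hz
        exact this
      refine DifferentiableAt.differentiableWithinAt (DifferentiableAt.div ?_ ?_ (hden z hz))
      · exact hd.differentiableAt.comp z (by fun_prop)
      · exact hd.differentiableAt.comp z (by fun_prop)
    · refine ⟨1, by norm_num, C + C₁ + |C₂|, ?_⟩
      refine Asymptotics.IsBigO.of_bound (Real.exp (C + C₁)) ?_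
      filter_upwards [mem_inf_of_right (mem_principal_self _)] with z hz
      have hz : 0 < z.re := hz
      rw [Real.rpow_one, Real.norm_eq_abs, Real.abs_exp, ← Real.exp_add]
      have hC₂0 := abs_nonneg C₂
      have hzn := norm_nonneg z
      rcases le_total 3 z.re with h3 | h3
      · refine (hright z h3).trans ?_
        have h5 : (3 : ℝ) ≤ ‖z‖ := h3.trans (re_le_norm z)
        have := Real.add_one_le_exp (C + C₁ + (C + C₁ + |C₂|) * ‖z‖)
        nlinarith [le_abs_self C₂]
      · have e1 := hup (1 / 2 + z - h) (by simp; linarith) (by simp; linarith)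
        have e2 := hlow₁ (1 / 2 + z + h) (by simp; linarith) (by simp; linarith)
        rw [norm_div, div_le_iff₀ (norm_pos_iff.mpr (hden z hz.le))]
        refine e1.trans (le_trans ?_ (mul_le_mul_of_nonneg_left e2 (Real.exp_pos _).le))
        rw [← Real.exp_add, Real.exp_le_exp]
        have e3 : (1 / 2 + z - h).im = z.im := by simp
        have e4 : (1 / 2 + z + h).im = z.im := by simp
        rw [e3, e4]
        nlinarith [abs_im_le_norm z, mul_nonneg hC₂0 hzn]
    · refine ⟨C₂, ?_⟩
      rw [eventually_map]
      filter_upwards [eventually_ge_atTop 3] with x hx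
      exact hright x (by simpa using hx)
    · intro x
      rw [norm_div]
      have e : ‖Ξ (1 / 2 + x * I - h)‖ = ‖Ξ (1 / 2 + x * I + h)‖ := by
        rw [← hsymm (1 / 2 + x * I - h)]
        congr 2
        apply Complex.ext
        · simp; ring
        · simp
      rw [e]
      exact div_self_le_one _
    · simp; linarith
  rw [hq, norm_div, div_le_iff₀ (norm_pos_iff.mpr (hden _ (by simp; linarith))), one_mul] at key
  simpa using key

theorem hasDerivAt_normSq_div {f : ℂ → ℂ} {s : ℂ} (hd : DifferentiableAt ℂ f s) (hne : f s ≠ 0) :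
    HasDerivAt (fun h : ℝ ↦ normSq (f (s + h) / f s)) (2 * (logDeriv f s).re) 0 := by
  have hd0 : HasDerivAt f (deriv f s) (s + ((0 : ℝ) : ℂ)) := by simpa using hd.hasDerivAt
  have h1 : HasDerivAt (fun h : ℝ ↦ f (s + h) / f s) (logDeriv f s) 0 := by
    have h2 := (hd0.scomp_of_eq (0 : ℝ) ((ofRealCLM.hasDerivAt (x := (0 : ℝ))).const_add s)
      (by simp)).div_const (f s)
    simpa [logDeriv_apply] using h2
  have hre : HasDerivAt (fun h : ℝ ↦ (f (s + h) / f s).re) (logDeriv f s).re 0 :=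
    reCLM.hasFDerivAt.comp_hasDerivAt (0 : ℝ) h1
  have him : HasDerivAt (fun h : ℝ ↦ (f (s + h) / f s).im) (logDeriv f s).im 0 :=
    imCLM.hasFDerivAt.comp_hasDerivAt (0 : ℝ) h1
  have h4 := (hre.mul hre).add (him.mul him)
  refine h4.congr_deriv ?_
  simp [hne]
  ring

theorem re_logDeriv_nonneg {f : ℂ → ℂ} {s : ℂ} (hd : DifferentiableAt ℂ f s) (hne : f s ≠ 0)
    (hle : ∀ᶠ h : ℝ in 𝓝[>] 0, ‖f (s - h)‖ ≤ ‖f (s + h)‖) : 0 ≤ (logDeriv f s).re := by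
  have h1 := hasDerivAt_normSq_div hd hne
  have h2 : HasDerivAt (fun h : ℝ ↦ normSq (f (s + (-h : ℝ)) / f s))
      (-(2 * (logDeriv f s).re)) 0 := by
    have := HasDerivAt.scomp_of_eq (0 : ℝ) h1 (hasDerivAt_neg (0 : ℝ)) (by simp)
    simpa [Function.comp_def] using this
  have h3 := (h1.sub h2).tendsto_slope_zero_right
  have h4 := ge_of_tendsto h3 (b := 0) ?_
  · linarith
  · filter_upwards [hle, self_mem_nhdsWithin] with h hh hpos
    have hpos : 0 < h := hpos
    simp only [zero_add, Pi.sub_apply, ofReal_zero, add_zero, sub_self, sub_zero,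
      smul_eq_mul, ofReal_neg, ← sub_eq_add_neg, normSq_eq_norm_sq, norm_div]
    have : ‖f (s - h)‖ / ‖f s‖ ≤ ‖f (s + h)‖ / ‖f s‖ := by gcongr
    have h5 : (‖f (s - h)‖ / ‖f s‖) ^ 2 ≤ (‖f (s + h)‖ / ‖f s‖) ^ 2 := by gcongr
    have := inv_pos.mpr hpos
    apply mul_nonneg this.le
    linarith

end

section

open Complex MeasureTheory Set Filter Topology Metric ComplexConjugate Bornology

theorem log_normSq_add_one_sub_le {r : ℝ} (hr : 1 / 2 < r) (t : ℝ) :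
    1 / 2 * Real.log ((r + 1) ^ 2 + t ^ 2) - 1 / 2 * Real.log (r ^ 2 + t ^ 2) ≤
      r / (r ^ 2 + t ^ 2) + 1 / 2 * (1 / (r - 1 / 2) - 1 / (r + 1 / 2)) := by
  have h0 : 0 < r ^ 2 + t ^ 2 := by positivity
  have h1 : Real.log ((r + 1) ^ 2 + t ^ 2) - Real.log (r ^ 2 + t ^ 2) ≤
      (2 * r + 1) / (r ^ 2 + t ^ 2) := by
    rw [← Real.log_div (by positivity) h0.ne']
    refine (Real.log_le_sub_one_of_pos (by positivity)).trans (le_of_eq ?_)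
    field_simp
    ring
  have h2 : 1 / (r ^ 2 + t ^ 2) ≤ 1 / (r - 1 / 2) - 1 / (r + 1 / 2) := by
    rw [div_sub_div _ _ (by linarith) (by linarith), div_le_div_iff₀ h0 (by nlinarith)]
    nlinarith [sq_nonneg t]
  have h3 : (2 * r + 1) / (r ^ 2 + t ^ 2) = 2 * (r / (r ^ 2 + t ^ 2)) + 1 / (r ^ 2 + t ^ 2) := by
    field_simp
  linarith

theorem log_sub_sum_le {r : ℝ} (hr : 3 / 2 ≤ r) (t : ℝ) (n : ℕ) :
    1 / 2 * Real.log ((r + n) ^ 2 + t ^ 2) -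
        ∑ j ∈ Finset.range n, (r + j) / ((r + j) ^ 2 + t ^ 2) ≤
      1 / 2 * Real.log (r ^ 2 + t ^ 2) + 1 / 2 * (1 - 1 / (r + n - 1 / 2)) := by
  induction n with
  | zero =>
    have : 1 / (r - 1 / 2) ≤ 1 := by rw [div_le_one (by linarith)]; linarith
    simp only [CharP.cast_eq_zero, add_zero, Finset.range_zero, Finset.sum_empty]
    linarith
  | succ n ih =>
    have hn : (0 : ℝ) ≤ n := n.cast_nonneg
    have := log_normSq_add_one_sub_le (r := r + n) (by linarith) t
    rw [Finset.sum_range_succ]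
    push_cast
    rw [show r + (n + 1 : ℝ) = r + n + 1 by ring, show r + n + 1 - 1 / 2 = r + n + 1 / 2 by ring]
    linarith

theorem normSq_GammaSeq_div_le {w : ℂ} (hw : 3 / 2 ≤ w.re) {h : ℝ} (h0 : 0 < h) {n : ℕ}
    (hn : n ≠ 0) :
    ‖GammaSeq (w + h) n‖ ^ 2 ≤
      ‖GammaSeq w n‖ ^ 2 * Real.exp (2 * h * (Real.log ‖w‖ + 1 / 2) + 4 * h ^ 2) := by
  have hn0 : (0 : ℝ) < n := by positivity
  have hr (j : ℕ) : 0 < w.re + j := by positivity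
  set c : ℕ → ℝ := fun j ↦ (w.re + j) / ((w.re + j) ^ 2 + w.im ^ 2) with hc
  have hc0 (j : ℕ) : 0 < c j := by have := hr j; positivity
  have hwj (j : ℕ) : ‖w + j‖ ^ 2 = (w.re + j) ^ 2 + w.im ^ 2 := by
    rw [← normSq_eq_norm_sq, normSq_apply]; simp; ring
  have hfac (j : ℕ) : ‖w + j‖ ^ 2 * Real.exp (2 * h * c j - 2 * h ^ 2 * c j ^ 2) ≤
      ‖w + h + j‖ ^ 2 := by
    have h1 : ‖w + h + j‖ ^ 2 = ‖w + j‖ ^ 2 * (1 + 2 * h * c j) + h ^ 2 := by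
      have := hr j
      rw [hwj, ← normSq_eq_norm_sq, normSq_apply]
      simp only [hc, add_re, add_im, ofReal_re, ofReal_im, natCast_re, natCast_im]
      field_simp
      ring
    rw [h1]
    have h2 : Real.exp (2 * h * c j - 2 * h ^ 2 * c j ^ 2) ≤ 1 + 2 * h * c j := by
      have hx : 0 ≤ 2 * h * c j := by have := hc0 j; positivity
      rw [← Real.le_log_iff_exp_le (by linarith)]
      have := Real.le_log_one_add_of_nonneg hx
      refine le_trans ?_ this
      rw [le_div_iff₀ (by linarith)]
      have := mul_nonneg (mul_nonneg hx hx) hx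
      nlinarith [mul_nonneg hx hx]
    nlinarith [mul_le_mul_of_nonneg_left h2 (sq_nonneg ‖w + j‖)]
  have hprod : (∏ j ∈ Finset.range (n + 1), ‖w + j‖ ^ 2) *
      Real.exp (∑ j ∈ Finset.range (n + 1), (2 * h * c j - 2 * h ^ 2 * c j ^ 2)) ≤
      ∏ j ∈ Finset.range (n + 1), ‖w + h + j‖ ^ 2 := by
    rw [Real.exp_sum, ← Finset.prod_mul_distrib]
    exact Finset.prod_le_prod (fun j _ ↦ by positivity) fun j _ ↦ hfac j
  have hsq : ∀ m : ℕ, ∑ j ∈ Finset.range m, c j ^ 2 ≤ 1 - 1 / (w.re + m - 1 / 2) := by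
    intro m
    induction m with
    | zero =>
      have : 1 / (w.re - 1 / 2) ≤ 1 := by rw [div_le_one (by linarith)]; linarith
      simpa using this
    | succ m ih =>
      have hm : (0 : ℝ) ≤ m := m.cast_nonneg
      have h2 : c m ^ 2 ≤ 1 / (w.re + m - 1 / 2) - 1 / (w.re + m + 1 / 2) := by
        have h3 : c m ≤ 1 / (w.re + m) := by
          have := hr m
          rw [hc, div_le_div_iff₀ (by positivity) this]
          nlinarith [sq_nonneg w.im]
        have h4 : c m ^ 2 ≤ (1 / (w.re + m)) ^ 2 := by
          have := hc0 m
          gcongr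
        refine h4.trans ?_
        have := hr m
        rw [div_sub_div _ _ (by linarith) (by linarith), div_pow,
          div_le_div_iff₀ (by positivity) (by nlinarith)]
        nlinarith
      rw [Finset.sum_range_succ]
      push_cast
      rw [show w.re + (m + 1 : ℝ) - 1 / 2 = w.re + m + 1 / 2 by ring]
      linarith
  have hsum : 2 * h * Real.log n - 2 * h * (Real.log ‖w‖ + 1 / 2) - 4 * h ^ 2 ≤
      ∑ j ∈ Finset.range (n + 1), (2 * h * c j - 2 * h ^ 2 * c j ^ 2) := by
    rw [Finset.sum_sub_distrib, ← Finset.mul_sum, ← Finset.mul_sum]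
    have e1 := log_sub_sum_le hw w.im (n + 1)
    have e2 := hsq (n + 1)
    have e3 : (0 : ℝ) ≤ 1 / (w.re + (n + 1 : ℕ) - 1 / 2) := by
      push_cast
      have : 0 < w.re + (n + 1 : ℝ) - 1 / 2 := by linarith
      positivity
    have e4 : Real.log n ≤ 1 / 2 * Real.log ((w.re + (n + 1 : ℕ)) ^ 2 + w.im ^ 2) := by
      have : Real.log n = 1 / 2 * Real.log ((n : ℝ) ^ 2) := by
        rw [Real.log_pow]; push_cast; ring
      rw [this]
      have : (n : ℝ) ^ 2 ≤ (w.re + (n + 1 : ℕ)) ^ 2 + w.im ^ 2 := by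
        push_cast
        nlinarith [sq_nonneg w.im]
      have := Real.log_le_log (by positivity) this
      linarith
    have e5 : Real.log ‖w‖ = 1 / 2 * Real.log (w.re ^ 2 + w.im ^ 2) := by
      have := hwj 0
      simp only [CharP.cast_eq_zero, add_zero] at this
      rw [← this, Real.log_pow]; push_cast; ring
    rw [e5]
    have e6 : Real.log n - ∑ j ∈ Finset.range (n + 1), c j ≤
      1 / 2 * Real.log (w.re ^ 2 + w.im ^ 2) + 1 / 2 := by simp only [hc]; linarith
    have e7 := mul_le_mul_of_nonneg_left e6 h0.le
    have e8 : h ^ 2 * ∑ j ∈ Finset.range (n + 1), c j ^ 2 ≤ h ^ 2 * 1 :=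
      mul_le_mul_of_nonneg_left (by linarith) (sq_nonneg h)
    linarith [sq_nonneg h]
  have hpow : ∀ s : ℂ, ‖GammaSeq s n‖ ^ 2 =
      Real.exp (2 * s.re * Real.log n) * (n.factorial : ℝ) ^ 2 /
        ∏ j ∈ Finset.range (n + 1), ‖s + j‖ ^ 2 := by
    intro s
    rw [GammaSeq, norm_div, norm_mul, norm_prod, div_pow, mul_pow, Finset.prod_pow,
      show (n : ℂ) = ((n : ℝ) : ℂ) by simp, norm_cpow_eq_rpow_re_of_pos hn0,
      Real.rpow_def_of_pos hn0, ← Real.exp_nat_mul]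
    congr 2
    · push_cast; ring_nf
    · simp
  have hP : 0 < ∏ j ∈ Finset.range (n + 1), ‖w + j‖ ^ 2 :=
    Finset.prod_pos fun j _ ↦ by rw [hwj]; have := hr j; positivity
  have hPh : 0 < ∏ j ∈ Finset.range (n + 1), ‖w + h + j‖ ^ 2 :=
    lt_of_lt_of_le (by positivity) hprod
  rw [hpow, hpow, div_mul_eq_mul_div, div_le_div_iff₀ hPh hP]
  have hexp : Real.exp (2 * (w + h).re * Real.log n) ≤
      Real.exp (2 * w.re * Real.log n) *
        Real.exp (2 * h * (Real.log ‖w‖ + 1 / 2) + 4 * h ^ 2) *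
          Real.exp (∑ j ∈ Finset.range (n + 1), (2 * h * c j - 2 * h ^ 2 * c j ^ 2)) := by
    rw [← Real.exp_add, ← Real.exp_add, Real.exp_le_exp, add_re, ofReal_re]
    linarith
  calc _ ≤ Real.exp (2 * w.re * Real.log n) *
        Real.exp (2 * h * (Real.log ‖w‖ + 1 / 2) + 4 * h ^ 2) *
          Real.exp (∑ j ∈ Finset.range (n + 1), (2 * h * c j - 2 * h ^ 2 * c j ^ 2)) *
          (n.factorial : ℝ) ^ 2 * ∏ j ∈ Finset.range (n + 1), ‖w + j‖ ^ 2 := by gcongr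
    _ = Real.exp (2 * w.re * Real.log n) *
        Real.exp (2 * h * (Real.log ‖w‖ + 1 / 2) + 4 * h ^ 2) * (n.factorial : ℝ) ^ 2 *
        ((∏ j ∈ Finset.range (n + 1), ‖w + j‖ ^ 2) *
        Real.exp (∑ j ∈ Finset.range (n + 1), (2 * h * c j - 2 * h ^ 2 * c j ^ 2))) := by ring
    _ ≤ Real.exp (2 * w.re * Real.log n) *
        Real.exp (2 * h * (Real.log ‖w‖ + 1 / 2) + 4 * h ^ 2) * (n.factorial : ℝ) ^ 2 *
        ∏ j ∈ Finset.range (n + 1), ‖w + h + j‖ ^ 2 := by gcongr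
    _ = _ := by ring

theorem re_logDeriv_Gamma_le {w : ℂ} (hw : 3 / 2 ≤ w.re) :
    (logDeriv Gamma w).re ≤ Real.log ‖w‖ + 1 / 2 := by
  have hG : Gamma w ≠ 0 := Gamma_ne_zero_of_re_pos (by linarith)
  have hd : DifferentiableAt ℂ Gamma w := differentiableAt_Gamma _ fun m hm ↦ by
    rw [hm] at hw
    have : (0 : ℝ) ≤ m := m.cast_nonneg
    simp at hw
    linarith
  set B := Real.log ‖w‖ + 1 / 2
  have hle : ∀ h : ℝ, 0 < h →
      normSq (Gamma (w + h) / Gamma w) ≤ Real.exp (2 * h * B + 4 * h ^ 2) := by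
    intro h h0
    rw [normSq_eq_norm_sq, norm_div, div_pow, div_le_iff₀ (by positivity), mul_comm]
    refine le_of_tendsto_of_tendsto (((GammaSeq_tendsto_Gamma (w + h)).norm).pow 2)
      ((((GammaSeq_tendsto_Gamma w).norm).pow 2).mul_const _) ?_
    filter_upwards [eventually_ne_atTop 0] with n hn
    exact normSq_GammaSeq_div_le hw h0 hn
  have h1 := hasDerivAt_normSq_div hd hG
  have h2 : HasDerivAt (fun h : ℝ ↦ Real.exp (2 * h * B + 4 * h ^ 2)) (2 * B) 0 := by
    have : HasDerivAt (fun h : ℝ ↦ 2 * h * B + 4 * h ^ 2) (2 * B) 0 := by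
      have := (((hasDerivAt_id (0 : ℝ)).const_mul 2).mul_const B).add
        (((hasDerivAt_id (0 : ℝ)).pow 2).const_mul 4)
      simpa [Pi.add_def] using this
    simpa using this.exp
  have h4 := ge_of_tendsto (h2.sub h1).tendsto_slope_zero_right (b := 0) ?_
  · linarith
  · filter_upwards [self_mem_nhdsWithin] with h hpos
    have hpos : 0 < h := hpos
    have := inv_pos.mpr hpos
    have h5 := hle h hpos
    simp only [zero_add, Pi.sub_apply, smul_eq_mul, mul_zero, zero_mul, ofReal_zero, add_zero,
      div_self hG, Real.exp_zero, map_one, sub_self, sub_zero, ne_eq, OfNat.ofNat_ne_zero,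
      not_false_eq_true, zero_pow]
    exact mul_nonneg this.le (by linarith)

end

section

open Complex Set Filter Topology Metric ComplexConjugate Bornology DirichletCharacter

theorem exists_norm_LSeries_le : ∃ M : ℝ, 0 < M ∧ ∀ (f : ℕ → ℂ) (s : ℂ), (∀ n, ‖f n‖ ≤ 1) →
    2 ≤ s.re → ‖LSeries f s‖ ≤ M := by
  have hsum : Summable fun n ↦ ‖LSeries.term 1 2 n‖ :=
    ((LSeriesSummable_one_iff (s := 2)).mpr (by norm_num)).norm
  have h0 : 0 ≤ ∑' n, ‖LSeries.term 1 2 n‖ := tsum_nonneg fun _ ↦ norm_nonneg _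
  refine ⟨∑' n, ‖LSeries.term 1 2 n‖ + 1, by linarith, fun f s hf hs ↦ ?_⟩
  have hle (n : ℕ) : ‖LSeries.term f s n‖ ≤ ‖LSeries.term 1 2 n‖ :=
    (LSeries.norm_term_le_of_re_le_re f (s := 2) (by simpa using hs) n).trans
      (LSeries.norm_term_le 2 (by simpa using hf n))
  refine (tsum_of_norm_bounded hsum.hasSum hle).trans (by linarith)

theorem exists_norm_LFunction_bounds : ∃ M : ℝ, 0 < M ∧ ∀ (N : ℕ) [NeZero N]
    (χ : DirichletCharacter ℂ N) (s : ℂ), 2 ≤ s.re →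
    ‖LFunction χ s‖ ≤ M ∧ M⁻¹ ≤ ‖LFunction χ s‖ := by
  obtain ⟨M, hM, h⟩ := exists_norm_LSeries_le
  refine ⟨M, hM, fun N _ χ s hs ↦ ?_⟩
  rw [LFunction_eq_LSeries χ (by linarith)]
  refine ⟨h _ _ (fun n ↦ χ.norm_le_one _) hs, ?_⟩
  have h1 := LSeries.mul_mu_eq_one χ (s := s) (by linarith)
  have h2 := h ((fun n : ℕ ↦ χ n) * (fun n : ℕ ↦ (ArithmeticFunction.moebius n : ℂ))) s
    (fun n ↦ ?_) hs
  · have h3 := congrArg norm h1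
    rw [norm_mul, norm_one] at h3
    rw [inv_le_iff_one_le_mul₀ hM, ← h3]
    gcongr
  · rw [Pi.mul_apply, norm_mul]
    refine mul_le_one₀ (χ.norm_le_one _) (norm_nonneg _) ?_
    rw [norm_intCast]
    exact_mod_cast ArithmeticFunction.abs_moebius_le_one

/-- The entire function `(s - 1) ζ(s) L(s, χ)`. -/
noncomputable def zetaMulLFunction {N : ℕ} [NeZero N] (χ : DirichletCharacter ℂ N) (s : ℂ) : ℂ :=
  LFunctionTrivChar₁ 1 s * LFunction χ s

/-- The entire function `s (s - 1) N ^ (s / 2) Λ(s) Λ(s, χ)`, with `Λ` the completed zeta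
function. -/
noncomputable def completedXi {N : ℕ} [NeZero N] (χ : DirichletCharacter ℂ N) (s : ℂ) : ℂ :=
  (N : ℂ) ^ (s / 2) * completedLFunction χ s * (s * (s - 1) * completedRiemannZeta₀ s + 1)

theorem DirichletCharacter.Odd.ne_one {N : ℕ} {χ : DirichletCharacter ℂ N} (hodd : χ.Odd) :
    χ ≠ 1 := by
  rintro rfl
  have : (1 : DirichletCharacter ℂ N) (-1) = -1 := hodd
  rw [MulChar.one_apply isUnit_one.neg] at this
  norm_num at this

theorem LSeries_conj_of_inv_eq {N : ℕ} {χ : DirichletCharacter ℂ N} (hinv : χ⁻¹ = χ) (s : ℂ) :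
    LSeries (χ ·) (conj s) = conj (LSeries (χ ·) s) := by
  rw [LSeries, LSeries, conj_tsum]
  congr 1
  ext n
  rcases eq_or_ne n 0 with rfl | hn
  · simp
  · have h1 : conj (χ n) = χ n := by
      have := MulChar.star_apply' χ (n : ZMod N)
      rwa [hinv] at this
    rw [LSeries.term_of_ne_zero hn, LSeries.term_of_ne_zero hn, map_div₀, h1,
      cpow_conj _ _ (by rw [natCast_arg]; exact Real.pi_ne_zero.symm), conj_natCast]

section
variable {N : ℕ} [NeZero N] {χ : DirichletCharacter ℂ N}

theorem LFunctionTrivChar₁_one_apply {s : ℂ} (hs : s ≠ 1) :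
    LFunctionTrivChar₁ 1 s = (s - 1) * riemannZeta s := by
  rw [LFunctionTrivChar₁, Function.update_of_ne hs, LFunctionTrivChar, LFunction_modOne_eq]

theorem differentiable_zetaMulLFunction (hχ : χ ≠ 1) : Differentiable ℂ (zetaMulLFunction χ) :=
  (differentiable_LFunctionTrivChar₁ 1).mul (differentiable_LFunction hχ)

theorem zetaMulLFunction_ne_zero (herh : ERH) (hχ : χ ≠ 1) {s : ℂ} (hs : 1 / 2 < s.re) :
    zetaMulLFunction χ s ≠ 0 := by
  refine mul_ne_zero ?_ ?_
  · rcases eq_or_ne s 1 with rfl | h1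
    · exact LFunctionTrivChar₁_apply_one_ne_zero 1
    · rw [LFunctionTrivChar₁, Function.update_of_ne h1]
      refine mul_ne_zero (sub_ne_zero.mpr h1) ?_
      rcases lt_or_ge s.re 1 with h | h
      · exact herh 1 1 s hs h
      · exact LFunction_ne_zero_of_one_le_re _ (.inr h1) h
  · rcases lt_or_ge s.re 1 with h | h
    · exact herh N χ s hs h
    · exact LFunction_ne_zero_of_one_le_re _ (.inl hχ) h

theorem differentiable_completedXi (hχ : χ ≠ 1) : Differentiable ℂ (completedXi χ) := by
  have h1 := differentiable_completedLFunction hχ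
  have h2 := differentiable_completedZeta₀
  have hN : (N : ℂ) ≠ 0 := NeZero.ne _
  intro s
  unfold completedXi
  have : DifferentiableAt ℂ (fun s : ℂ ↦ (N : ℂ) ^ (s / 2)) s :=
    DifferentiableAt.const_cpow (by fun_prop) (.inl hN)
  fun_prop

theorem completedXi_eq (hodd : χ.Odd) {s : ℂ} (hs : 0 < s.re) :
    completedXi χ s = (N : ℂ) ^ (s / 2) * (2 * (2 * Real.pi) ^ (-s)) * Gamma (s + 1) *
      zetaMulLFunction χ s := by
  have hs0 : s ≠ 0 := by rintro rfl; simp at hs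
  have hG1 : Gammaℝ (s + 1) ≠ 0 := Gammaℝ_ne_zero_of_re_pos (by simp; linarith)
  have hL : completedLFunction χ s = LFunction χ s * Gammaℝ (s + 1) := by
    rw [LFunction_eq_completed_div_gammaFactor χ s (.inl hs0), hodd.gammaFactor_def,
      div_mul_cancel₀ _ hG1]
  have hGG := Gammaℝ_mul_Gammaℝ_add_one s
  rw [Gammaℂ] at hGG
  have hz : (s * (s - 1) * completedRiemannZeta₀ s + 1) =
      s * Gammaℝ s * LFunctionTrivChar₁ 1 s := by
    rcases eq_or_ne s 1 with rfl | h1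
    · simp [LFunctionTrivChar₁, Gammaℝ_one]
    · have h1' : 1 - s ≠ 0 := sub_ne_zero.mpr h1.symm
      rw [LFunctionTrivChar₁_one_apply h1, riemannZeta_def_of_ne_zero hs0, completedRiemannZeta_eq]
      have := Gammaℝ_ne_zero_of_re_pos hs
      field_simp
      ring
  rw [completedXi, hL, hz, zetaMulLFunction, Complex.Gamma_add_one s hs0]
  linear_combination (N : ℂ) ^ (s / 2) * LFunction χ s * s * LFunctionTrivChar₁ 1 s * hGG

theorem completedXi_ne_zero (herh : ERH) (hodd : χ.Odd) {s : ℂ} (hs : 1 / 2 < s.re) :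
    completedXi χ s ≠ 0 := by
  rw [completedXi_eq hodd (by linarith)]
  have h1 : (N : ℂ) ≠ 0 := NeZero.ne _
  have h2 : (2 * Real.pi : ℂ) ≠ 0 := by simp [Real.pi_ne_zero]
  refine mul_ne_zero (mul_ne_zero (mul_ne_zero ?_ (mul_ne_zero two_ne_zero ?_)) ?_)
    (zetaMulLFunction_ne_zero herh hodd.ne_one hs)
  · simp [cpow_eq_zero_iff, h1]
  · simp [cpow_eq_zero_iff, Real.pi_ne_zero]
  · exact Gamma_ne_zero_of_re_pos (by simp; linarith)

theorem norm_completedXi_one_sub (herh : ERH) (hprim : χ.IsPrimitive) (hodd : χ.Odd)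
    (hinv : χ⁻¹ = χ) (s : ℂ) : ‖completedXi χ (1 - s)‖ = ‖completedXi χ s‖ := by
  have hN : (N : ℂ) ≠ 0 := NeZero.ne _
  have key (s : ℂ) : completedXi χ (1 - s) = rootNumber χ * completedXi χ s := by
    rw [completedXi, completedXi, hprim.completedLFunction_one_sub, hinv,
      completedRiemannZeta₀_one_sub]
    have : (N : ℂ) ^ (s / 2) = (N : ℂ) ^ ((1 - s) / 2) * (N : ℂ) ^ (s - 1 / 2) := by
      rw [← cpow_add _ _ hN]; ring_nf
    rw [this]
    ring
  have h3 : completedXi χ 3 ≠ 0 := completedXi_ne_zero herh hodd (by norm_num)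
  have hW : rootNumber χ * rootNumber χ = 1 := by
    have h := key (1 - 3)
    rw [key 3, sub_sub_cancel, ← mul_assoc] at h
    exact mul_right_cancel₀ h3 (by rw [one_mul, ← h])
  have hW' : ‖rootNumber χ‖ = 1 := by
    have := congrArg norm hW
    rw [norm_mul, norm_one] at this
    nlinarith [norm_nonneg (rootNumber χ)]
  rw [key, norm_mul, hW', one_mul]

theorem completedXi_conj (hodd : χ.Odd) (hinv : χ⁻¹ = χ) (s : ℂ) :
    completedXi χ (conj s) = conj (completedXi χ s) := by
  have hd := differentiable_completedXi hodd.ne_one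
  have hd' : Differentiable ℂ fun s ↦ conj (completedXi χ (conj s)) := fun s ↦
    differentiableAt_conj_conj_iff.mpr hd.differentiableAt
  have heq : (fun s ↦ conj (completedXi χ (conj s))) = completedXi χ := by
    refine AnalyticOnNhd.eq_of_eventuallyEq (z₀ := 2)
      (analyticOnNhd_univ_iff_differentiable.mpr hd')
      (analyticOnNhd_univ_iff_differentiable.mpr hd) ?_
    have : {z : ℂ | 1 < z.re} ∈ 𝓝 (2 : ℂ) :=
      (isOpen_lt continuous_const continuous_re).mem_nhds (by norm_num)
    filter_upwards [this] with z hz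
    have hz : 1 < z.re := hz
    have hz1 : z ≠ 1 := by rintro rfl; simp at hz
    have hcz1 : conj z ≠ 1 := by rwa [map_ne_one_iff _ (starRingEnd ℂ).injective]
    have e1 : conj ((N : ℂ) ^ (conj z / 2)) = (N : ℂ) ^ (z / 2) := by
      have : conj z / 2 = conj (z / 2) := by
        rw [map_div₀, map_ofNat]
      rw [this, cpow_conj _ _ (by rw [natCast_arg]; exact Real.pi_ne_zero.symm), conj_natCast,
        conj_conj]
    have e2 : conj ((2 * Real.pi : ℂ) ^ (-conj z)) = (2 * Real.pi : ℂ) ^ (-z) := by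
      have h2 : (2 * Real.pi : ℂ) = ((2 * Real.pi : ℝ) : ℂ) := by push_cast; rfl
      rw [h2, ← map_neg, cpow_conj _ _ (by
        rw [arg_ofReal_of_nonneg (by positivity)]; exact Real.pi_ne_zero.symm), conj_ofReal,
        conj_conj]
    rw [completedXi_eq hodd (by simp; linarith), completedXi_eq hodd (by linarith),
      zetaMulLFunction, zetaMulLFunction, LFunctionTrivChar₁_one_apply hz1,
      LFunctionTrivChar₁_one_apply hcz1, riemannZeta_conj,
      LFunction_eq_LSeries _ hz, LFunction_eq_LSeries _ (by simpa using hz),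
      LSeries_conj_of_inv_eq hinv]
    simp only [map_mul, conj_conj, map_sub, map_one, e1, e2, ← Gamma_conj, map_add, map_ofNat]
  have : conj (completedXi χ (conj s)) = completedXi χ s := congrFun heq s
  rw [← this, conj_conj]

end

end

section

open Complex Set Filter Topology Metric ComplexConjugate Bornology DirichletCharacter

theorem norm_le_norm_add_ofReal {z : ℂ} (hz : 0 ≤ z.re) {k : ℝ} (hk : 0 ≤ k) : ‖z‖ ≤ ‖z + k‖ := by
  refine abs_le_of_sq_le_sq' ?_ (norm_nonneg _) |>.2
  rw [← normSq_eq_norm_sq, ← normSq_eq_norm_sq, normSq_apply, normSq_apply]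
  simp
  nlinarith

theorem norm_sin_le (z : ℂ) : ‖Complex.sin z‖ ≤ Real.exp |z.im| := by
  have h1 : ‖cexp (-z * I)‖ ≤ Real.exp |z.im| := by
    rw [norm_exp]; gcongr; simpa using le_abs_self z.im
  have h2 : ‖cexp (z * I)‖ ≤ Real.exp |z.im| := by
    rw [norm_exp]; gcongr; simpa using neg_le_abs z.im
  rw [Complex.sin, norm_div, norm_mul, norm_I, mul_one, norm_ofNat, div_le_iff₀ two_pos]
  linarith [norm_sub_le (cexp (-z * I)) (cexp (z * I))]

theorem exp_neg_le_norm_Gamma_half (t : ℝ) :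
    Real.exp (-(2 * |t|)) ≤ ‖Gamma (1 / 2 + t * I)‖ := by
  have h := Complex.Gamma_mul_Gamma_one_sub (1 / 2 + t * I)
  have h1 : (1 - (1 / 2 + t * I) : ℂ) = conj (1 / 2 + t * I) := by
    simp [Complex.ext_iff]; norm_num
  rw [h1, Gamma_conj, mul_conj] at h
  have h2 := congrArg norm h
  rw [norm_div, norm_real, norm_real, Real.norm_of_nonneg (normSq_nonneg _),
    Real.norm_of_nonneg Real.pi_pos.le, normSq_eq_norm_sq] at h2
  refine abs_le_of_sq_le_sq' ?_ (norm_nonneg _) |>.2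
  rw [h2]
  have h3 := norm_sin_le (Real.pi * (1 / 2 + t * I))
  have h4 : (Real.pi * (1 / 2 + t * I) : ℂ).im = Real.pi * t := by simp
  rw [h4, abs_mul, abs_of_pos Real.pi_pos] at h3
  have h5 : 0 < ‖Complex.sin (Real.pi * (1 / 2 + t * I))‖ := by
    by_contra! h0
    rw [norm_le_zero_iff] at h0
    rw [h0] at h2
    simp only [norm_zero, div_zero] at h2
    have : Gamma (1 / 2 + t * I) ≠ 0 := Gamma_ne_zero_of_re_pos (by simp)
    simp_all
  rw [le_div_iff₀ h5, ← Real.exp_nat_mul]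
  calc _ ≤ Real.exp ((2 : ℕ) * -(2 * |t|)) * Real.exp (Real.pi * |t|) := by gcongr
    _ = Real.exp ((Real.pi - 4) * |t|) := by rw [← Real.exp_add]; congr 1; push_cast; ring
    _ ≤ 1 := by
      rw [Real.exp_le_one_iff]
      nlinarith [Real.pi_le_four, abs_nonneg t]
    _ ≤ Real.pi := by linarith [Real.pi_gt_three]

theorem exp_neg_le_norm_Gamma (t : ℝ) :
    Real.exp (-(2 * |t|)) ≤ ‖Gamma (7 / 2 + t * I + 1)‖ := by
  have key (a : ℝ) (ha : 0 < a) : a * ‖Gamma (a + t * I)‖ ≤ ‖Gamma (a + t * I + 1)‖ := by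
    have h0 : (a + t * I : ℂ).re = a := by simp
    have h1 : (a + t * I : ℂ) ≠ 0 := by intro h; rw [h] at h0; simp at h0; linarith
    rw [Complex.Gamma_add_one _ h1, norm_mul]
    gcongr
    conv_lhs => rw [← h0]
    exact re_le_norm _
  have e0 := exp_neg_le_norm_Gamma_half t
  have e1 := key (1 / 2) (by norm_num)
  have e2 := key (3 / 2) (by norm_num)
  have e3 := key (5 / 2) (by norm_num)
  have e4 := key (7 / 2) (by norm_num)
  push_cast at e1 e2 e3 e4
  rw [show (1 / 2 + t * I + 1 : ℂ) = 3 / 2 + t * I by ring] at e1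
  rw [show (3 / 2 + t * I + 1 : ℂ) = 5 / 2 + t * I by ring] at e2
  rw [show (5 / 2 + t * I + 1 : ℂ) = 7 / 2 + t * I by ring] at e3
  linarith [norm_nonneg (Gamma (1 / 2 + t * I))]

theorem exists_norm_Gamma_le_norm_Gamma_add {k : ℝ} (hk : 0 < k) :
    ∃ C : ℝ, 0 ≤ C ∧ ∀ w : ℂ, 1 ≤ w.re → ‖Gamma w‖ ≤ C * ‖Gamma (w + k)‖ := by
  have hbeta := betaIntegral_convergent (u := 1) (v := k) (by simp) (by simpa)
  have hG : 0 < ‖Gamma k‖ := norm_pos_iff.mpr (Gamma_ne_zero_of_re_pos (by simpa))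
  set B : ℝ := ∫ x in (0 : ℝ)..1, ‖(x : ℂ) ^ ((1 : ℂ) - 1) * (1 - (x : ℂ)) ^ ((k : ℂ) - 1)‖
  have hB : 0 ≤ B := intervalIntegral.integral_nonneg zero_le_one fun _ _ ↦ norm_nonneg _
  refine ⟨B / ‖Gamma k‖, by positivity, fun w hw ↦ ?_⟩
  have hb : ‖betaIntegral w k‖ ≤ B := by
    refine intervalIntegral.norm_integral_le_of_norm_le zero_le_one ?_ hbeta.norm
    refine Filter.Eventually.of_forall fun x hx ↦ ?_
    rw [norm_mul, norm_mul, sub_self, cpow_zero, norm_one]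
    gcongr
    rw [norm_cpow_eq_rpow_re_of_pos hx.1]
    exact Real.rpow_le_one hx.1.le hx.2 (by simpa using hw)
  have h := Complex.Gamma_mul_Gamma_eq_betaIntegral (s := w) (t := k) (by linarith) (by simpa)
  have h' := congrArg norm h
  rw [norm_mul, norm_mul] at h'
  rw [div_mul_eq_mul_div, le_div_iff₀ hG, h', mul_comm]
  gcongr

section
variable {N : ℕ} [NeZero N] {χ : DirichletCharacter ℂ N}

theorem exists_norm_completedXi_le (hodd : χ.Odd) : ∃ C : ℝ, 0 ≤ C ∧ ∀ s : ℂ, -1 ≤ s.re →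
    s.re ≤ 7 → ‖completedXi χ s‖ ≤ Real.exp (C * (1 + |s.im|)) := by
  obtain ⟨C₁, h₁⟩ := hodd.exists_norm_completedLFunction_le (-1) 7
  obtain ⟨C₂, h₂⟩ := exists_norm_completedRiemannZeta₀_le (-1) 7
  have hC₁ : 0 ≤ C₁ := (norm_nonneg _).trans (h₁ 0 (by simp) (by simp))
  have hC₂ : 0 ≤ C₂ := (norm_nonneg _).trans (h₂ 0 (by simp) (by simp))
  have hN : 1 ≤ (N : ℝ) := by exact_mod_cast NeZero.one_le
  set K : ℝ := (N : ℝ) ^ (7 / 2 : ℝ) * C₁ * (C₂ + 1) with hK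
  have hK0 : 0 ≤ K := by positivity
  refine ⟨K + 14, by positivity, fun s hs1 hs2 ↦ ?_⟩
  have hs : ‖s‖ ≤ 7 + |s.im| := (norm_le_abs_re_add_abs_im s).trans (by
    gcongr; exact abs_le.mpr ⟨by linarith, hs2⟩)
  have hs' : ‖s - 1‖ ≤ 7 + |s.im| := (norm_le_abs_re_add_abs_im _).trans (by
    simp only [sub_re, one_re, sub_im, one_im, sub_zero]
    gcongr; exact abs_le.mpr ⟨by linarith, by linarith⟩)
  set E := Real.exp (7 + |s.im|) with hE
  have hE1 : 1 ≤ E := Real.one_le_exp (by positivity)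
  have hle : 7 + |s.im| ≤ E := by linarith [Real.add_one_le_exp (7 + |s.im|)]
  have hNs : ‖(N : ℂ) ^ (s / 2)‖ ≤ (N : ℝ) ^ (7 / 2 : ℝ) := by
    rw [norm_natCast_cpow_of_pos (NeZero.pos N)]
    refine Real.rpow_le_rpow_of_exponent_le hN ?_
    simp; linarith
  calc ‖completedXi χ s‖ ≤ (N : ℝ) ^ (7 / 2 : ℝ) * C₁ * (E * E * C₂ + 1) := by
        rw [completedXi, norm_mul, norm_mul]
        gcongr
        · exact h₁ s hs1 hs2
        · refine (norm_add_le _ _).trans ?_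
          rw [norm_mul, norm_mul, norm_one]
          gcongr
          · exact hs.trans hle
          · exact hs'.trans hle
          · exact h₂ s hs1 hs2
    _ ≤ (N : ℝ) ^ (7 / 2 : ℝ) * C₁ * (E * E * (C₂ + 1)) := by
        gcongr; nlinarith
    _ = K * (E * E) := by rw [hK]; ring
    _ ≤ Real.exp K * (E * E) := by
        gcongr; linarith [Real.add_one_le_exp K]
    _ = Real.exp (K + 14 + 2 * |s.im|) := by
        rw [hE, ← Real.exp_add, ← Real.exp_add]; ring_nf
    _ ≤ _ := by
        gcongr
        nlinarith [abs_nonneg s.im]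

theorem exists_zetaMulLFunction_bounds : ∃ M : ℝ, 0 < M ∧ ∀ (N : ℕ) [NeZero N]
    (χ : DirichletCharacter ℂ N) (s : ℂ), 2 ≤ s.re →
    ‖zetaMulLFunction χ s‖ ≤ M * ‖s - 1‖ ∧ M⁻¹ * ‖s - 1‖ ≤ ‖zetaMulLFunction χ s‖ := by
  obtain ⟨M, hM, h⟩ := exists_norm_LFunction_bounds
  refine ⟨M * M, by positivity, fun N _ χ s hs ↦ ?_⟩
  have h1 : s ≠ 1 := by rintro rfl; norm_num at hs
  obtain ⟨a1, a2⟩ := h N χ s hs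
  obtain ⟨b1, b2⟩ := h 1 1 s hs
  rw [zetaMulLFunction, LFunctionTrivChar₁_one_apply h1, norm_mul, norm_mul,
    ← LFunction_modOne_eq (χ := 1)]
  constructor
  · calc _ ≤ ‖s - 1‖ * M * M := by gcongr
      _ = _ := by ring
  · calc _ = ‖s - 1‖ * M⁻¹ * M⁻¹ := by rw [mul_inv]; ring
      _ ≤ _ := by gcongr

theorem norm_two_mul_two_pi_cpow (s : ℂ) :
    ‖(2 * (2 * Real.pi) ^ (-s) : ℂ)‖ = 2 * (2 * Real.pi) ^ (-s.re) := by
  have h2 : (2 * Real.pi : ℂ) = ((2 * Real.pi : ℝ) : ℂ) := by push_cast; rfl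
  rw [norm_mul, norm_ofNat, h2, norm_cpow_eq_rpow_re_of_pos (by positivity), neg_re]

theorem exists_exp_neg_le_norm_completedXi (hodd : χ.Odd) : ∃ C : ℝ, 0 ≤ C ∧ ∀ t : ℝ,
    Real.exp (-(C * (1 + |t|))) ≤ ‖completedXi χ (7 / 2 + t * I)‖ := by
  obtain ⟨M, hM, h⟩ := exists_zetaMulLFunction_bounds
  have hN : 1 ≤ (N : ℝ) := by exact_mod_cast NeZero.one_le
  set c : ℝ := 2 * (2 * Real.pi) ^ (-(7 / 2) : ℝ) * M⁻¹ with hc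
  have hc0 : 0 < c := by positivity
  refine ⟨|Real.log c| + 2, by positivity, fun t ↦ ?_⟩
  have hre : (7 / 2 + t * I : ℂ).re = 7 / 2 := by simp
  rw [completedXi_eq hodd (by rw [hre]; norm_num), norm_mul, norm_mul, norm_mul,
    norm_natCast_cpow_of_pos (NeZero.pos N), norm_two_mul_two_pi_cpow, hre]
  have h1 : 1 ≤ (N : ℝ) ^ ((7 / 2 + t * I : ℂ) / 2).re :=
    Real.one_le_rpow hN (by simp; norm_num)
  have h2 : M⁻¹ ≤ ‖zetaMulLFunction χ (7 / 2 + t * I)‖ := by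
    refine le_trans ?_ (h N χ _ (by rw [hre]; norm_num)).2
    have : 1 ≤ ‖(7 / 2 + t * I - 1 : ℂ)‖ := by
      refine le_trans ?_ (re_le_norm _)
      simp; norm_num
    nlinarith [inv_pos.mpr hM]
  calc _ ≤ Real.exp (Real.log c + -(2 * |t|)) := by
        gcongr
        nlinarith [neg_abs_le (Real.log c), abs_nonneg t, abs_nonneg (Real.log c)]
    _ = 1 * (2 * (2 * Real.pi) ^ (-(7 / 2) : ℝ)) * Real.exp (-(2 * |t|)) * M⁻¹ := by
        rw [Real.exp_add, Real.exp_log hc0, hc]; ring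
    _ ≤ _ := by
        gcongr
        exact exp_neg_le_norm_Gamma t

theorem exists_norm_completedXi_le_norm_completedXi_add (hodd : χ.Odd) {k : ℝ} (hk : 0 < k) :
    ∃ C : ℝ, ∀ w : ℂ, 3 ≤ w.re → ‖completedXi χ w‖ ≤ C * ‖completedXi χ (w + k)‖ := by
  obtain ⟨M, hM, h⟩ := exists_zetaMulLFunction_bounds
  obtain ⟨B, hB, hG⟩ := exists_norm_Gamma_le_norm_Gamma_add hk
  have hN : 1 ≤ (N : ℝ) := by exact_mod_cast NeZero.one_le
  refine ⟨(2 * Real.pi) ^ k * B * (M * M), fun w hw ↦ ?_⟩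
  have hre : (w + k : ℂ).re = w.re + k := by simp
  rw [completedXi_eq hodd (by linarith), completedXi_eq hodd (by rw [hre]; linarith)]
  rw [norm_mul, norm_mul, norm_mul, norm_mul (_ * _ * _), norm_mul (_ * _), norm_mul (_ ^ _),
    norm_natCast_cpow_of_pos (NeZero.pos N), norm_natCast_cpow_of_pos (NeZero.pos N),
    norm_two_mul_two_pi_cpow, norm_two_mul_two_pi_cpow, hre]
  have h1 : (N : ℝ) ^ (w / 2).re ≤ (N : ℝ) ^ ((w + k) / 2).re := by
    refine Real.rpow_le_rpow_of_exponent_le hN ?_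
    simp; linarith
  have h2 : 2 * (2 * Real.pi) ^ (-w.re) =
      (2 * Real.pi) ^ k * (2 * (2 * Real.pi) ^ (-(w.re + k))) := by
    rw [neg_add, Real.rpow_add (by positivity), Real.rpow_neg (by positivity) k]
    field_simp
  have h3 : ‖Gamma (w + 1)‖ ≤ B * ‖Gamma (w + k + 1)‖ := by
    have := hG (w + 1) (by simp; linarith)
    rwa [add_right_comm] at this
  have h4 : ‖zetaMulLFunction χ w‖ ≤ M * M * ‖zetaMulLFunction χ (w + k)‖ := by
    have a1 := (h N χ w (by linarith)).1
    have a2 := (h N χ (w + k) (by rw [hre]; linarith)).2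
    have a3 : ‖w - 1‖ ≤ ‖w + k - 1‖ := by
      rw [add_sub_right_comm]
      exact norm_le_norm_add_ofReal (by simp; linarith) hk.le
    rw [inv_mul_le_iff₀ hM] at a2
    calc _ ≤ M * ‖w - 1‖ := a1
      _ ≤ M * ‖w + k - 1‖ := by gcongr
      _ ≤ M * (M * ‖zetaMulLFunction χ (w + k)‖) := by gcongr
      _ = _ := by ring
  rw [h2]
  calc _ ≤ (N : ℝ) ^ ((w + k) / 2).re * ((2 * Real.pi) ^ k * (2 * (2 * Real.pi) ^ (-(w.re + k)))) *
        (B * ‖Gamma (w + k + 1)‖) * (M * M * ‖zetaMulLFunction χ (w + k)‖) := by gcongr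
    _ = _ := by ring

theorem norm_completedXi_sub_le (herh : ERH) (hprim : χ.IsPrimitive) (hodd : χ.Odd)
    (hinv : χ⁻¹ = χ) {h : ℝ} (h0 : 0 < h) (h1 : h ≤ 1 / 2) {s : ℂ} (hs : 1 / 2 ≤ s.re) :
    ‖completedXi χ (s - h)‖ ≤ ‖completedXi χ (s + h)‖ := by
  obtain ⟨C₁, hC₁, hup⟩ := exists_norm_completedXi_le hodd
  obtain ⟨C₂, hC₂, hlow⟩ := exists_exp_neg_le_norm_completedXi hodd
  refine norm_sub_le_norm_add_of_symm (C := C₁ + C₂ + 1) (by positivity)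
    (differentiable_completedXi hodd.ne_one) (fun s ↦ ?_)
    (fun s hs ↦ completedXi_ne_zero herh hodd hs) (fun s hs1 hs2 ↦ ?_) (fun t ↦ ?_) h0 h1 ?_ hs
  · rw [norm_completedXi_one_sub herh hprim hodd hinv, completedXi_conj hodd hinv, norm_conj]
  · refine (hup s hs1 hs2).trans ?_
    gcongr
    linarith
  · refine le_trans ?_ (hlow t)
    gcongr
    linarith
  · obtain ⟨C, hC⟩ :=
      exists_norm_completedXi_le_norm_completedXi_add hodd (k := 2 * h) (by linarith)
    refine ⟨C, fun s hs ↦ ?_⟩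
    have := hC (s - h) (by simp; linarith)
    rwa [show s - h + (2 * h : ℝ) = s + h by push_cast; ring] at this

theorem re_logDeriv_completedXi_nonneg (herh : ERH) (hprim : χ.IsPrimitive) (hodd : χ.Odd)
    (hinv : χ⁻¹ = χ) {s : ℂ} (hs : 1 / 2 < s.re) : 0 ≤ (logDeriv (completedXi χ) s).re := by
  refine re_logDeriv_nonneg (differentiable_completedXi hodd.ne_one s)
    (completedXi_ne_zero herh hodd hs) ?_
  filter_upwards [Ioc_mem_nhdsGT (show (0 : ℝ) < 1 / 2 by norm_num)] with h hh
  exact norm_completedXi_sub_le herh hprim hodd hinv hh.1 hh.2 hs.le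

theorem logDeriv_completedXi (herh : ERH) (hodd : χ.Odd) {s : ℂ} (hs : 1 / 2 < s.re) :
    logDeriv (completedXi χ) s = Real.log N / 2 - Real.log (2 * Real.pi) +
      logDeriv Gamma (s + 1) + logDeriv (zetaMulLFunction χ) s := by
  have hN : (N : ℂ) ≠ 0 := NeZero.ne _
  have hpi : (2 * Real.pi : ℂ) ≠ 0 := by simp [Real.pi_ne_zero]
  have hs1 : 0 < s.re := by linarith
  have hev : completedXi χ =ᶠ[𝓝 s] fun s ↦ (N : ℂ) ^ (s / 2) * (2 * (2 * Real.pi) ^ (-s)) *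
      Gamma (s + 1) * zetaMulLFunction χ s := by
    filter_upwards [(isOpen_lt continuous_const continuous_re).mem_nhds hs1] with z hz
    exact completedXi_eq hodd hz
  have hG0 : Gamma (s + 1) ≠ 0 := Gamma_ne_zero_of_re_pos (by simp; linarith)
  have hGd : DifferentiableAt ℂ Gamma (s + 1) := differentiableAt_Gamma _ fun m hm ↦ by
    have := congrArg re hm
    simp at this
    linarith [(Nat.cast_nonneg m : (0 : ℝ) ≤ m)]
  have d1 : HasDerivAt (fun s : ℂ ↦ (N : ℂ) ^ (s / 2)) ((N : ℂ) ^ (s / 2) * log N * (1 / 2)) s :=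
    ((hasDerivAt_id s).div_const 2).const_cpow (.inl hN)
  have d2 : HasDerivAt (fun s : ℂ ↦ 2 * (2 * Real.pi : ℂ) ^ (-s))
      (2 * ((2 * Real.pi : ℂ) ^ (-s) * log (2 * Real.pi) * (-1))) s :=
    (((hasDerivAt_id s).neg).const_cpow (.inl hpi)).const_mul 2
  have d3 : HasDerivAt (fun s : ℂ ↦ Gamma (s + 1)) (deriv Gamma (s + 1)) s :=
    hGd.hasDerivAt.comp_add_const s 1
  have n1 : (N : ℂ) ^ (s / 2) ≠ 0 := by simp [cpow_eq_zero_iff, hN]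
  have n2 : (2 * Real.pi : ℂ) ^ (-s) ≠ 0 := by simp [cpow_eq_zero_iff, Real.pi_ne_zero]
  have n2' : (2 * (2 * Real.pi) ^ (-s) : ℂ) ≠ 0 := mul_ne_zero two_ne_zero n2
  have hl1 : (log N : ℂ) = Real.log N := by rw [natCast_log]
  have hl2 : (log (2 * Real.pi) : ℂ) = Real.log (2 * Real.pi) := by
    rw [ofReal_log (by positivity)]; push_cast; rfl
  rw [show logDeriv (completedXi χ) s = logDeriv (fun s ↦ (N : ℂ) ^ (s / 2) *
      (2 * (2 * Real.pi) ^ (-s)) * Gamma (s + 1) * zetaMulLFunction χ s) s by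
      rw [logDeriv_apply, logDeriv_apply, hev.deriv_eq, hev.eq_of_nhds]]
  have e1 := logDeriv_mul (f := fun s : ℂ ↦ (N : ℂ) ^ (s / 2))
    (g := fun s ↦ 2 * (2 * Real.pi : ℂ) ^ (-s)) s n1 n2' d1.differentiableAt d2.differentiableAt
  have e2 := logDeriv_mul (f := fun s : ℂ ↦ (N : ℂ) ^ (s / 2) * (2 * (2 * Real.pi : ℂ) ^ (-s)))
    (g := fun s ↦ Gamma (s + 1)) s (mul_ne_zero n1 n2') hG0
    (d1.differentiableAt.mul d2.differentiableAt) d3.differentiableAt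
  have e3 := logDeriv_mul
    (f := fun s : ℂ ↦ (N : ℂ) ^ (s / 2) * (2 * (2 * Real.pi : ℂ) ^ (-s)) * Gamma (s + 1))
    (g := zetaMulLFunction χ) s (mul_ne_zero (mul_ne_zero n1 n2') hG0)
    (zetaMulLFunction_ne_zero herh hodd.ne_one hs)
    ((d1.differentiableAt.mul d2.differentiableAt).mul d3.differentiableAt)
    (differentiable_zetaMulLFunction hodd.ne_one s)
  rw [e3, e2, e1]
  simp only [logDeriv_apply, d1.deriv, d2.deriv, d3.deriv, hl1, hl2]
  field_simp
  ring

/-- Under ERH, a lower bound for the real part of the logarithmic derivative of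
`(s - 1) ζ(s) L(s, χ)` to the right of the critical line. -/
theorem neg_le_re_logDeriv_zetaMulLFunction (herh : ERH) (hprim : χ.IsPrimitive) (hodd : χ.Odd)
    (hinv : χ⁻¹ = χ) {s : ℂ} (hs : 1 / 2 < s.re) :
    -(Real.log N / 2 - Real.log (2 * Real.pi) + 1 / 2 + Real.log ‖s + 1‖) ≤
      (logDeriv (zetaMulLFunction χ) s).re := by
  have h1 := re_logDeriv_completedXi_nonneg herh hprim hodd hinv hs
  have h2 := re_logDeriv_Gamma_le (w := s + 1) (by simp; linarith)
  rw [logDeriv_completedXi herh hodd hs] at h1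
  have h3 : ((Real.log N / 2 - Real.log (2 * Real.pi) : ℂ)).re =
      Real.log N / 2 - Real.log (2 * Real.pi) := by
    have : (Real.log N / 2 - Real.log (2 * Real.pi) : ℂ) =
      ((Real.log N / 2 - Real.log (2 * Real.pi) : ℝ) : ℂ) := by push_cast; rfl
    rw [this, ofReal_re]
  simp only [add_re, h3] at h1
  linarith

end

end

section

open Complex Set Filter Topology MeasureTheory FourierTransform

/-- The tent function supported on `[-2, 2]` of height `1`. -/
noncomputable def tent (v : ℝ) : ℝ := max 0 (1 - |v| / 2)

/-- The bilateral Laplace transform `2 (sinh w / w) ^ 2` of the tent function. -/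
noncomputable def tentTransform (w : ℂ) : ℂ := 2 * dslope Complex.sinh 0 w ^ 2

theorem tent_nonneg (v : ℝ) : 0 ≤ tent v := le_max_left _ _

theorem tent_le_one (v : ℝ) : tent v ≤ 1 :=
  max_le zero_le_one (by linarith [abs_nonneg v])

theorem tent_of_two_le_abs {v : ℝ} (hv : 2 ≤ |v|) : tent v = 0 :=
  max_eq_left (by linarith)

theorem tent_of_abs_le_two {v : ℝ} (hv : |v| ≤ 2) : tent v = 1 - |v| / 2 :=
  max_eq_right (by linarith)

theorem continuous_tent : Continuous tent := by unfold tent; fun_prop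

theorem differentiable_tentTransform : Differentiable ℂ tentTransform := by
  have : Differentiable ℂ (dslope Complex.sinh 0) := by
    rw [← differentiableOn_univ, Complex.differentiableOn_dslope univ_mem]
    exact Complex.differentiable_sinh.differentiableOn
  unfold tentTransform
  fun_prop

theorem tentTransform_zero : tentTransform 0 = 2 := by
  simp [tentTransform, dslope_same]

theorem tentTransform_of_ne_zero {w : ℂ} (hw : w ≠ 0) :
    tentTransform w = 2 * (Complex.sinh w / w) ^ 2 := by
  rw [tentTransform, dslope_of_ne _ hw, slope_def_field]
  simp

theorem tent_mul_exp_eq_zero {w : ℂ} {v : ℝ} (hv : v ∉ Ioc (-2 : ℝ) 2) :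
    (tent v : ℂ) * cexp (w * v) = 0 := by
  rw [tent_of_two_le_abs, ofReal_zero, zero_mul]
  rw [mem_Ioc, not_and_or, not_lt, not_le] at hv
  rcases hv with h | h
  · rw [abs_of_nonpos (by linarith)]; linarith
  · rw [abs_of_nonneg (by linarith)]; exact h.le

theorem integrable_tent_mul_exp (w : ℂ) : Integrable fun v : ℝ ↦ (tent v : ℂ) * cexp (w * v) := by
  refine Continuous.integrable_of_hasCompactSupport ?_ ?_
  · have := continuous_tent
    fun_prop
  · refine HasCompactSupport.intro (K := Icc (-2) 2) isCompact_Icc fun v hv ↦ ?_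
    exact tent_mul_exp_eq_zero fun h ↦ hv (Ioc_subset_Icc_self h)

theorem integral_tent_mul_exp (w : ℂ) :
    ∫ v : ℝ, (tent v : ℂ) * cexp (w * v) = tentTransform w := by
  have hinteg (a b : ℝ) : IntervalIntegrable (fun v : ℝ ↦ (tent v : ℂ) * cexp (w * v)) volume a b :=
    (integrable_tent_mul_exp w).intervalIntegrable
  have hcont : Continuous fun v : ℝ ↦ (tent v : ℂ) * cexp (w * v) := by
    have := continuous_tent
    fun_prop
  rw [← setIntegral_eq_integral_of_forall_compl_eq_zero (s := Ioc (-2) 2)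
    (fun v hv ↦ tent_mul_exp_eq_zero hv), ← intervalIntegral.integral_of_le (by norm_num),
    ← intervalIntegral.integral_add_adjacent_intervals (hinteg (-2) 0) (hinteg 0 2)]
  have hneg := intervalIntegral.integral_comp_neg (a := 0) (b := 2)
    fun v : ℝ ↦ (tent v : ℂ) * cexp (w * v)
  rw [neg_zero] at hneg
  have hneg' : IntervalIntegrable (fun v : ℝ ↦ (tent (-v) : ℂ) * cexp (w * (-v : ℝ))) volume 0 2 :=
    (hcont.comp continuous_neg).intervalIntegrable _ _
  rw [← hneg, ← intervalIntegral.integral_add hneg' (hinteg 0 2)]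
  have hcongr : ∫ v in (0 : ℝ)..2, (tent (-v) : ℂ) * cexp (w * (-v : ℝ)) + tent v * cexp (w * v) =
      ∫ v in (0 : ℝ)..2, (1 - v / 2 : ℂ) * (cexp (w * v) + cexp (-w * v)) := by
    refine intervalIntegral.integral_congr fun v hv ↦ ?_
    rw [uIcc_of_le zero_le_two] at hv
    have h1 : |v| = v := abs_of_nonneg hv.1
    have h2 : tent v = 1 - v / 2 := by rw [tent_of_abs_le_two (by rw [h1]; exact hv.2), h1]
    have h3 : tent (-v) = tent v := by simp [tent]
    simp only [h3, h2]
    push_cast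
    rw [mul_neg, neg_mul]
    ring
  rw [hcongr]
  rcases eq_or_ne w 0 with rfl | hw
  · rw [tentTransform_zero]
    have hd (v : ℝ) (_ : v ∈ uIcc (0 : ℝ) 2) :
        HasDerivAt (fun v : ℝ ↦ (2 * v - v ^ 2 / 2 : ℂ))
          ((1 - v / 2 : ℂ) * (cexp (0 * v) + cexp (-0 * v))) v := by
      have h0 : HasDerivAt (fun v : ℂ ↦ (2 * v - v ^ 2 / 2 : ℂ))
          (2 * 1 - (2 : ℕ) * (v : ℂ) ^ (2 - 1) * 1 / 2) v :=
        ((hasDerivAt_id _).const_mul _).sub (((hasDerivAt_id _).pow 2).div_const 2)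
      convert h0.comp_ofReal using 1
      simp
      ring
    rw [intervalIntegral.integral_eq_sub_of_hasDerivAt hd
      ((by fun_prop : Continuous _).intervalIntegrable _ _)]
    norm_num
  · have hd (v : ℝ) (_ : v ∈ uIcc (0 : ℝ) 2) :
        HasDerivAt (fun v : ℝ ↦ (1 - v / 2 : ℂ) * (cexp (w * v) - cexp (-w * v)) / w +
          (cexp (w * v) + cexp (-w * v)) / (2 * w ^ 2))
          ((1 - v / 2 : ℂ) * (cexp (w * v) + cexp (-w * v))) v := by
      have he (z : ℂ) : HasDerivAt (fun v : ℂ ↦ cexp (z * v)) (cexp (z * v) * (z * 1)) v :=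
        ((hasDerivAt_id (v : ℂ)).const_mul z).cexp
      have h1 : HasDerivAt (fun v : ℂ ↦ 1 - v / 2) (-(1 / 2)) v :=
        ((hasDerivAt_id (v : ℂ)).div_const 2).const_sub 1
      have h2 := ((h1.mul ((he w).sub (he (-w)))).div_const w).add
        (((he w).add (he (-w))).div_const (2 * w ^ 2))
      refine h2.comp_ofReal.congr_deriv ?_
      simp only [Pi.sub_apply]
      field_simp
      ring
    rw [intervalIntegral.integral_eq_sub_of_hasDerivAt hd
      ((by fun_prop : Continuous _).intervalIntegrable _ _),
    tentTransform_of_ne_zero hw, Complex.sinh]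
    have e1 : cexp (w * (2 : ℝ)) = cexp w ^ 2 := by rw [← Complex.exp_nat_mul]; push_cast; ring_nf
    have e2 : cexp (-w * (2 : ℝ)) = cexp (-w) ^ 2 := by
      rw [← Complex.exp_nat_mul]; push_cast; ring_nf
    have e3 : cexp w * cexp (-w) = 1 := by rw [← Complex.exp_add]; simp
    rw [e1, e2]
    push_cast
    simp only [mul_zero, Complex.exp_zero]
    field_simp
    linear_combination 2 * e3

theorem norm_tentTransform_le (w : ℂ) :
    ‖tentTransform w‖ ≤ 6 * Real.exp (2 * |w.re|) * (1 + w.im ^ 2)⁻¹ := by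
  rw [← div_eq_mul_inv, le_div_iff₀ (by positivity)]
  have h1 : ‖tentTransform w‖ ≤ 4 * Real.exp (2 * |w.re|) := by
    rw [← integral_tent_mul_exp, ← setIntegral_eq_integral_of_forall_compl_eq_zero (s := Ioc (-2) 2)
      (fun v hv ↦ tent_mul_exp_eq_zero hv), ← intervalIntegral.integral_of_le (by norm_num)]
    refine (intervalIntegral.norm_integral_le_of_norm_le_const (C := Real.exp (2 * |w.re|))
      fun v hv ↦ ?_).trans (by norm_num; linarith)
    rw [uIoc_of_le (by norm_num)] at hv
    rw [norm_mul, norm_real, Real.norm_of_nonneg (tent_nonneg v), norm_exp, re_mul_ofReal]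
    have h2 : w.re * v ≤ 2 * |w.re| := by
      refine (le_abs_self _).trans ?_
      rw [abs_mul, mul_comm]
      gcongr
      exact abs_le.mpr ⟨hv.1.le, hv.2⟩
    calc _ ≤ 1 * Real.exp (2 * |w.re|) := by gcongr; exact tent_le_one v
      _ = _ := one_mul _
  have h2 : ‖tentTransform w‖ * w.im ^ 2 ≤ 2 * Real.exp (2 * |w.re|) := by
    rcases eq_or_ne w 0 with rfl | hw
    · simp
    have hw' : 0 < ‖w‖ := norm_pos_iff.mpr hw
    have hs : ‖Complex.sinh w‖ ≤ Real.exp |w.re| := by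
      rw [Complex.sinh, norm_div, norm_ofNat, div_le_iff₀ two_pos]
      refine (norm_sub_le _ _).trans ?_
      rw [norm_exp, norm_exp, neg_re]
      have := Real.exp_le_exp.mpr (le_abs_self w.re)
      have := Real.exp_le_exp.mpr (neg_le_abs w.re)
      linarith
    have him : w.im ^ 2 ≤ ‖w‖ ^ 2 := by
      rw [← sq_abs]; gcongr; exact abs_im_le_norm w
    rw [tentTransform_of_ne_zero hw, norm_mul, norm_pow, norm_div, norm_ofNat]
    calc _ ≤ 2 * (Real.exp |w.re| / ‖w‖) ^ 2 * ‖w‖ ^ 2 := by gcongr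
      _ = 2 * Real.exp |w.re| ^ 2 := by field_simp
      _ = _ := by rw [← Real.exp_nat_mul]; norm_num
  linarith

theorem integrable_tentTransform (c : ℝ) : Integrable fun t : ℝ ↦ tentTransform (c + t * I) := by
  have hd := differentiable_tentTransform.continuous
  refine (integrable_inv_one_add_sq.const_mul (6 * Real.exp (2 * |c|))).mono'
    (by fun_prop : Continuous _).aestronglyMeasurable (Eventually.of_forall fun t ↦ ?_)
  simpa using norm_tentTransform_le (c + t * I)

/-- Fourier inversion for the tent function on a vertical line. -/
theorem integral_tentTransform_mul_exp (c u : ℝ) :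
    ∫ t : ℝ, tentTransform (c + t * I) * cexp (-(c + t * I) * u) = 2 * Real.pi * tent u := by
  set f : ℝ → ℂ := fun v ↦ (tent v : ℂ) * cexp (c * v) with hf
  have h1 (ξ : ℝ) : 𝓕⁻ f ξ = tentTransform (c + (2 * Real.pi * ξ : ℝ) * I) := by
    rw [Real.fourierInv_eq', ← integral_tent_mul_exp]
    congr 1
    ext v
    rw [smul_eq_mul, hf, mul_left_comm, ← Complex.exp_add]
    simp only [RCLike.inner_apply, conj_trivial]
    congr 2
    push_cast
    ring
  have h2 : Continuous f := by
    have := continuous_tent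
    fun_prop
  have h3 : Integrable (𝓕 f) := by
    have : 𝓕 f = fun ξ ↦ tentTransform (c + ((-(2 * Real.pi)) * ξ : ℝ) * I) := by
      ext ξ
      rw [← neg_neg ξ, ← Real.fourierInv_eq_fourier_neg, h1]
      simp
    rw [this]
    exact (integrable_tentTransform c).comp_mul_left' (neg_ne_zero.mpr Real.two_pi_pos.ne')
  have h4 := congrFun (h2.fourier_fourierInv_eq (integrable_tent_mul_exp c) h3) u
  rw [Real.fourier_real_eq_integral_exp_smul] at h4
  have h5 (t : ℝ) : cexp ((-2 * Real.pi * t * u : ℝ) * I) • 𝓕⁻ f t =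
      (fun t : ℝ ↦ cexp (-(t * I) * u) * tentTransform (c + t * I)) (2 * Real.pi * t) := by
    rw [h1, smul_eq_mul]
    push_cast
    ring_nf
  rw [integral_congr_ae (Eventually.of_forall h5), Measure.integral_comp_mul_left
    (fun t : ℝ ↦ cexp (-(t * I) * u) * tentTransform (c + t * I)),
    abs_of_pos (by positivity), real_smul] at h4
  have h6 : ∀ t : ℝ, tentTransform (c + t * I) * cexp (-(c + t * I) * u) =
      cexp (-(c * u)) * (cexp (-(t * I) * u) * tentTransform (c + t * I)) := fun t ↦ by
    rw [← mul_assoc, ← Complex.exp_add, mul_comm]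
    ring_nf
  simp_rw [h6]
  have hpi : (Real.pi : ℂ) ≠ 0 := by exact_mod_cast Real.pi_ne_zero
  rw [integral_const_mul]
  push_cast at h4
  rw [inv_mul_eq_iff_eq_mul₀ (by simp [hpi])] at h4
  rw [h4, hf]
  have : cexp (-(c * u)) * cexp (c * u) = 1 := by rw [← Complex.exp_add]; simp
  linear_combination (2 * Real.pi * tent u) * this

end

section

open Complex Set Filter Topology MeasureTheory

theorem hasDerivAt_log_div_add_arctan {t : ℝ} (ht : 0 < t) :
    HasDerivAt (fun t ↦ Real.arctan (t / 2) - Real.log (1 + t ^ 2 / 4) / t)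
      (Real.log (1 + t ^ 2 / 4) / t ^ 2) t := by
  have h1 : HasDerivAt (fun t : ℝ ↦ 1 + t ^ 2 / 4) (((2 : ℕ) * t ^ (2 - 1) * 1) / 4) t :=
    (((hasDerivAt_id t).pow 2).div_const 4).const_add 1
  have h2 : HasDerivAt (fun t : ℝ ↦ Real.arctan (t / 2)) (1 / (1 + (t / 2) ^ 2) * (1 / 2)) t :=
    ((hasDerivAt_id t).div_const 2).arctan
  have h3 : 0 < 1 + t ^ 2 / 4 := by positivity
  have h4 := h2.sub ((h1.log h3.ne').div (hasDerivAt_id t) ht.ne')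
  refine h4.congr_deriv ?_
  simp only [id]
  have h5 : 1 + (t / 2) ^ 2 ≠ 0 := by positivity
  field_simp
  push_cast
  ring

theorem log_one_add_sq_div_four_nonneg (t : ℝ) : 0 ≤ Real.log (1 + t ^ 2 / 4) :=
  Real.log_nonneg (by linarith [sq_nonneg t])

theorem log_one_add_sq_div_four_le (t : ℝ) : Real.log (1 + t ^ 2 / 4) ≤ t ^ 2 / 4 := by
  have := Real.log_le_sub_one_of_pos (x := 1 + t ^ 2 / 4) (by positivity)
  linarith

theorem integral_log_one_add_sq_div_sq :
    ∫ t : ℝ, Real.log (1 + t ^ 2 / 4) / t ^ 2 = Real.pi := by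
  have hlim : Tendsto (fun t : ℝ ↦ Real.arctan (t / 2) - Real.log (1 + t ^ 2 / 4) / t) atTop
      (𝓝 (Real.pi / 2 - 0)) := by
    refine Tendsto.sub ?_ ?_
    · exact (Real.tendsto_arctan_atTop.mono_right nhdsWithin_le_nhds).comp
        (tendsto_id.atTop_div_const two_pos)
    · have h1 : Tendsto (fun t : ℝ ↦ 2 * (Real.log t / t)) atTop (𝓝 (2 * 0)) :=
        (Real.isLittleO_log_id_atTop.tendsto_div_nhds_zero).const_mul 2
      rw [mul_zero] at h1
      refine squeeze_zero' ?_ ?_ h1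
      · filter_upwards [eventually_gt_atTop 0] with t ht
        exact div_nonneg (log_one_add_sq_div_four_nonneg t) ht.le
      · filter_upwards [eventually_ge_atTop 2] with t ht
        rw [← mul_div_assoc]
        gcongr
        rw [← Real.log_rpow (by linarith)]
        gcongr
        norm_num
        nlinarith
  have hcont : ContinuousWithinAt
      (fun t : ℝ ↦ Real.arctan (t / 2) - Real.log (1 + t ^ 2 / 4) / t) (Ici 0) 0 := by
    refine ContinuousWithinAt.sub (by fun_prop) ?_
    rw [ContinuousWithinAt, div_zero]
    have h1 : Tendsto (fun t : ℝ ↦ t / 4) (𝓝[≥] 0) (𝓝 (0 / 4)) :=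
      (tendsto_id.div_const 4).mono_left nhdsWithin_le_nhds
    rw [zero_div] at h1
    refine squeeze_zero' ?_ ?_ h1
    · filter_upwards [self_mem_nhdsWithin] with t ht
      exact div_nonneg (log_one_add_sq_div_four_nonneg t) ht
    · filter_upwards [self_mem_nhdsWithin] with t ht
      rcases (show 0 ≤ t from ht).eq_or_lt with rfl | h0
      · simp
      · rw [div_le_iff₀ h0]
        linarith [log_one_add_sq_div_four_le t]
  have h := integral_Ioi_of_hasDerivAt_of_nonneg hcont (fun t ht ↦ hasDerivAt_log_div_add_arctan ht)
    (fun t _ ↦ div_nonneg (log_one_add_sq_div_four_nonneg t) (sq_nonneg t)) hlim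
  have h2 := integral_comp_abs (f := fun t : ℝ ↦ Real.log (1 + t ^ 2 / 4) / t ^ 2)
  simp only [sq_abs] at h2
  rw [h2, h]
  simp
  ring

theorem integrable_log_one_add_sq_div_sq :
    Integrable fun t : ℝ ↦ Real.log (1 + t ^ 2 / 4) / t ^ 2 :=
  Integrable.of_integral_ne_zero (by rw [integral_log_one_add_sq_div_sq]; exact Real.pi_ne_zero)

/-- Shifting the line of integration inside a vertical strip. -/
theorem integral_vertical_eq_of_norm_le {F : ℂ → ℂ} {a b : ℝ} (hab : a ≤ b)
    (hd : ∀ s : ℂ, a ≤ s.re → s.re ≤ b → DifferentiableAt ℂ F s) {g : ℝ → ℝ} (hg : Integrable g)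
    (hg0 : Tendsto g (cocompact ℝ) (𝓝 0))
    (hle : ∀ s : ℂ, a ≤ s.re → s.re ≤ b → ‖F s‖ ≤ g s.im) :
    ∫ t : ℝ, F (a + t * I) = ∫ t : ℝ, F (b + t * I) := by
  rw [_root_.cocompact_eq_atBot_atTop, tendsto_sup] at hg0
  have hinteg (x : ℝ) (h1 : a ≤ x) (h2 : x ≤ b) : Integrable fun t : ℝ ↦ F (x + t * I) := by
    refine hg.mono' (Continuous.aestronglyMeasurable ?_) (Eventually.of_forall fun t ↦ ?_)
    · refine continuous_iff_continuousAt.mpr fun t ↦ ?_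
      exact ContinuousAt.comp (f := fun t : ℝ ↦ (x + t * I : ℂ))
        (hd _ (by simpa) (by simpa)).continuousAt (by fun_prop)
    · simpa using hle (x + t * I) (by simpa) (by simpa)
  have hlim (x : ℝ) (h1 : a ≤ x) (h2 : x ≤ b) :
      Tendsto (fun T : ℝ ↦ ∫ t in (-T)..T, F (x + t * I)) atTop (𝓝 (∫ t : ℝ, F (x + t * I))) :=
    intervalIntegral_tendsto_integral (hinteg x h1 h2) tendsto_neg_atTop_atBot tendsto_id
  have hhor (T : ℝ) : ‖∫ x : ℝ in a..b, F (x + T * I)‖ ≤ g T * (b - a) := by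
    refine (intervalIntegral.norm_integral_le_of_norm_le_const (C := g T) fun x hx ↦ ?_).trans_eq
      (by rw [abs_of_nonneg (by linarith)])
    rw [uIoc_of_le hab] at hx
    simpa using hle (x + T * I) (by simpa using hx.1.le) (by simpa using hx.2)
  have hh1 : Tendsto (fun T : ℝ ↦ ∫ x : ℝ in a..b, F (x + T * I)) atTop (𝓝 0) := by
    refine squeeze_zero_norm hhor ?_
    simpa using hg0.2.mul_const (b - a)
  have hh2 : Tendsto (fun T : ℝ ↦ ∫ x : ℝ in a..b, F (x + (-T : ℝ) * I)) atTop (𝓝 0) := by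
    refine squeeze_zero_norm (fun T ↦ hhor (-T)) ?_
    simpa using (hg0.1.comp tendsto_neg_atTop_atBot).mul_const (b - a)
  have hrect (T : ℝ) : (∫ x : ℝ in a..b, F (x + (-T : ℝ) * I)) - (∫ x : ℝ in a..b, F (x + T * I)) +
      I • (∫ t in (-T)..T, F (b + t * I)) - I • (∫ t in (-T)..T, F (a + t * I)) = 0 := by
    have := Complex.integral_boundary_rect_eq_zero_of_differentiableOn F
      (a + (-T : ℝ) * I) (b + T * I) (fun s hs ↦ ?_)
    · simpa using this
    · have hs1 := hs.1
      simp only [mem_preimage] at hs1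
      rw [show (a + (-T : ℝ) * I : ℂ).re = a by simp, show (b + T * I : ℂ).re = b by simp,
        uIcc_of_le hab] at hs1
      exact (hd s hs1.1 hs1.2).differentiableWithinAt
  have hL := ((hh2.sub hh1).add ((hlim b hab le_rfl).const_smul I)).sub
    ((hlim a le_rfl hab).const_smul I)
  simp_rw [hrect] at hL
  have := tendsto_nhds_unique tendsto_const_nhds hL
  simp only [smul_eq_mul, sub_zero, zero_add, ← mul_sub] at this
  have := mul_eq_zero.mp this.symm
  simp only [I_ne_zero, false_or] at this
  exact (sub_eq_zero.mp this).symm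

end

section

open Complex Set Filter Topology MeasureTheory

/-- The combination `2 tent u - tent (u - T) - tent (u + T)`. -/
noncomputable def tentDiff (T u : ℝ) : ℝ := 2 * tent u - tent (u - T) - tent (u + T)

/-- The bilateral Laplace transform of `tentDiff T`. -/
noncomputable def tentKernel (T : ℝ) (w : ℂ) : ℂ :=
  tentTransform w * (2 - cexp (T * w) - cexp (-(T * w)))

/-- The nonnegative values of `tentKernel T` on the imaginary axis. -/
noncomputable def tentWeight (T t : ℝ) : ℝ :=
  4 * (Real.sin t / t) ^ 2 * (1 - Real.cos (T * t))

theorem differentiable_tentKernel (T : ℝ) : Differentiable ℂ (tentKernel T) := by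
  have := differentiable_tentTransform
  unfold tentKernel
  fun_prop

theorem norm_tentKernel_le (T : ℝ) (w : ℂ) : ‖tentKernel T w‖ ≤
    6 * Real.exp (2 * |w.re|) * (2 + 2 * Real.exp (|T| * |w.re|)) * (1 + w.im ^ 2)⁻¹ := by
  have h1 : ‖cexp (T * w)‖ ≤ Real.exp (|T| * |w.re|) := by
    rw [norm_exp, re_ofReal_mul, ← abs_mul]
    gcongr
    exact le_abs_self _
  have h2 : ‖cexp (-(T * w))‖ ≤ Real.exp (|T| * |w.re|) := by
    rw [norm_exp, neg_re, re_ofReal_mul, ← abs_mul]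
    gcongr
    exact neg_le_abs _
  have h3 : ‖2 - cexp (T * w) - cexp (-(T * w))‖ ≤ 2 + 2 * Real.exp (|T| * |w.re|) := by
    refine (norm_sub_le _ _).trans ?_
    have := norm_sub_le 2 (cexp (T * w))
    rw [norm_ofNat] at this
    linarith
  rw [tentKernel, norm_mul, mul_right_comm]
  gcongr
  exact norm_tentTransform_le w

theorem integrable_tentTransform_mul_exp (c u : ℝ) :
    Integrable fun t : ℝ ↦ tentTransform (c + t * I) * cexp (-(c + t * I) * u) := by
  have hd := differentiable_tentTransform.continuous
  refine ((integrable_tentTransform c).norm.mul_const (Real.exp (-c * u))).mono'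
    (by fun_prop : Continuous _).aestronglyMeasurable (Eventually.of_forall fun t ↦ ?_)
  rw [norm_mul, norm_exp, re_mul_ofReal]
  simp

theorem tentKernel_mul_exp (T u : ℝ) (w : ℂ) : tentKernel T w * cexp (-w * u) =
    2 * (tentTransform w * cexp (-w * u)) - tentTransform w * cexp (-w * (u - T : ℝ)) -
      tentTransform w * cexp (-w * (u + T : ℝ)) := by
  have h1 : cexp (-w * (u - T : ℝ)) = cexp (T * w) * cexp (-w * u) := by
    rw [← Complex.exp_add]; push_cast; ring_nf
  have h2 : cexp (-w * (u + T : ℝ)) = cexp (-(T * w)) * cexp (-w * u) := by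
    rw [← Complex.exp_add]; push_cast; ring_nf
  rw [h1, h2, tentKernel]
  ring

theorem integrable_tentKernel_mul_exp (T c u : ℝ) :
    Integrable fun t : ℝ ↦ tentKernel T (c + t * I) * cexp (-(c + t * I) * u) := by
  simp_rw [tentKernel_mul_exp]
  exact (((integrable_tentTransform_mul_exp c u).const_mul 2).sub
    (integrable_tentTransform_mul_exp c _)).sub (integrable_tentTransform_mul_exp c _)

theorem integrable_tentKernel (T c : ℝ) : Integrable fun t : ℝ ↦ tentKernel T (c + t * I) := by
  simpa using integrable_tentKernel_mul_exp T c 0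

theorem integral_tentKernel_mul_exp (T c u : ℝ) :
    ∫ t : ℝ, tentKernel T (c + t * I) * cexp (-(c + t * I) * u) =
      2 * Real.pi * tentDiff T u := by
  simp_rw [tentKernel_mul_exp]
  have h (v : ℝ) := integrable_tentTransform_mul_exp c v
  have h' : Integrable fun t : ℝ ↦ 2 * (tentTransform (c + t * I) * cexp (-(c + t * I) * u)) -
      tentTransform (c + t * I) * cexp (-(c + t * I) * (u - T : ℝ)) :=
    ((h _).const_mul 2).sub (h _)
  rw [integral_sub h' (h _), integral_sub ((h _).const_mul 2) (h _),
    integral_const_mul, integral_tentTransform_mul_exp, integral_tentTransform_mul_exp,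
    integral_tentTransform_mul_exp, tentDiff]
  push_cast
  ring

theorem tentKernel_mul_I (T t : ℝ) : tentKernel T (t * I) = tentWeight T t := by
  rcases eq_or_ne t 0 with rfl | ht
  · simp [tentKernel, tentWeight]
    norm_num
  · have ht' : (t : ℂ) ≠ 0 := by exact_mod_cast ht
    have h : cexp (T * (t * I)) + cexp (-(T * (t * I))) = 2 * Complex.cos (T * t) := by
      rw [← mul_assoc, ← neg_mul, Complex.two_cos]
    rw [tentKernel, sub_sub, h, tentTransform_of_ne_zero (mul_ne_zero ht' I_ne_zero),
      Complex.sinh_mul_I, mul_div_mul_right _ _ I_ne_zero, tentWeight]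
    push_cast
    ring

theorem tentWeight_nonneg (T t : ℝ) : 0 ≤ tentWeight T t :=
  mul_nonneg (by positivity) (by linarith [Real.cos_le_one (T * t)])

theorem integrable_tentWeight (T : ℝ) : Integrable (tentWeight T) := by
  have h := integrable_tentKernel T 0
  simp only [ofReal_zero, zero_add, tentKernel_mul_I] at h
  exact h.re

theorem integral_tentWeight {T : ℝ} (hT : 2 ≤ T) : ∫ t, tentWeight T t = 4 * Real.pi := by
  have h := integral_tentKernel_mul_exp T 0 0
  simp only [ofReal_zero, zero_add, tentKernel_mul_I, mul_zero, Complex.exp_zero, mul_one] at h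
  rw [integral_complex_ofReal] at h
  have h1 : tentDiff T 0 = 2 := by
    rw [tentDiff, tent_of_two_le_abs (v := 0 - T), tent_of_two_le_abs (v := 0 + T)]
    · simp [tent]
    · rw [zero_add]; exact hT.trans (le_abs_self T)
    · rw [zero_sub, abs_neg]; exact hT.trans (le_abs_self T)
  rw [h1] at h
  have : ∫ t, tentWeight T t = 2 * Real.pi * 2 := by exact_mod_cast h
  rw [this]
  ring

theorem tentWeight_mul_log_le (T t : ℝ) : tentWeight T t * (Real.log (1 + t ^ 2 / 4) / 2) ≤
    4 * (Real.log (1 + t ^ 2 / 4) / t ^ 2) := by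
  have h1 := log_one_add_sq_div_four_nonneg t
  have h2 : Real.sin t ^ 2 * (1 - Real.cos (T * t)) ≤ 1 * 2 := by
    gcongr
    · linarith [Real.cos_le_one (T * t)]
    · exact Real.sin_sq_le_one t
    · linarith [Real.neg_one_le_cos (T * t)]
  calc _ = 2 * (Real.sin t ^ 2 * (1 - Real.cos (T * t))) * (Real.log (1 + t ^ 2 / 4) / t ^ 2) := by
        rw [tentWeight]; ring
    _ ≤ 2 * (1 * 2) * (Real.log (1 + t ^ 2 / 4) / t ^ 2) := by gcongr
    _ = _ := by ring

theorem integrable_tentWeight_mul_log (T : ℝ) :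
    Integrable fun t ↦ tentWeight T t * (Real.log (1 + t ^ 2 / 4) / 2) := by
  refine (integrable_log_one_add_sq_div_sq.const_mul 4).mono' ?_ (Eventually.of_forall fun t ↦ ?_)
  · unfold tentWeight
    fun_prop
  · rw [Real.norm_of_nonneg]
    · exact tentWeight_mul_log_le T t
    · exact mul_nonneg (tentWeight_nonneg T t)
        (div_nonneg (log_one_add_sq_div_four_nonneg t) zero_le_two)

theorem half_log_four_add_sq (t : ℝ) :
    Real.log (4 + t ^ 2) / 2 = Real.log 2 + Real.log (1 + t ^ 2 / 4) / 2 := by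
  have h : 4 + t ^ 2 = 2 ^ 2 * (1 + t ^ 2 / 4) := by ring
  rw [h, Real.log_mul (by norm_num) (by positivity), Real.log_pow]
  push_cast
  ring

theorem integrable_tentWeight_mul_add_log (T A : ℝ) :
    Integrable fun t ↦ tentWeight T t * (A + Real.log (4 + t ^ 2) / 2) := by
  simp_rw [half_log_four_add_sq, ← add_assoc, mul_add _ (_ + _)]
  exact ((integrable_tentWeight T).mul_const _).add (integrable_tentWeight_mul_log T)

theorem integral_tentWeight_mul_add_log_le {T : ℝ} (hT : 2 ≤ T) (A : ℝ) :
    ∫ t, tentWeight T t * (A + Real.log (4 + t ^ 2) / 2) ≤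
      4 * Real.pi * (A + Real.log 2 + 1) := by
  simp_rw [half_log_four_add_sq, ← add_assoc, mul_add _ (_ + _)]
  rw [integral_add ((integrable_tentWeight T).mul_const _) (integrable_tentWeight_mul_log T),
    integral_mul_const, integral_tentWeight hT]
  have := integral_mono (integrable_tentWeight_mul_log T)
    (integrable_log_one_add_sq_div_sq.const_mul 4) (tentWeight_mul_log_le T)
  rw [integral_const_mul, integral_log_one_add_sq_div_sq] at this
  linarith

end

section

open Complex Set Filter Topology MeasureTheory Metric

theorem one_le_one_add_sq_rpow (t : ℝ) : 1 ≤ (1 + t ^ 2) ^ (1 / 4 : ℝ) :=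
  Real.one_le_rpow (by nlinarith [sq_nonneg t]) (by norm_num)

theorem log_five_add_abs_le (t : ℝ) : Real.log (5 + |t|) ≤ 7 * (1 + t ^ 2) ^ (1 / 4 : ℝ) := by
  have h0 : 0 < 1 + t ^ 2 := by positivity
  have h1 : (5 + |t|) ^ 2 ≤ 36 * (1 + t ^ 2) := by
    nlinarith [sq_abs t, sq_nonneg (|t| - 1)]
  have h2 : 2 * Real.log (5 + |t|) ≤ Real.log 36 + Real.log (1 + t ^ 2) := by
    rw [← Real.log_mul (by norm_num) h0.ne', ← Nat.cast_two, ← Real.log_pow]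
    exact Real.log_le_log (by positivity) h1
  have h3 := Real.log_le_rpow_div h0.le (by norm_num : (0 : ℝ) < 1 / 4)
  have h4 : Real.log 36 ≤ 10 := by
    rw [Real.log_le_iff_le_exp (by norm_num)]
    have : (1.5 : ℝ) + 1 ≤ Real.exp 1.5 := Real.add_one_le_exp _
    have h5 : Real.exp 10 = Real.exp 2.5 ^ 4 := by rw [← Real.exp_nat_mul]; norm_num
    have h6 : (2.5 : ℝ) + 1 ≤ Real.exp 2.5 := Real.add_one_le_exp _
    rw [h5]
    calc (36 : ℝ) ≤ (2.5 + 1) ^ 4 := by norm_num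
      _ ≤ _ := by gcongr
  linarith [one_le_one_add_sq_rpow t]

/-- A Borel–Carathéodory growth estimate in a closed vertical strip. -/
theorem exists_norm_le_one_add_sq_rpow {J : ℂ → ℂ} {A B σ : ℝ}
    (hJd : ∀ s : ℂ, 1 / 2 < s.re → DifferentiableAt ℂ J s)
    (hJre : ∀ s : ℂ, 1 / 2 < s.re → -(A + Real.log ‖s + 1‖) ≤ (J s).re)
    (hB : ∀ s : ℂ, s.re = 2 → ‖J s‖ ≤ B) (hσ : 1 / 2 < σ) :
    ∃ C, 0 ≤ C ∧ ∀ s : ℂ, σ ≤ s.re → s.re ≤ 2 → ‖J s‖ ≤ C * (1 + s.im ^ 2) ^ (1 / 4 : ℝ) := by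
  have hB0 : 0 ≤ B := (norm_nonneg _).trans (hB 2 rfl)
  have hδ : 0 < σ - 1 / 2 := by linarith
  refine ⟨(4 * (|A| + 7) + 3 * B) / (σ - 1 / 2), by positivity, fun s h1 h2 ↦ ?_⟩
  set c : ℂ := 2 + s.im * I with hc
  have hre (z : ℂ) (hz : z ∈ ball (0 : ℂ) (3 / 2)) : 1 / 2 < (c + z).re := by
    have := (abs_le.1 ((abs_re_le_norm z).trans (mem_ball_zero_iff.1 hz).le)).1
    have h3 := (abs_lt.1 ((abs_re_le_norm z).trans_lt (mem_ball_zero_iff.1 hz))).1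
    simp [hc]
    linarith
  set M := |A| + Real.log (5 + |s.im|)
  have hlog : 0 < Real.log (5 + |s.im|) := Real.log_pos (by linarith [abs_nonneg s.im])
  have hM : 0 < M := by positivity
  have hz : ‖s - c‖ = 2 - s.re := by
    have : s - c = ((s.re - 2 : ℝ) : ℂ) := by
      apply Complex.ext <;> simp [hc]
    rw [this, norm_real, Real.norm_of_nonpos (by linarith)]
    ring
  have key := Complex.borelCaratheodory (f := fun z ↦ -J (c + z)) (R := 3 / 2) (z := s - c) hM
    (fun z hz ↦ ?_) (fun z hz ↦ ?_) (by norm_num) (by rw [mem_ball_zero_iff, hz]; linarith)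
  · simp only [add_sub_cancel, add_zero, norm_neg, hz] at key
    have hJc : ‖J c‖ ≤ B := hB c (by simp [hc])
    have hq := one_le_one_add_sq_rpow s.im
    set q := (1 + s.im ^ 2) ^ (1 / 4 : ℝ)
    have hMq : M ≤ (|A| + 7) * q := by
      have := log_five_add_abs_le s.im
      nlinarith [abs_nonneg A]
    have hd : σ - 1 / 2 ≤ 3 / 2 - (2 - s.re) := by linarith
    have hM2 : 0 ≤ 2 - s.re := by linarith
    calc ‖J s‖ ≤ _ := key
      _ = (2 * M * (2 - s.re) + ‖J c‖ * (3 / 2 + (2 - s.re))) / (3 / 2 - (2 - s.re)) := by ring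
      _ ≤ (2 * ((|A| + 7) * q) * 2 + (B * q) * 3) / (σ - 1 / 2) := by
        have : ‖J c‖ ≤ B * q := hJc.trans (le_mul_of_one_le_right hB0 hq)
        gcongr <;> linarith
      _ = _ := by ring
  · exact (DifferentiableAt.comp z (hJd _ (hre z hz)) (by fun_prop)).neg.differentiableWithinAt
  · have h3 := hJre _ (hre z hz)
    have h4 : ‖c + z + 1‖ ≤ 5 + |s.im| := by
      have : c + z + 1 = 3 + s.im * I + z := by rw [hc]; ring
      rw [this]
      refine (norm_add_le _ _).trans ?_
      have h5 := norm_add_le (3 : ℂ) (s.im * I)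
      rw [norm_mul, norm_I, mul_one, norm_real, norm_ofNat, Real.norm_eq_abs] at h5
      linarith [mem_ball_zero_iff.1 hz]
    have h5 : 0 < ‖c + z + 1‖ := by
      refine norm_pos_iff.2 fun h ↦ ?_
      have := congrArg re h
      have h6 := hre z hz
      simp only [add_re, one_re, zero_re] at this h6
      linarith
    have h6 := Real.log_le_log h5 h4
    simp only [Set.mem_ofPred_eq, neg_re]
    linarith [le_abs_self A]

theorem integrable_one_add_sq_rpow : Integrable fun t : ℝ ↦ (1 + t ^ 2) ^ (-(3 / 4) : ℝ) := by
  have := integrable_rpow_neg_one_add_norm_sq (E := ℝ) (μ := volume) (r := 3 / 2)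
    (by simp; norm_num)
  convert this using 3
  · simp
  · norm_num

theorem tendsto_one_add_sq_rpow :
    Tendsto (fun t : ℝ ↦ (1 + t ^ 2) ^ (-(3 / 4) : ℝ)) (cocompact ℝ) (𝓝 0) := by
  refine (tendsto_rpow_neg_atTop (by norm_num : (0 : ℝ) < 3 / 4)).comp ?_
  refine tendsto_atTop_add_const_left _ _ ?_
  have h : Tendsto (fun t : ℝ ↦ ‖t‖ ^ 2) (cocompact ℝ) atTop :=
    (tendsto_pow_atTop two_ne_zero).comp (tendsto_norm_cocompact_atTop)
  simpa using h

/-- Shifting the contour of the kernel integral from `re s = σ` to `re s = 2`. -/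
theorem integral_mul_tentKernel_eq {J : ℂ → ℂ} {A B σ : ℝ}
    (hJd : ∀ s : ℂ, 1 / 2 < s.re → DifferentiableAt ℂ J s)
    (hJre : ∀ s : ℂ, 1 / 2 < s.re → -(A + Real.log ‖s + 1‖) ≤ (J s).re)
    (hB : ∀ s : ℂ, s.re = 2 → ‖J s‖ ≤ B) (hσ : 1 / 2 < σ) (hσ2 : σ ≤ 2) (T : ℝ) :
    (Integrable fun t : ℝ ↦ J (σ + t * I) * tentKernel T (t * I)) ∧
    ∫ t : ℝ, J (σ + t * I) * tentKernel T (t * I) =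
      ∫ t : ℝ, J (2 + t * I) * tentKernel T ((2 - σ : ℝ) + t * I) := by
  obtain ⟨C, hC, hbd⟩ := exists_norm_le_one_add_sq_rpow hJd hJre hB hσ
  set K := 6 * Real.exp (2 * (2 - σ)) * (2 + 2 * Real.exp (|T| * (2 - σ))) with hK
  have hle (s : ℂ) (h1 : σ ≤ s.re) (h2 : s.re ≤ 2) :
      ‖J s * tentKernel T (s - σ)‖ ≤ C * K * (1 + s.im ^ 2) ^ (-(3 / 4) : ℝ) := by
    have h3 : |(s - σ).re| ≤ 2 - σ := by
      simp only [sub_re, ofReal_re]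
      rw [abs_of_nonneg] <;> linarith
    have h4 : ‖tentKernel T (s - σ)‖ ≤ K * (1 + s.im ^ 2)⁻¹ := by
      refine (norm_tentKernel_le T (s - σ)).trans ?_
      simp only [sub_im, ofReal_im, sub_zero, hK]
      gcongr
    have h5 : (1 + s.im ^ 2) ^ (-(3 / 4) : ℝ) =
        (1 + s.im ^ 2) ^ (1 / 4 : ℝ) * (1 + s.im ^ 2)⁻¹ := by
      rw [← Real.rpow_neg_one, ← Real.rpow_add (by positivity)]
      norm_num
    rw [norm_mul, h5]
    calc _ ≤ (C * (1 + s.im ^ 2) ^ (1 / 4 : ℝ)) * (K * (1 + s.im ^ 2)⁻¹) := by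
          gcongr
          exact hbd s h1 h2
      _ = _ := by ring
  have hd (s : ℂ) (h1 : σ ≤ s.re) : DifferentiableAt ℂ (fun s ↦ J s * tentKernel T (s - σ)) s :=
    (hJd s (by linarith)).mul ((differentiable_tentKernel T _).comp s (by fun_prop))
  constructor
  · refine (integrable_one_add_sq_rpow.const_mul (C * K)).mono' ?_ (Eventually.of_forall fun t ↦ ?_)
    · refine Continuous.aestronglyMeasurable (continuous_iff_continuousAt.2 fun t ↦ ?_)
      have h : ContinuousAt (fun s ↦ J s * tentKernel T (s - σ)) (σ + t * I) :=
        (hd (σ + t * I) (by simp)).continuousAt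
      have := ContinuousAt.comp (x := t) (f := fun t : ℝ ↦ (σ + t * I : ℂ)) h (by fun_prop)
      simpa [Function.comp_def] using this
    · simpa using hle (σ + t * I) (by simp) (by simpa using hσ2)
  · have := integral_vertical_eq_of_norm_le (F := fun s ↦ J s * tentKernel T (s - σ)) hσ2
      (fun s h1 _ ↦ hd s h1) (integrable_one_add_sq_rpow.const_mul (C * K))
      (by simpa using tendsto_one_add_sq_rpow.const_mul (C * K)) hle
    simp only [add_sub_cancel_left] at this
    rw [this]
    congr! 4 with t
    push_cast
    ring

end

section

open Complex Set Filter Topology MeasureTheory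

theorem integral_exp_neg_one_add_mul_I (t : ℝ) :
    ∫ u : ℝ in Ioi 0, cexp (-(1 + t * I) * u) = (1 + t * I)⁻¹ := by
  rw [integral_exp_mul_complex_Ioi (by simp) 0]
  rw [ofReal_zero, mul_zero, Complex.exp_zero, neg_div, ← div_neg, neg_neg, one_div]

theorem one_add_mul_I_ne_zero (t : ℝ) : (1 + t * I : ℂ) ≠ 0 := fun h ↦ by
  simpa using congrArg re h

theorem integrable_tentKernel_mul_inv (T c : ℝ) :
    Integrable fun t : ℝ ↦ tentKernel T (c + t * I) * (1 + t * I)⁻¹ := by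
  have hd := (differentiable_tentKernel T).continuous
  have hi : Continuous fun t : ℝ ↦ (1 + t * I : ℂ)⁻¹ :=
    (by fun_prop : Continuous fun t : ℝ ↦ (1 + t * I : ℂ)).inv₀ one_add_mul_I_ne_zero
  refine (integrable_tentKernel T c).norm.mono'
    (by fun_prop : Continuous _).aestronglyMeasurable (Eventually.of_forall fun t ↦ ?_)
  rw [norm_mul, norm_inv]
  refine mul_le_of_le_one_right (norm_nonneg _) (inv_le_one_of_one_le₀ ?_)
  simpa using abs_re_le_norm (1 + t * I)

theorem integral_tentKernel_mul_inv (T c : ℝ) :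
    ∫ t : ℝ, tentKernel T (c + t * I) * (1 + t * I)⁻¹ =
      ((2 * Real.pi * ∫ u in Ioi 0, Real.exp ((c - 1) * u) * tentDiff T u : ℝ) : ℂ) := by
  have hd := (differentiable_tentKernel T).continuous
  have hinteg : Integrable (Function.uncurry fun t u : ℝ ↦
      tentKernel T (c + t * I) * cexp (-(1 + t * I) * u))
      (volume.prod (volume.restrict (Ioi 0))) := by
    refine ((integrable_tentKernel T c).norm.mul_prod
      (integrableOn_exp_mul_Ioi (a := -1) (by norm_num) 0)).mono' ?_
      (Eventually.of_forall fun ⟨t, u⟩ ↦ ?_)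
    · refine Continuous.aestronglyMeasurable ?_
      simp only [Function.uncurry_def]
      fun_prop
    · simp [Function.uncurry, norm_exp]
  calc _ = ∫ t : ℝ, ∫ u : ℝ in Ioi 0, tentKernel T (c + t * I) * cexp (-(1 + t * I) * u) := by
        simp_rw [integral_const_mul, integral_exp_neg_one_add_mul_I]
    _ = ∫ u : ℝ in Ioi 0, ∫ t : ℝ, tentKernel T (c + t * I) * cexp (-(1 + t * I) * u) :=
        integral_integral_swap hinteg
    _ = ∫ u : ℝ in Ioi 0, ((2 * Real.pi * (Real.exp ((c - 1) * u) * tentDiff T u) : ℝ) : ℂ) := by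
        congr! 2 with u
        have (t : ℝ) : tentKernel T (c + t * I) * cexp (-(1 + t * I) * u) =
            cexp ((c - 1) * u) * (tentKernel T (c + t * I) * cexp (-(c + t * I) * u)) := by
          rw [mul_left_comm, ← Complex.exp_add]
          ring_nf
        simp_rw [this, integral_const_mul, integral_tentKernel_mul_exp]
        push_cast
        ring
    _ = _ := by
        rw [integral_complex_ofReal, integral_const_mul]

theorem norm_LSeries_term_two_add (a : ℕ → ℂ) (t : ℝ) (n : ℕ) :
    ‖LSeries.term a (2 + t * I) n‖ = ‖LSeries.term a 2 n‖ := by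
  simp [LSeries.norm_term_eq]

theorem continuous_LSeries_term (a : ℕ → ℂ) (n : ℕ) :
    Continuous fun t : ℝ ↦ LSeries.term a (2 + t * I) n := by
  rcases eq_or_ne n 0 with rfl | hn
  · simpa using continuous_const
  · have hn' : (n : ℂ) ≠ 0 := by exact_mod_cast hn
    simp_rw [LSeries.term_of_ne_zero hn, div_eq_mul_inv, ← Complex.cpow_neg,
      Complex.cpow_def_of_ne_zero hn']
    fun_prop

theorem continuous_LSeries_two_add {a : ℕ → ℂ} (ha : LSeriesSummable a 2) :
    Continuous fun t : ℝ ↦ LSeries a (2 + t * I) :=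
  continuous_tsum (continuous_LSeries_term a) ha.norm
    fun n t ↦ (norm_LSeries_term_two_add a t n).le

theorem norm_LSeries_two_add_le {a : ℕ → ℂ} (ha : LSeriesSummable a 2) (t : ℝ) :
    ‖LSeries a (2 + t * I)‖ ≤ ∑' n, ‖LSeries.term a 2 n‖ :=
  tsum_of_norm_bounded ha.norm.hasSum fun n ↦ (norm_LSeries_term_two_add a t n).le

theorem integrable_tentKernel_mul_LSeries (T c : ℝ) {a : ℕ → ℂ} (ha : LSeriesSummable a 2) :
    Integrable fun t : ℝ ↦ tentKernel T (c + t * I) * LSeries a (2 + t * I) := by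
  have hd := (differentiable_tentKernel T).continuous
  have hL := continuous_LSeries_two_add ha
  refine ((integrable_tentKernel T c).norm.mul_const
    (∑' n, ‖LSeries.term a 2 n‖)).mono'
    (by fun_prop : Continuous _).aestronglyMeasurable (Eventually.of_forall fun t ↦ ?_)
  rw [norm_mul]
  gcongr
  exact norm_LSeries_two_add_le ha t

theorem integral_tentKernel_mul_term (T σ : ℝ) (hσ : σ ≠ 0) (a : ℕ → ℝ) (n : ℕ) :
    ∫ t : ℝ, tentKernel T ((2 - σ : ℝ) + t * I) * LSeries.term (fun n ↦ (a n : ℂ)) (2 + t * I) n =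
      ((2 * Real.pi * (a n * (n : ℝ) ^ (-σ) * tentDiff T (Real.log n)) : ℝ) : ℂ) := by
  rcases eq_or_ne n 0 with rfl | hn
  · simp [Real.zero_rpow (neg_ne_zero.2 hσ)]
  · have hn' : (n : ℂ) ≠ 0 := by exact_mod_cast hn
    have hpos : (0 : ℝ) < n := by positivity
    have (t : ℝ) : tentKernel T ((2 - σ : ℝ) + t * I) *
          LSeries.term (fun n ↦ (a n : ℂ)) (2 + t * I) n =
        (a n * (n : ℝ) ^ (-σ) : ℝ) * (tentKernel T ((2 - σ : ℝ) + t * I) *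
          cexp (-((2 - σ : ℝ) + t * I) * Real.log n)) := by
      rw [LSeries.term_of_ne_zero hn, div_eq_mul_inv, ← Complex.cpow_neg,
        Complex.cpow_def_of_ne_zero hn', Real.rpow_def_of_pos hpos, Complex.ofReal_mul,
        Complex.ofReal_exp, mul_mul_mul_comm, mul_comm (tentKernel _ _), mul_mul_mul_comm,
        ← Complex.natCast_log]
      have : cexp (Real.log n * -(2 + t * I)) = cexp ((Real.log n * -σ : ℝ)) *
          cexp (-((2 - σ : ℝ) + t * I) * Real.log n) := by
        rw [← Complex.exp_add]
        push_cast
        ring_nf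
      rw [this]
      ring
    simp_rw [this, integral_const_mul, integral_tentKernel_mul_exp]
    push_cast
    ring

theorem integral_tentKernel_mul_LSeries (T : ℝ) {σ : ℝ} (hσ : σ ≠ 0) {a : ℕ → ℝ}
    (ha : LSeriesSummable (fun n ↦ (a n : ℂ)) 2) :
    ∫ t : ℝ, tentKernel T ((2 - σ : ℝ) + t * I) * LSeries (fun n ↦ (a n : ℂ)) (2 + t * I) =
      ((2 * Real.pi * ∑' n : ℕ, a n * (n : ℝ) ^ (-σ) * tentDiff T (Real.log n) : ℝ) : ℂ) := by
  have hd := (differentiable_tentKernel T).continuous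
  have hF (n : ℕ) : Integrable fun t : ℝ ↦ tentKernel T ((2 - σ : ℝ) + t * I) *
      LSeries.term (fun n ↦ (a n : ℂ)) (2 + t * I) n := by
    have hL := continuous_LSeries_term (fun n ↦ (a n : ℂ)) n
    refine ((integrable_tentKernel T (2 - σ)).norm.mul_const
      ‖LSeries.term (fun n ↦ (a n : ℂ)) 2 n‖).mono'
      (by fun_prop : Continuous _).aestronglyMeasurable (Eventually.of_forall fun t ↦ ?_)
    rw [norm_mul, norm_LSeries_term_two_add]
  have := integral_tsum_of_summable_integral_norm hF ?_
  · simp_rw [integral_tentKernel_mul_term T σ hσ, tsum_mul_left] at this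
    rw [← tsum_mul_left, ofReal_tsum, this]
    rfl
  · simp_rw [norm_mul, norm_LSeries_term_two_add, integral_mul_const]
    exact ha.norm.mul_left _

end

section

open Complex Set Filter Topology MeasureTheory

theorem integrable_tent_mul_real_exp (b : ℝ) : Integrable fun v ↦ tent v * Real.exp (b * v) := by
  have h : Integrable fun v : ℝ ↦ ((tent v * Real.exp (b * v) : ℝ) : ℂ) := by
    simpa using integrable_tent_mul_exp (b : ℂ)
  exact h.re

theorem integral_tent_mul_real_exp {b : ℝ} (hb : b ≠ 0) :
    ∫ v, tent v * Real.exp (b * v) = 2 * (Real.sinh b / b) ^ 2 := by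
  have h := integral_tent_mul_exp (b : ℂ)
  rw [tentTransform_of_ne_zero (by exact_mod_cast hb)] at h
  have h' : ∫ v : ℝ, ((tent v * Real.exp (b * v) : ℝ) : ℂ) =
      ((2 * (Real.sinh b / b) ^ 2 : ℝ) : ℂ) := by
    push_cast
    exact h
  rw [integral_complex_ofReal] at h'
  exact_mod_cast h'

theorem exp_mul_tent_sub (b T u : ℝ) : Real.exp (b * u) * tent (u - T) =
    Real.exp (b * T) * (tent (u - T) * Real.exp (b * (u - T))) := by
  rw [mul_sub, Real.exp_sub]
  field_simp

theorem integrable_exp_mul_tent_sub (b T : ℝ) :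
    Integrable fun u ↦ Real.exp (b * u) * tent (u - T) := by
  simp_rw [exp_mul_tent_sub]
  exact ((integrable_tent_mul_real_exp b).comp_sub_right T).const_mul _

theorem integral_Ioi_exp_mul_tent_sub {b T : ℝ} (hb : b ≠ 0) (hT : 2 ≤ T) :
    ∫ u in Ioi 0, Real.exp (b * u) * tent (u - T) =
      Real.exp (b * T) * (2 * (Real.sinh b / b) ^ 2) := by
  rw [setIntegral_eq_integral_of_forall_compl_eq_zero]
  · simp_rw [exp_mul_tent_sub]
    rw [integral_const_mul, integral_sub_right_eq_self (fun v ↦ tent v * Real.exp (b * v)),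
      integral_tent_mul_real_exp hb]
  · intro u hu
    rw [tent_of_two_le_abs, mul_zero]
    rw [abs_of_nonpos] <;> linarith [notMem_Ioi.1 hu]

theorem integral_Ioi_exp_mul_tent_le {b : ℝ} (hb : b ≤ 1 / 2) :
    ∫ u in Ioi 0, Real.exp (b * u) * tent u ≤ 2 := by
  have h0 (u : ℝ) (hu : u ∈ Ioi (0 : ℝ) \ Ioc 0 2) : Real.exp (b * u) * tent u = 0 := by
    rw [tent_of_two_le_abs, mul_zero]
    have h1 : 0 < u := hu.1
    have h2 : ¬ u ≤ 2 := fun h ↦ hu.2 ⟨h1, h⟩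
    rw [abs_of_pos h1]
    linarith
  rw [setIntegral_eq_of_subset_of_forall_sdiff_eq_zero measurableSet_Ioi Ioc_subset_Ioi_self h0]
  have hi : IntegrableOn (fun u ↦ Real.exp (b * u) * tent u) (Ioc 0 2) := by
    simpa using (integrable_exp_mul_tent_sub b 0).integrableOn (s := Ioc 0 2)
  calc _ ≤ ∫ u in Ioc (0 : ℝ) 2, (1 : ℝ) := by
        refine setIntegral_mono_on hi (by simp) measurableSet_Ioc fun u hu ↦ ?_
        rw [tent_of_abs_le_two (by rw [abs_of_pos hu.1]; exact hu.2), abs_of_pos hu.1]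
        have h1 : b * u ≤ u / 2 := by nlinarith [hu.1]
        have h2 : 1 - u / 2 ≤ Real.exp (-(u / 2)) := by
          have := Real.add_one_le_exp (-(u / 2))
          linarith
        calc _ ≤ Real.exp (u / 2) * Real.exp (-(u / 2)) := by
              gcongr
              linarith [hu.2]
          _ = 1 := by rw [← Real.exp_add]; simp
    _ = 2 := by simp

theorem le_neg_integral_exp_mul_tentDiff {b T : ℝ} (hb : 0 < b) (hb' : b ≤ 1 / 2) (hT : 2 ≤ T) :
    Real.exp (b * T) * (2 * (Real.sinh b / b) ^ 2) - 4 ≤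
      -∫ u in Ioi 0, Real.exp (b * u) * tentDiff T u := by
  have h1 : ∫ u in Ioi 0, Real.exp (b * u) * tentDiff T u =
      ∫ u in Ioi 0, (2 * (Real.exp (b * u) * tent u) - Real.exp (b * u) * tent (u - T)) := by
    refine setIntegral_congr_fun measurableSet_Ioi fun u (hu : 0 < u) ↦ ?_
    simp only [tentDiff]
    rw [tent_of_two_le_abs (v := u + T) (by rw [abs_of_nonneg] <;> linarith)]
    ring
  have h2 : Integrable fun u ↦ Real.exp (b * u) * tent u := by
    simpa using integrable_exp_mul_tent_sub b 0
  rw [h1, integral_sub (h2.const_mul 2).integrableOn (integrable_exp_mul_tent_sub b T).integrableOn,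
    integral_const_mul, integral_Ioi_exp_mul_tent_sub hb.ne' hT]
  linarith [integral_Ioi_exp_mul_tent_le hb']

theorem tentDiff_log_of_ceil_le {T : ℝ} (hT : 2 ≤ T) {n : ℕ} (hn : ⌈Real.exp (T + 2)⌉₊ ≤ n) :
    tentDiff T (Real.log n) = 0 := by
  have h1 : Real.exp (T + 2) ≤ n := Nat.ceil_le.1 hn
  have h2 : T + 2 ≤ Real.log n :=
    (Real.le_log_iff_exp_le ((Real.exp_pos _).trans_le h1)).2 h1
  have h (v : ℝ) (hv : 2 ≤ v) : tent v = 0 := tent_of_two_le_abs (hv.trans (le_abs_self v))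
  rw [tentDiff, h _ (by linarith), h _ (by linarith), h _ (by linarith)]
  ring

theorem neg_sum_mul_tentDiff_le {T σ : ℝ} (hT : 2 ≤ T) (hσ : 1 / 2 < σ) {a : ℕ → ℝ}
    (ha : ∀ n, 0 ≤ a n) :
    -∑' n : ℕ, a n * (n : ℝ) ^ (-σ) * tentDiff T (Real.log n) ≤
      ∑ n ∈ Finset.range ⌈Real.exp (T + 2)⌉₊,
        a n * (n : ℝ) ^ (-(1 / 2) : ℝ) * tent (Real.log n - T) := by
  rw [tsum_eq_sum (s := Finset.range ⌈Real.exp (T + 2)⌉₊), ← Finset.sum_neg_distrib]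
  · refine Finset.sum_le_sum fun n _ ↦ ?_
    rcases Nat.eq_zero_or_pos n with rfl | hn
    · rw [Nat.cast_zero, Real.zero_rpow (by linarith), Real.zero_rpow (by norm_num)]
      simp
    have hn1 : (1 : ℝ) ≤ n := by exact_mod_cast hn
    have h1 : -tentDiff T (Real.log n) ≤ tent (Real.log n - T) := by
      rw [tentDiff, tent_of_two_le_abs (v := Real.log n + T)]
      · linarith [tent_nonneg (Real.log n)]
      · have := Real.log_nonneg hn1
        rw [abs_of_nonneg] <;> linarith
    rw [← mul_neg]
    calc _ ≤ a n * (n : ℝ) ^ (-σ) * tent (Real.log n - T) := by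
          have := ha n
          gcongr
      _ ≤ _ := by
          have := ha n
          have := tent_nonneg (Real.log n - T)
          gcongr
  · intro n hn
    rw [tentDiff_log_of_ceil_le hT (by simpa using hn), mul_zero]

theorem neg_le_re_integral_mul_tentKernel {J : ℂ → ℂ} {A σ T : ℝ}
    (hJre : ∀ s : ℂ, 1 / 2 < s.re → -(A + Real.log ‖s + 1‖) ≤ (J s).re)
    (hσ : 1 / 2 < σ) (hσ1 : σ ≤ 1) (hT : 2 ≤ T)
    (hi : Integrable fun t : ℝ ↦ J (σ + t * I) * tentKernel T (t * I)) :
    -(4 * Real.pi * (A + Real.log 2 + 1)) ≤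
      (∫ t : ℝ, J (σ + t * I) * tentKernel T (t * I)).re := by
  have h1 : (∫ t : ℝ, J (σ + t * I) * tentKernel T (t * I)).re =
      ∫ t : ℝ, (J (σ + t * I) * tentKernel T (t * I)).re := (integral_re hi).symm
  have h2 (t : ℝ) : (J (σ + t * I) * tentKernel T (t * I)).re =
      tentWeight T t * (J (σ + t * I)).re := by
    rw [tentKernel_mul_I, re_mul_ofReal, mul_comm]
  have h3 (t : ℝ) : -(A + Real.log (4 + t ^ 2) / 2) ≤ (J (σ + t * I)).re := by
    have h4 := hJre (σ + t * I) (by simpa using hσ)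
    have h5 : ‖(σ + t * I + 1 : ℂ)‖ ^ 2 ≤ 4 + t ^ 2 := by
      rw [← normSq_eq_norm_sq, normSq_apply]
      simp
      nlinarith
    have h6 : 0 < ‖(σ + t * I + 1 : ℂ)‖ := by
      refine norm_pos_iff.2 fun h ↦ ?_
      have := congrArg re h
      simp at this
      linarith
    have h7 := Real.log_le_log (by positivity) h5
    rw [Real.log_pow] at h7
    push_cast at h7
    linarith
  rw [h1]
  simp_rw [h2]
  calc _ ≤ -∫ t, tentWeight T t * (A + Real.log (4 + t ^ 2) / 2) :=
        neg_le_neg (integral_tentWeight_mul_add_log_le hT A)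
    _ = ∫ t, tentWeight T t * -(A + Real.log (4 + t ^ 2) / 2) := by
        simp_rw [mul_neg]
        rw [integral_neg]
    _ ≤ _ := by
        refine integral_mono ?_ ?_ fun t ↦ mul_le_mul_of_nonneg_left (h3 t) (tentWeight_nonneg T t)
        · simp_rw [mul_neg]
          exact (integrable_tentWeight_mul_add_log T A).neg
        · simp_rw [← h2]
          exact hi.re

/-- The explicit inequality for a function with a lower bound for its real part in the
half-plane `1 / 2 < re s`, given by a pole at `1` and a Dirichlet series with
nonnegative coefficients. -/
theorem exp_half_mul_le {J : ℂ → ℂ} {A T : ℝ} {a : ℕ → ℝ}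
    (hJd : ∀ s : ℂ, 1 / 2 < s.re → DifferentiableAt ℂ J s)
    (hJre : ∀ s : ℂ, 1 / 2 < s.re → -(A + Real.log ‖s + 1‖) ≤ (J s).re)
    (ha : ∀ n, 0 ≤ a n) (has : LSeriesSummable (fun n ↦ (a n : ℂ)) 2)
    (hJ : ∀ s : ℂ, s.re = 2 → J s = (s - 1)⁻¹ - LSeries (fun n ↦ (a n : ℂ)) s) (hT : 2 ≤ T) :
    Real.exp (T / 2) * (8 * Real.sinh (1 / 2) ^ 2) ≤ 4 + 2 * (A + Real.log 2 + 1) +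
      ∑ n ∈ Finset.range ⌈Real.exp (T + 2)⌉₊,
        a n * (n : ℝ) ^ (-(1 / 2) : ℝ) * tent (Real.log n - T) := by
  set S := ∑ n ∈ Finset.range ⌈Real.exp (T + 2)⌉₊,
    a n * (n : ℝ) ^ (-(1 / 2) : ℝ) * tent (Real.log n - T)
  have hJ2 (t : ℝ) : J (2 + t * I) = (1 + t * I)⁻¹ - LSeries (fun n ↦ (a n : ℂ)) (2 + t * I) := by
    rw [hJ _ (by simp)]
    ring_nf
  have hB (s : ℂ) (hs : s.re = 2) :
      ‖J s‖ ≤ 1 + ∑' n, ‖LSeries.term (fun n ↦ (a n : ℂ)) 2 n‖ := by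
    have : s = 2 + s.im * I := by apply Complex.ext <;> simp [hs]
    rw [this, hJ2]
    refine (norm_sub_le _ _).trans (add_le_add ?_ (norm_LSeries_two_add_le has _))
    rw [norm_inv]
    refine inv_le_one_of_one_le₀ ?_
    simpa using abs_re_le_norm (1 + s.im * I)
  have key (b : ℝ) (hb : 0 < b) (hb' : b < 1 / 2) :
      Real.exp (b * T) * (2 * (Real.sinh b / b) ^ 2) ≤ 4 + 2 * (A + Real.log 2 + 1) + S := by
    have hσ : 1 / 2 < 1 - b := by linarith
    obtain ⟨hi, heq⟩ := integral_mul_tentKernel_eq hJd hJre hB hσ (by linarith) T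
    have h1 := neg_le_re_integral_mul_tentKernel hJre hσ (by linarith) hT hi
    have h2 : ∫ t : ℝ, J (2 + t * I) * tentKernel T ((2 - (1 - b) : ℝ) + t * I) =
        (∫ t : ℝ, tentKernel T ((2 - (1 - b) : ℝ) + t * I) * (1 + t * I)⁻¹) -
        ∫ t : ℝ, tentKernel T ((2 - (1 - b) : ℝ) + t * I) *
          LSeries (fun n ↦ (a n : ℂ)) (2 + t * I) := by
      rw [← integral_sub (integrable_tentKernel_mul_inv T _)
        (integrable_tentKernel_mul_LSeries T _ has)]
      simp_rw [hJ2]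
      congr! 2 with t
      ring
    rw [heq, h2, integral_tentKernel_mul_inv, integral_tentKernel_mul_LSeries T (by linarith) has,
      ← ofReal_sub, ofReal_re, show 2 - (1 - b) - 1 = b by ring, ← mul_sub,
      show 4 * Real.pi * (A + Real.log 2 + 1) = 2 * Real.pi * (2 * (A + Real.log 2 + 1)) by ring,
      ← mul_neg] at h1
    have h3 := le_of_mul_le_mul_left h1 (by positivity)
    have h4 := le_neg_integral_exp_mul_tentDiff hb hb'.le hT
    have h5 := neg_sum_mul_tentDiff_le hT hσ ha
    linarith
  have hlim : Tendsto (fun b ↦ Real.exp (b * T) * (2 * (Real.sinh b / b) ^ 2)) (𝓝[<] (1 / 2))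
      (𝓝 (Real.exp (1 / 2 * T) * (2 * (Real.sinh (1 / 2) / (1 / 2)) ^ 2))) := by
    refine Tendsto.mono_left (ContinuousAt.tendsto ?_) nhdsWithin_le_nhds
    have := Real.continuous_sinh
    refine ContinuousAt.mul (by fun_prop) (ContinuousAt.mul (by fun_prop) (ContinuousAt.pow ?_ 2))
    exact ContinuousAt.div (by fun_prop) (by fun_prop) (by norm_num)
  have h := le_of_tendsto hlim (b := 4 + 2 * (A + Real.log 2 + 1) + S) (by
    filter_upwards [Ioo_mem_nhdsLT (by norm_num : (0 : ℝ) < 1 / 2)] with b hb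
    exact key b hb.1 hb.2)
  calc _ = Real.exp (1 / 2 * T) * (2 * (Real.sinh (1 / 2) / (1 / 2)) ^ 2) := by
        rw [show 1 / 2 * T = T / 2 by ring]
        ring
    _ ≤ _ := h

end

section

open Complex Set Filter Topology DirichletCharacter ArithmeticFunction

theorem logDeriv_LFunctionTrivChar₁_one {s : ℂ} (hs : 1 < s.re) :
    logDeriv (LFunctionTrivChar₁ 1) s = (s - 1)⁻¹ - LSeries (fun n ↦ (Λ n : ℂ)) s := by
  have hs1 : s ≠ 1 := by rintro rfl; simp at hs
  have h : LFunctionTrivChar₁ 1 =ᶠ[𝓝 s] fun z ↦ (z - 1) * riemannZeta z := by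
    filter_upwards [isOpen_ne.mem_nhds hs1] with z hz
    exact LFunctionTrivChar₁_one_apply hz
  have h1 : logDeriv (LFunctionTrivChar₁ 1) s = logDeriv (fun z ↦ (z - 1) * riemannZeta z) s := by
    rw [logDeriv_apply, logDeriv_apply, h.deriv_eq, h.eq_of_nhds]
  rw [h1, logDeriv_mul (f := fun z ↦ z - 1) s (sub_ne_zero.2 hs1) (riemannZeta_ne_zero_of_one_lt_re hs)
    (by fun_prop)
    (differentiableAt_riemannZeta hs1),
    ArithmeticFunction.LSeries_vonMangoldt_eq_deriv_riemannZeta_div hs]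
  simp [logDeriv_apply, neg_div]

theorem logDeriv_LFunction_of_one_lt_re {N : ℕ} [NeZero N] (χ : DirichletCharacter ℂ N) {s : ℂ}
    (hs : 1 < s.re) : logDeriv (LFunction χ) s = -LSeries (fun n ↦ χ n * (Λ n : ℂ)) s := by
  have h : LFunction χ =ᶠ[𝓝 s] LSeries (χ ·) := by
    filter_upwards [(isOpen_lt continuous_const continuous_re).mem_nhds hs] with z hz
    exact LFunction_eq_LSeries χ hz
  rw [logDeriv_apply, h.deriv_eq, h.eq_of_nhds]
  have := DirichletCharacter.LSeries_twist_vonMangoldt_eq χ hs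
  rw [show (fun n : ℕ ↦ χ n * (Λ n : ℂ)) = (fun n : ℕ ↦ χ n) * fun n ↦ (Λ n : ℂ) from rfl, this,
    neg_div, neg_neg]

/-- The coefficients of the Dirichlet series of minus the logarithmic derivative of
`ζ(s) L(s, χ)`. -/
noncomputable def vonMangoldtMulOneAdd {N : ℕ} (χ : DirichletCharacter ℂ N) (n : ℕ) : ℝ :=
  Λ n * (1 + (χ n).re)

theorem vonMangoldtMulOneAdd_nonneg {N : ℕ} (χ : DirichletCharacter ℂ N) (n : ℕ) :
    0 ≤ vonMangoldtMulOneAdd χ n := by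
  have := (abs_le.1 ((abs_re_le_norm _).trans (χ.norm_le_one n))).1
  exact mul_nonneg vonMangoldt_nonneg (by linarith)

theorem vonMangoldtMulOneAdd_le {N : ℕ} (χ : DirichletCharacter ℂ N) (n : ℕ) :
    vonMangoldtMulOneAdd χ n ≤ 2 * Λ n := by
  have := (abs_le.1 ((abs_re_le_norm _).trans (χ.norm_le_one n))).2
  have h := vonMangoldt_nonneg (n := n)
  rw [vonMangoldtMulOneAdd]
  nlinarith

theorem ofReal_re_of_inv_eq {N : ℕ} {χ : DirichletCharacter ℂ N} (hinv : χ⁻¹ = χ) (n : ZMod N) :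
    ((χ n).re : ℂ) = χ n := by
  rw [← conj_eq_iff_re]
  have := MulChar.star_apply' χ n
  rwa [hinv] at this

theorem LSeries_vonMangoldtMulOneAdd {N : ℕ} [NeZero N] {χ : DirichletCharacter ℂ N}
    (hinv : χ⁻¹ = χ) {s : ℂ} (hs : 1 < s.re) :
    LSeriesSummable (fun n ↦ (vonMangoldtMulOneAdd χ n : ℂ)) s ∧
    LSeries (fun n ↦ (vonMangoldtMulOneAdd χ n : ℂ)) s =
      LSeries (fun n ↦ (Λ n : ℂ)) s + LSeries (fun n ↦ χ n * (Λ n : ℂ)) s := by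
  have h : (fun n ↦ (vonMangoldtMulOneAdd χ n : ℂ)) =
      (fun n : ℕ ↦ (Λ n : ℂ)) + fun n : ℕ ↦ χ n * (Λ n : ℂ) := by
    ext n
    simp [vonMangoldtMulOneAdd, ofReal_re_of_inv_eq hinv]
    ring
  have h1 := ArithmeticFunction.LSeriesSummable_vonMangoldt hs
  have h2 : LSeriesSummable (fun n ↦ χ n * (Λ n : ℂ)) s :=
    DirichletCharacter.LSeriesSummable_twist_vonMangoldt χ hs
  rw [h]
  exact ⟨h1.add h2, LSeries_add h1 h2⟩

theorem logDeriv_zetaMulLFunction {N : ℕ} [NeZero N] {χ : DirichletCharacter ℂ N} (hχ : χ ≠ 1)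
    (hinv : χ⁻¹ = χ) {s : ℂ} (hs : 1 < s.re) : logDeriv (zetaMulLFunction χ) s =
      (s - 1)⁻¹ - LSeries (fun n ↦ (vonMangoldtMulOneAdd χ n : ℂ)) s := by
  have h1 : LFunctionTrivChar₁ 1 s ≠ 0 := by
    rw [LFunctionTrivChar₁_one_apply (by rintro rfl; simp at hs)]
    exact mul_ne_zero (sub_ne_zero.2 (by rintro rfl; simp at hs))
      (riemannZeta_ne_zero_of_one_lt_re hs)
  have h2 : LFunction χ s ≠ 0 := LFunction_ne_zero_of_one_le_re χ (.inl hχ) hs.le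
  have h3 : zetaMulLFunction χ = fun s ↦ LFunctionTrivChar₁ 1 s * LFunction χ s := rfl
  rw [h3, logDeriv_mul s h1 h2 (differentiable_LFunctionTrivChar₁ 1 s)
    (differentiable_LFunction hχ s), logDeriv_LFunctionTrivChar₁_one hs,
    logDeriv_LFunction_of_one_lt_re χ hs, (LSeries_vonMangoldtMulOneAdd hinv hs).2]
  ring

/-- The explicit inequality for an odd real primitive character. -/
theorem exp_half_mul_le_of_ERH {N : ℕ} [NeZero N] {χ : DirichletCharacter ℂ N} (herh : ERH)
    (hprim : χ.IsPrimitive) (hodd : χ.Odd) (hinv : χ⁻¹ = χ) {T : ℝ} (hT : 2 ≤ T) :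
    Real.exp (T / 2) * (8 * Real.sinh (1 / 2) ^ 2) ≤
      4 + 2 * (Real.log N / 2 - Real.log (2 * Real.pi) + 1 / 2 + Real.log 2 + 1) +
      ∑ n ∈ Finset.range ⌈Real.exp (T + 2)⌉₊,
        vonMangoldtMulOneAdd χ n * (n : ℝ) ^ (-(1 / 2) : ℝ) * tent (Real.log n - T) := by
  have hχ : χ ≠ 1 := hodd.ne_one
  have hd := differentiable_zetaMulLFunction hχ
  refine exp_half_mul_le (J := logDeriv (zetaMulLFunction χ)) (fun s hs ↦ ?_)
    (fun s hs ↦ neg_le_re_logDeriv_zetaMulLFunction herh hprim hodd hinv hs)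
    (vonMangoldtMulOneAdd_nonneg χ) (LSeries_vonMangoldtMulOneAdd hinv (by simp)).1
    (fun s hs ↦ logDeriv_zetaMulLFunction hχ hinv (by rw [hs]; norm_num)) hT
  exact (hd.deriv s).div (hd s) (zetaMulLFunction_ne_zero herh hχ hs)

end

section

open QuadraticAlgebra

/-- In the quadratic order of discriminant `D < 0`, a prime `p` that splits is the norm of an
ideal whose `E`-th power can only be principal if `|D| ≤ 4 p ^ E`. -/
theorem neg_le_of_isPrincipal_pow {a D : ℤ} (h4 : 4 * a = D - D ^ 2) (hneg : D < 0) {p : ℕ}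
    (hp : p.Prime) (hp2 : p ≠ 2) (hpD : ¬ (p : ℤ) ∣ D) {c : ℤ} (hc : (p : ℤ) ∣ c ^ 2 - D) {E : ℕ}
    (hE : E ≠ 0)
    (hprin : (Ideal.span {(p : QuadraticAlgebra ℤ a D), ⟨c + D, -2⟩} ^ E).IsPrincipal) :
    -D ≤ 4 * (p : ℤ) ^ E := by
  have hpZ : Prime (p : ℤ) := Nat.prime_iff_prime_int.1 hp
  have hp2' : ¬ (p : ℤ) ∣ 2 := fun h ↦ hp2 <|
    (Nat.prime_dvd_prime_iff_eq hp Nat.prime_two).1 (by exact_mod_cast h)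
  have hpc : ¬ (p : ℤ) ∣ c := fun h ↦ hpD <| by
    have := dvd_sub (dvd_pow h two_ne_zero) hc
    simpa using this
  have hp2c : ¬ (p : ℤ) ∣ 2 * c := fun h ↦ (hpZ.dvd_or_dvd h).elim hp2' hpc
  obtain ⟨m, hm⟩ := hc
  set u : QuadraticAlgebra ℤ a D := ⟨c + D, -2⟩ with hu
  set v : QuadraticAlgebra ℤ a D := ⟨c - D, 2⟩ with hv
  have huv : u * v = (p : QuadraticAlgebra ℤ a D) * m := by
    ext <;> simp [hu, hv]
    · linear_combination hm - h4
    · ring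
  have hadd : u + v = (2 * c : ℤ) := by
    ext <;> simp [hu, hv]
    ring
  have hvu : v = star u := by
    ext <;> simp [hu, hv]
    ring
  set P := Ideal.span {(p : QuadraticAlgebra ℤ a D), u} with hP
  set Q := Ideal.span {(p : QuadraticAlgebra ℤ a D), v} with hQ
  have hpPQ : (p : QuadraticAlgebra ℤ a D) ∈ P * Q := by
    have hcop : IsCoprime (p : ℤ) (2 * c) := (hpZ.coprime_iff_not_dvd).2 hp2c
    obtain ⟨x, y, hxy⟩ := hcop
    have h1 : (p : QuadraticAlgebra ℤ a D) ∈ P := Ideal.subset_span (by simp)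
    have h2 : u ∈ P := Ideal.subset_span (by simp)
    have h3 : (p : QuadraticAlgebra ℤ a D) ∈ Q := Ideal.subset_span (by simp)
    have h4 : v ∈ Q := Ideal.subset_span (by simp)
    have h5 : (p : QuadraticAlgebra ℤ a D) = x * (p * p) + y * (p * v + u * p) := by
      have h6 : ((x * p + y * (2 * c) : ℤ) : QuadraticAlgebra ℤ a D) = 1 := by
        rw [hxy, Int.cast_one]
      push_cast at h6 hadd
      linear_combination (-p : QuadraticAlgebra ℤ a D) * h6 - y * p * hadd
    rw [h5]
    exact Ideal.add_mem _ (Ideal.mul_mem_left _ _ (Ideal.mul_mem_mul h1 h3))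
      (Ideal.mul_mem_left _ _ (Ideal.add_mem _ (Ideal.mul_mem_mul h1 h4) (Ideal.mul_mem_mul h2 h3)))
  obtain ⟨α, hα⟩ := hprin
  have hα' : P ^ E = Ideal.span {α} := hα
  have hQP : Q = P.map (starRingEnd (QuadraticAlgebra ℤ a D)) := by
    rw [hP, Ideal.map_span, Set.image_pair]
    simp [starRingEnd_apply, ← hvu, hQ]
  have hQα : Q ^ E = Ideal.span {star α} := by
    rw [hQP, ← Ideal.map_pow, hα', Ideal.map_span, Set.image_singleton, starRingEnd_apply]
  have hN : ((α.norm : ℤ) : QuadraticAlgebra ℤ a D) = α * star α := by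
    rw [← algebraMap_norm_eq_mul_star]
    rfl
  have hdvd : α.norm ∣ (p : ℤ) ^ E := by
    have h1 : (p : QuadraticAlgebra ℤ a D) ^ E ∈ (P * Q) ^ E := Ideal.pow_mem_pow hpPQ E
    rw [mul_pow, hα', hQα, Ideal.span_singleton_mul_span_singleton, Ideal.mem_span_singleton,
      ← hN] at h1
    have h2 : (algebraMap ℤ (QuadraticAlgebra ℤ a D) α.norm) ∣
        algebraMap ℤ (QuadraticAlgebra ℤ a D) (p ^ E) := by
      simpa using h1
    exact (algebraMap_dvd_iff_dvd).1 h2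
  have hle := Int.le_of_dvd (by have := hp.pos; positivity) hdvd
  have h4N : 4 * α.norm = (2 * α.re + D * α.im) ^ 2 - D * α.im ^ 2 := by
    rw [norm_def]
    linear_combination (-α.im ^ 2) * h4
  rcases eq_or_ne α.im 0 with him | him
  · exfalso
    have hαx : α = ((α.re : ℤ) : QuadraticAlgebra ℤ a D) := by ext <;> simp [him]
    have hpow : ∀ k, ∃ z : QuadraticAlgebra ℤ a D,
        u ^ (k + 1) = ((2 * c : ℤ) : QuadraticAlgebra ℤ a D) ^ k * u + p * z := by
      intro k
      induction k with
      | zero => exact ⟨0, by simp⟩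
      | succ k ih =>
        obtain ⟨z, hz⟩ := ih
        refine ⟨-((2 * c : ℤ) : QuadraticAlgebra ℤ a D) ^ k * m + z * u, ?_⟩
        rw [pow_succ, hz, pow_succ (((2 * c : ℤ) : QuadraticAlgebra ℤ a D)), ← hadd]
        linear_combination (-(u + v) ^ k) * huv
    have hαp : (α.re : ℤ) ∣ (p : ℤ) ^ E := by
      refine dvd_trans ?_ hdvd
      rw [norm_def, him]
      exact ⟨α.re, by ring⟩
    obtain ⟨i, -, hi⟩ := (dvd_prime_pow hpZ E).1 hαp
    rcases Nat.eq_zero_or_pos i with rfl | hi0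
    · have hunit : IsUnit α := by
        rw [pow_zero] at hi
        have := (hi.symm.isUnit isUnit_one).map (Int.castRingHom (QuadraticAlgebra ℤ a D))
        rw [hαx]
        exact this
      have h1 : P = ⊤ := by
        rw [← top_le_iff, ← Ideal.span_singleton_eq_top.2 hunit, ← hα']
        exact Ideal.pow_le_self hE
      have h2 : (1 : QuadraticAlgebra ℤ a D) ∈ P := h1 ▸ Submodule.mem_top
      obtain ⟨β, γ, h3⟩ := Ideal.mem_span_pair.1 h2
      have h4 : (p : QuadraticAlgebra ℤ a D) * (β * v + γ * m) = v := by
        linear_combination v * h3 - γ * huv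
      have h5 := congrArg im h4
      simp only [im_mul, re_natCast, im_natCast, zero_mul, mul_zero, add_zero, hv] at h5
      exact hp2' ⟨_, h5.symm⟩
    · have hpα : (p : ℤ) ∣ α.re := (dvd_pow_self _ hi0.ne').trans hi.symm.dvd
      obtain ⟨k, rfl⟩ := Nat.exists_eq_add_one_of_ne_zero hE
      have h1 : u ^ (k + 1) ∈ P ^ (k + 1) := Ideal.pow_mem_pow (Ideal.subset_span (by simp)) _
      rw [hα', Ideal.mem_span_singleton, hαx] at h1
      obtain ⟨z, hz⟩ := hpow k
      obtain ⟨w, hw⟩ := h1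
      obtain ⟨r, hr⟩ := hpα
      have h2 : ((2 * c : ℤ) : QuadraticAlgebra ℤ a D) ^ k * u = (p : QuadraticAlgebra ℤ a D) *
          (r * w - z) := by
        have h3 : (α.re : QuadraticAlgebra ℤ a D) = p * r := by rw [hr]; push_cast; rfl
        linear_combination hw - hz + w * h3
      have h5 := congrArg im h2
      rw [← Int.cast_pow] at h5
      simp only [im_mul, re_natCast, im_natCast, zero_mul, mul_zero, add_zero, hu, re_intCast,
        im_intCast, Int.cast_id] at h5
      have h6 : (p : ℤ) ∣ (2 * c) ^ k * 2 := by
        rw [← dvd_neg]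
        exact ⟨_, by rw [← h5]; ring⟩
      rcases hpZ.dvd_or_dvd h6 with h | h
      · exact hp2c (hpZ.dvd_of_dvd_pow h)
      · exact hp2' h
  · have : 0 < α.im ^ 2 := by positivity
    nlinarith [sq_nonneg (2 * α.re + D * α.im)]

end

section

open QuadraticAlgebra

theorem IsFundamentalDiscriminant.dvd_of_sq_eq {D k t n : ℤ} (hD : IsFundamentalDiscriminant D)
    (h : k ^ 2 = D * (t ^ 2 - 4 * n)) : D ∣ k := by
  obtain ⟨-, ⟨-, hsq⟩ | ⟨m, rfl, hsq, hm⟩⟩ := hD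
  · exact (hsq.dvd_pow_iff_dvd two_ne_zero).1 ⟨_, h⟩
  · have hk2 : Even (k ^ 2) := by
      rw [h]
      exact ⟨2 * m * (t ^ 2 - 4 * n), by ring⟩
    obtain ⟨l, rfl⟩ := (Int.even_pow' two_ne_zero).1 hk2
    have hl : l ^ 2 = m * (t ^ 2 - 4 * n) := by linarith
    obtain ⟨j, rfl⟩ := (hsq.dvd_pow_iff_dvd two_ne_zero).1 ⟨_, hl⟩
    have hm0 : m ≠ 0 := hsq.ne_zero
    have hj : m * j ^ 2 = t ^ 2 - 4 * n := by
      apply mul_left_cancel₀ hm0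
      linear_combination hl
    have hj2 : j % 2 = 0 := by
      by_contra hodd
      have hj4 : j ^ 2 % 4 = 1 := Int.sq_mod_four_eq_one_of_odd (Int.odd_iff.2 (by omega))
      have ht : t ^ 2 % 4 = 0 ∨ t ^ 2 % 4 = 1 := by
        rcases Int.even_or_odd t with ⟨r, rfl⟩ | ht
        · left
          rw [show (r + r) ^ 2 = 4 * r ^ 2 by ring]
          omega
        · exact .inr (Int.sq_mod_four_eq_one_of_odd ht)
      have hmj : m * j ^ 2 % 4 = m % 4 := by
        rw [Int.mul_emod, hj4]
        omega
      omega
    obtain ⟨i, rfl⟩ := Int.dvd_of_emod_eq_zero hj2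
    exact ⟨i, by ring⟩

theorem IsFundamentalDiscriminant.exists_four_mul_eq {D : ℤ} (hD : IsFundamentalDiscriminant D) :
    ∃ a, 4 * a = D - D ^ 2 := by
  suffices h : 4 ∣ D - D ^ 2 from h.imp fun a h ↦ h.symm
  obtain ⟨-, ⟨h, -⟩ | ⟨m, rfl, -, -⟩⟩ := hD
  · have : (4 : ℤ) ∣ 1 - D := by omega
    exact (this.mul_left D).trans (dvd_of_eq (by ring))
  · exact ⟨m - 4 * m ^ 2, by ring⟩

theorem exists_intCast_eq_of_isIntegral {q : ℚ} (hq : IsIntegral ℤ q) : ∃ n : ℤ, (n : ℚ) = q :=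
  IsIntegrallyClosed.isIntegral_iff.1 hq

theorem IsFundamentalDiscriminant.exists_intCast_eq {D a t n : ℤ}
    (hD : IsFundamentalDiscriminant D) (h4 : 4 * a = D - D ^ 2) {x y : ℚ} (ht : 2 * x + D * y = t)
    (hn : x * x + D * x * y - a * y * y = n) : ∃ X Y : ℤ, (X : ℚ) = x ∧ (Y : ℚ) = y := by
  have hD0 : (D : ℚ) ≠ 0 := by
    obtain ⟨-, ⟨-, hsq⟩ | ⟨m, rfl, hsq, hm⟩⟩ := hD
    · exact_mod_cast hsq.ne_zero
    · have := hsq.ne_zero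
      exact_mod_cast mul_ne_zero (by norm_num) this
  have h4' : 4 * (a : ℚ) = D - D ^ 2 := by exact_mod_cast h4
  have hk2 : ((D : ℚ) * y) ^ 2 = ((D * (t ^ 2 - 4 * n) : ℤ) : ℚ) := by
    push_cast
    rw [← ht, ← hn]
    linear_combination -D * y ^ 2 * h4'
  obtain ⟨k, hk⟩ : ∃ k : ℤ, (k : ℚ) = D * y := by
    refine exists_intCast_eq_of_isIntegral (IsIntegral.of_pow two_pos ?_)
    rw [hk2]
    exact isIntegral_algebraMap (A := ℚ) (R := ℤ)
  rw [← hk] at hk2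
  obtain ⟨Y, rfl⟩ := hD.dvd_of_sq_eq (by exact_mod_cast hk2)
  have hY : (Y : ℚ) = y := by
    push_cast at hk
    exact mul_left_cancel₀ hD0 hk
  have h5 : D * Y ^ 2 = t ^ 2 - 4 * n := by
    have : D ≠ 0 := by exact_mod_cast hD0
    apply mul_left_cancel₀ this
    have : (D * Y) ^ 2 = D * (t ^ 2 - 4 * n) := by exact_mod_cast hk2
    linear_combination this
  have h6 : (2 : ℤ) ∣ t - D * Y := by
    have h7 : Even ((t - D * Y) ^ 2) :=
      ⟨2 * n + D * Y ^ 2 - t * D * Y - 2 * a * Y ^ 2, by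
        linear_combination -h5 + Y ^ 2 * h4⟩
    exact ((Int.even_pow' two_ne_zero).1 h7).two_dvd
  obtain ⟨X, hX⟩ := h6
  refine ⟨X, Y, ?_, hY⟩
  have : (t : ℚ) - D * Y = 2 * X := by exact_mod_cast hX
  rw [hY] at this
  linarith

/-- The inclusion of a quadratic order in its field of fractions. -/
def quadraticIntCast (a b : ℤ) :
    QuadraticAlgebra ℤ a b →+* QuadraticAlgebra ℚ (a : ℚ) (b : ℚ) where
  toFun z := ⟨z.re, z.im⟩
  map_one' := by ext <;> simp
  map_zero' := by ext <;> simp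
  map_mul' z w := by ext <;> simp
  map_add' z w := by ext <;> simp

theorem quadraticIntCast_injective (a b : ℤ) : Function.Injective (quadraticIntCast a b) := by
  intro z w h
  have h1 := congrArg re h
  have h2 := congrArg im h
  ext
  · exact Int.cast_injective (α := ℚ) h1
  · exact Int.cast_injective (α := ℚ) h2

theorem IsFundamentalDiscriminant.isIntegral_iff {D a : ℤ} (hD : IsFundamentalDiscriminant D)
    (h4 : 4 * a = D - D ^ 2) {z : QuadraticAlgebra ℚ (a : ℚ) (D : ℚ)} :
    IsIntegral ℤ z ↔ ∃ y, quadraticIntCast a D y = z := by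
  constructor
  · intro hz
    have hz' : IsIntegral ℤ (star z) :=
      hz.map ((starRingEnd (QuadraticAlgebra ℚ (a : ℚ) (D : ℚ))).toIntAlgHom)
    have hinj := algebraMap_injective (R := ℚ) (a := (a : ℚ)) (b := (D : ℚ))
    have h1 : IsIntegral ℤ (trace z) := by
      rw [← isIntegral_algebraMap_iff hinj, algebraMap_trace_eq_add_star]
      exact hz.add hz'
    have h2 : IsIntegral ℤ (QuadraticAlgebra.norm z) := by
      rw [← isIntegral_algebraMap_iff hinj, algebraMap_norm_eq_mul_star]
      exact hz.mul hz'
    obtain ⟨t, ht⟩ := exists_intCast_eq_of_isIntegral h1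
    obtain ⟨n, hn⟩ := exists_intCast_eq_of_isIntegral h2
    obtain ⟨X, Y, hX, hY⟩ := hD.exists_intCast_eq h4 ht.symm hn.symm
    exact ⟨⟨X, Y⟩, QuadraticAlgebra.ext hX hY⟩
  · rintro ⟨y, rfl⟩
    exact (Algebra.IsIntegral.isIntegral (R := ℤ) y).map (quadraticIntCast a D).toIntAlgHom

theorem quadraticAlgebra_basis_apply (a b : ℤ) (i : Fin 2) :
    QuadraticAlgebra.basis a b i = if i = 0 then ⟨1, 0⟩ else ⟨0, 1⟩ := by
  apply (QuadraticAlgebra.basis a b).repr.injective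
  rw [Module.Basis.repr_self]
  ext j
  fin_cases i <;> fin_cases j <;> simp

theorem discr_basis_eq {a D : ℤ} (h4 : 4 * a = D - D ^ 2) :
    Algebra.discr ℤ (QuadraticAlgebra.basis a D) = D := by
  have htr (z : QuadraticAlgebra ℤ a D) : Algebra.trace ℤ _ z = 2 * z.re + D * z.im := by
    rw [Algebra.trace_eq_matrix_trace (QuadraticAlgebra.basis a D), Matrix.trace_fin_two]
    simp [Algebra.leftMulMatrix_apply, LinearMap.toMatrix_apply, quadraticAlgebra_basis_apply]
    ring
  rw [Algebra.discr_def, Matrix.det_fin_two]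
  simp [Algebra.traceMatrix_apply, Algebra.traceForm_apply, htr, quadraticAlgebra_basis_apply]
  linear_combination h4

theorem exists_isPrincipal_pow {R : Type*} [CommRing R] [IsDedekindDomain R]
    [Finite (ClassGroup R)] {k : ℕ} (hk : Monoid.exponent (ClassGroup R) ≤ k) :
    ∃ E, E ≠ 0 ∧ E ≤ k ∧ ∀ I : Ideal R, I ≠ ⊥ → (I ^ E).IsPrincipal := by
  refine ⟨Monoid.exponent (ClassGroup R), Monoid.exponent_ne_zero_of_finite, hk, fun I hI ↦ ?_⟩
  have h := Monoid.pow_exponent_eq_one (ClassGroup.mk0 ⟨I, mem_nonZeroDivisors_of_ne_zero hI⟩)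
  rw [← map_pow, ClassGroup.mk0_eq_one_iff] at h
  exact h

theorem IsFundamentalDiscriminant.exists_isPrincipal_pow {D a : ℤ}
    (hD : IsFundamentalDiscriminant D) (hneg : D < 0) (h4 : 4 * a = D - D ^ 2) {k : ℕ}
    (hexp : ∀ (K : Type) [Field K] [NumberField K], Module.finrank ℚ K = 2 →
      NumberField.discr K = D → Monoid.exponent (ClassGroup (𝓞 K)) ≤ k) :
    ∃ E, E ≠ 0 ∧ E ≤ k ∧
      ∀ I : Ideal (QuadraticAlgebra ℤ a D), I ≠ ⊥ → (I ^ E).IsPrincipal := by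
  have h4' : 4 * (a : ℚ) = D - D ^ 2 := by exact_mod_cast h4
  have hneg' : (D : ℚ) < 0 := by exact_mod_cast hneg
  have : Fact (∀ r : ℚ, r ^ 2 ≠ a + D * r) :=
    ⟨fun r hr ↦ by nlinarith [sq_nonneg (2 * r - D)]⟩
  let K := QuadraticAlgebra ℚ (a : ℚ) (D : ℚ)
  have hfr : Module.finrank ℚ K = 2 := by
    convert QuadraticAlgebra.finrank_eq_two (a : ℚ) (D : ℚ)
  have : CharZero K := inferInstance
  have : NumberField K := { to_finiteDimensional := Module.finite_of_finrank_eq_succ hfr }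
  let : Algebra (QuadraticAlgebra ℤ a D) K := (quadraticIntCast a D).toAlgebra
  have : IsIntegralClosure (QuadraticAlgebra ℤ a D) ℤ K :=
    ⟨quadraticIntCast_injective a D, hD.isIntegral_iff h4⟩
  let e : 𝓞 K ≃+* QuadraticAlgebra ℤ a D := RingOfIntegers.equiv _
  have hdisc : NumberField.discr K = D := by
    rw [← NumberField.discr_eq_discr K
      ((QuadraticAlgebra.basis a D).map e.symm.toIntAlgEquiv.toLinearEquiv)]
    refine Eq.trans ?_ (discr_basis_eq h4)
    rw [Algebra.discr_eq_discr_of_algEquiv _ e.symm.toIntAlgEquiv]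
    congr 1
  obtain ⟨E, hE0, hE, h⟩ := _root_.exists_isPrincipal_pow (hexp K hfr hdisc)
  refine ⟨E, hE0, hE, fun I hI ↦ ?_⟩
  have h1 := h (I.map e.symm) (by rwa [ne_eq, Ideal.map_eq_bot_iff_of_injective e.symm.injective])
  rw [← Ideal.map_pow] at h1
  obtain ⟨x, hx⟩ := h1
  refine ⟨e x, ?_⟩
  have h2 := congrArg (Ideal.map e) hx
  rw [Ideal.submodule_span_eq, Ideal.map_span, Set.image_singleton, Ideal.map_symm,
    Ideal.map_comap_of_surjective _ e.surjective] at h2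
  exact h2

theorem IsFundamentalDiscriminant.neg_le_of_dvd_sq_sub {D : ℤ}
    (hD : IsFundamentalDiscriminant D) (hneg : D < 0) {k : ℕ}
    (hexp : ∀ (K : Type) [Field K] [NumberField K], Module.finrank ℚ K = 2 →
      NumberField.discr K = D → Monoid.exponent (ClassGroup (𝓞 K)) ≤ k) {p : ℕ}
    (hp : p.Prime) (hp2 : p ≠ 2) (hpD : ¬ (p : ℤ) ∣ D) {c : ℤ} (hc : (p : ℤ) ∣ c ^ 2 - D) :
    -D ≤ 4 * (p : ℤ) ^ k := by
  obtain ⟨a, h4⟩ := hD.exists_four_mul_eq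
  obtain ⟨E, hE0, hE, h⟩ := hD.exists_isPrincipal_pow hneg h4 hexp
  refine (neg_le_of_isPrincipal_pow h4 hneg hp hp2 hpD hc hE0 (h _ ?_)).trans ?_
  · intro h0
    have h1 : (p : QuadraticAlgebra ℤ a D) ∈ (⊥ : Ideal (QuadraticAlgebra ℤ a D)) :=
      h0 ▸ Ideal.subset_span (by simp)
    exact hp.ne_zero (by exact_mod_cast (Ideal.mem_bot.1 h1))
  · have : (1 : ℤ) ≤ p := by exact_mod_cast hp.one_le
    gcongr

end

section

open DirichletCharacter NumberTheorySymbols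

/-- The Kronecker symbol `(D / ·)`, as a Dirichlet character of level `4|D|`. -/
noncomputable def jacobiCharacter (D : ℤ) [NeZero (4 * D.natAbs)] :
    DirichletCharacter ℂ (4 * D.natAbs) where
  toFun n := open Classical in if IsUnit n then ((J(D | n.val) : ℤ) : ℂ) else 0
  map_one' := by
    have h : 1 < 4 * D.natAbs := by
      have := NeZero.ne (4 * D.natAbs)
      omega
    have : Fact (1 < 4 * D.natAbs) := ⟨h⟩
    simp [ZMod.val_one]
  map_mul' a b := by
    by_cases ha : IsUnit a
    · by_cases hb : IsUnit b
      · have hodd {c : ZMod (4 * D.natAbs)} (hc : IsUnit c) : _root_.Odd c.val := by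
          have := ((ZMod.isUnit_iff_coprime c.val _).1 (by simpa using hc)).coprime_dvd_right
            (Dvd.intro (2 * D.natAbs) (by ring) : 2 ∣ 4 * D.natAbs)
          exact (Nat.coprime_two_right).1 this
        rw [if_pos (ha.mul hb), if_pos ha, if_pos hb, ZMod.val_mul,
          ← jacobiSym.mod_right D ((hodd ha).mul (hodd hb)),
          jacobiSym.mul_right' D (hodd ha).pos.ne' (hodd hb).pos.ne']
        push_cast
        ring
      · have : ¬ IsUnit (a * b) := fun h ↦ hb (isUnit_of_mul_isUnit_right h)
        simp [hb, this]
    · have : ¬ IsUnit (a * b) := fun h ↦ ha (isUnit_of_mul_isUnit_left h)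
      simp [ha, this]
  map_nonunit' a ha := by simp [ha]

lemma jacobiCharacter_apply (D : ℤ) [NeZero (4 * D.natAbs)] {n : ℕ}
    (hn : n.Coprime (4 * D.natAbs)) : jacobiCharacter D n = ((J(D | n) : ℤ) : ℂ) := by
  have hodd : _root_.Odd n := Nat.coprime_two_right.1
    (hn.coprime_dvd_right (Dvd.intro (2 * D.natAbs) (by ring) : 2 ∣ 4 * D.natAbs))
  have h : jacobiCharacter D n = if IsUnit (n : ZMod (4 * D.natAbs)) then
    ((J(D | (n : ZMod (4 * D.natAbs)).val) : ℤ) : ℂ) else 0 := by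
      classical
      simp [jacobiCharacter]
  rw [h, if_pos ((ZMod.isUnit_iff_coprime _ _).2 hn), ZMod.val_natCast,
    ← jacobiSym.mod_right D hodd]

lemma jacobiCharacter_isQuadratic (D : ℤ) [NeZero (4 * D.natAbs)] :
    (jacobiCharacter D).IsQuadratic := by
  intro a
  by_cases ha : IsUnit a
  · obtain ⟨n, rfl⟩ := ZMod.natCast_zmod_surjective a
    rw [jacobiCharacter_apply D ((ZMod.isUnit_iff_coprime _ _).1 ha)]
    rcases jacobiSym.trichotomy D n with h | h | h <;> simp [h]
  · exact .inl (MulChar.map_nonunit _ ha)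

lemma jacobiCharacter_odd {D : ℤ} [NeZero (4 * D.natAbs)] (hD : D < 0) :
    (jacobiCharacter D).Odd := by
  obtain ⟨d, rfl⟩ : ∃ d : ℕ, D = -(d + 1 : ℕ) := ⟨D.natAbs - 1, by omega⟩
  have habs : (-((d + 1 : ℕ) : ℤ)).natAbs = d + 1 := by omega
  have hcast : (-1 : ZMod (4 * (-((d + 1 : ℕ) : ℤ)).natAbs)) = ((4 * d + 3 : ℕ) : ZMod _) := by
    rw [neg_eq_iff_add_eq_zero, ← Nat.cast_one (R := ZMod _), ← Nat.cast_add,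
      ZMod.natCast_eq_zero_iff, habs]
    exact ⟨1, by ring⟩
  have hodd : _root_.Odd (4 * d + 3) := ⟨2 * d + 1, by ring⟩
  have hcop : (4 * d + 3).Coprime (4 * (d + 1)) := by
    rw [show 4 * (d + 1) = 4 * d + 3 + 1 by ring]
    simp
  have hfour : J((2 : ℤ) ^ 2 | 4 * d + 3) = 1 := by
    refine jacobiSym.sq_one' ?_
    rw [Int.gcd_eq_natAbs_gcd_natAbs]
    exact Nat.coprime_two_left.2 hodd
  rw [DirichletCharacter.Odd, hcast, jacobiCharacter_apply _ (by rwa [habs])]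
  have hmod : J((2 : ℤ) ^ 2 * -((d + 1 : ℕ) : ℤ) | 4 * d + 3) = J(-1 | 4 * d + 3) := by
    refine jacobiSym.mod_left' ((Int.emod_eq_emod_iff_emod_sub_eq_zero).2
      (Int.emod_eq_zero_of_dvd ⟨-1, ?_⟩))
    push_cast
    ring
  rw [jacobiSym.mul_left, hfour, one_mul, jacobiSym.at_neg_one hodd,
    ZMod.χ₄_nat_three_mod_four (by omega)] at hmod
  rw [hmod]
  simp

/-- For `D < 0` there is an odd primitive quadratic character, of conductor at most `4|D|`, taking
the value `-1` at the odd primes modulo which `D` is not a square. -/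
theorem exists_isPrimitive_odd_eq_neg_one {D : ℤ} (hD : D < 0) :
    ∃ (N : ℕ) (_ : NeZero N) (χ : DirichletCharacter ℂ N), N ≤ 4 * D.natAbs ∧ χ.IsPrimitive ∧
      χ.Odd ∧ χ⁻¹ = χ ∧ ∀ p : ℕ, p.Prime → p ≠ 2 → ¬ (p : ℤ) ∣ D →
        (∀ c : ℤ, ¬ (p : ℤ) ∣ c ^ 2 - D) → χ p = -1 := by
  have hM : NeZero (4 * D.natAbs) := ⟨by omega⟩
  set χ₀ := jacobiCharacter D with hχ₀
  have hN : NeZero χ₀.conductor :=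
    ⟨fun h ↦ NeZero.ne (4 * D.natAbs) (Nat.eq_zero_of_zero_dvd (h ▸ χ₀.conductor_dvd_level))⟩
  refine ⟨χ₀.conductor, hN, χ₀.primitiveCharacter,
    Nat.le_of_dvd (Nat.pos_of_ne_zero (NeZero.ne _)) χ₀.conductor_dvd_level,
    χ₀.primitiveCharacter_isPrimitive, ?_, ?_, ?_⟩
  · have h := χ₀.primitiveCharacter_apply_of_isCoprime (a := -1) isCoprime_one_left.neg_left
    push_cast at h
    rw [DirichletCharacter.Odd, h]
    exact jacobiCharacter_odd hD
  · refine changeLevel_injective χ₀.conductor_dvd_level ?_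
    rw [map_inv, changeLevel_primitiveCharacter]
    exact (jacobiCharacter_isQuadratic D).inv
  · intro p hp hp2 hpD hc
    have : Fact p.Prime := ⟨hp⟩
    have hcop : p.Coprime (4 * D.natAbs) := by
      rw [hp.coprime_iff_not_dvd, hp.dvd_mul, not_or]
      refine ⟨fun h ↦ hp2 ?_, fun h ↦ hpD (Int.natCast_dvd.2 h)⟩
      exact (Nat.prime_dvd_prime_iff_eq hp Nat.prime_two).1
        (hp.dvd_of_dvd_pow (show p ∣ 2 ^ 2 by simpa using h))
    have h := χ₀.primitiveCharacter_apply_of_isCoprime (a := (p : ℤ))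
      (by exact_mod_cast hcop.isCoprime)
    push_cast at h
    rw [h, hχ₀, jacobiCharacter_apply D hcop, ← jacobiSym.legendreSym.to_jacobiSym]
    have hD0 : (D : ZMod p) ≠ 0 := by rwa [Ne, ZMod.intCast_zmod_eq_zero_iff_dvd]
    have : legendreSym p D = -1 := by
      refine (legendreSym.eq_neg_one_iff p).2 ?_
      rintro ⟨r, hr⟩
      obtain ⟨c, rfl⟩ := ZMod.intCast_surjective r
      refine hc c ?_
      rw [← ZMod.intCast_zmod_eq_zero_iff_dvd]
      push_cast
      rw [hr]
      ring
    rw [this]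
    simp

end

section

open Chebyshev Finset ArithmeticFunction

/-- An explicit bound for the contribution of the proper prime powers to `ψ`. -/
lemma psi_sub_theta_le_const_mul_sqrt (y : ℝ) : psi y - theta y ≤ 4.91 * √y := by
  rcases lt_or_ge y 2 with hy | hy
  · rw [theta_eq_zero_of_lt_two hy, psi_eq_zero_of_lt_two hy, sub_zero]
    positivity
  have hy0 : 0 < y := by linarith
  rw [psi_eq_theta_add_sum_theta hy, add_sub_cancel_left]
  set K := ⌊Real.log y / Real.log 2⌋₊ with hK
  set t := Real.log y with ht
  have hlog2 := Real.log_two_gt_d9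
  have hlog2' := Real.log_two_lt_d9
  have ht0 : 0 ≤ t := Real.log_nonneg (by linarith)
  have hKt : (K : ℝ) ≤ t / Real.log 2 := Nat.floor_le (by positivity)
  rcases lt_or_ge K 2 with h2 | h2
  · rw [Icc_eq_empty (by omega), sum_empty]
    positivity
  have hsq : √y = Real.exp (t / 2) := by
    rw [Real.sqrt_eq_rpow, Real.rpow_def_of_pos hy0]
    congr 1
    ring
  have hcube : y ^ (1 / 3 : ℝ) = √y * Real.exp (-(t / 6)) := by
    rw [hsq, ← Real.exp_add, Real.rpow_def_of_pos hy0]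
    congr 1
    ring
  have hlog4 : Real.log 4 = 2 * Real.log 2 := by
    rw [show (4 : ℝ) = 2 ^ 2 by norm_num, Real.log_pow]
    norm_num
  have hsum : ∑ n ∈ Icc 2 K, theta (y ^ ((1 : ℝ) / n)) ≤
      Real.log 4 * √y + (K - 2) * (Real.log 4 * (√y * Real.exp (-(t / 6)))) := by
    rw [← add_sum_Ioc_eq_sum_Icc h2]
    refine add_le_add ?_ ?_
    · refine (theta_le_log4_mul_x (by positivity)).trans_eq ?_
      rw [Real.sqrt_eq_rpow]
      norm_num
    · refine (sum_le_card_nsmul _ _ (Real.log 4 * (√y * Real.exp (-(t / 6))))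
        fun n hn ↦ ?_).trans_eq ?_
      · refine (theta_le_log4_mul_x (by positivity)).trans ?_
        rw [← hcube]
        have hn3 : (3 : ℝ) ≤ n := by exact_mod_cast (mem_Ioc.1 hn).1
        gcongr
        linarith
      · rw [Nat.card_Ioc, nsmul_eq_mul, Nat.cast_sub h2]
        norm_num
  have hexp : 3.415 * (1 + (t / 6 - 1.23)) ≤ Real.exp (t / 6) := by
    have h1 : Real.exp (t / 6) = Real.exp 1 * Real.exp 0.23 * Real.exp (t / 6 - 1.23) := by
      rw [← Real.exp_add, ← Real.exp_add]
      congr 1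
      ring
    have h2 := Real.exp_one_gt_d9
    have h3 := Real.quadratic_le_exp_of_nonneg (x := 0.23) (by norm_num)
    have h4 : 3.415 ≤ Real.exp 1 * Real.exp 0.23 := by
      nlinarith
    have h5 := Real.add_one_le_exp (t / 6 - 1.23)
    rw [h1]
    calc _ ≤ 3.415 * Real.exp (t / 6 - 1.23) := by linarith
      _ ≤ _ := by gcongr
  have hKexp : (K - 2 : ℝ) * Real.exp (-(t / 6)) ≤ 2.54 := by
    rw [Real.exp_neg, ← div_eq_mul_inv, div_le_iff₀ (Real.exp_pos _)]
    have : t / Real.log 2 ≤ 1.4427 * t := by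
      rw [div_le_iff₀ (by positivity)]
      nlinarith
    linarith
  have := Real.sqrt_nonneg y
  calc _ ≤ _ := hsum
    _ = Real.log 4 * (1 + (K - 2) * Real.exp (-(t / 6))) * √y := by ring
    _ ≤ 4.91 * √y := by
      gcongr
      rw [hlog4]
      nlinarith

/-- Partial summation against `n ^ (-1/2)`. -/
lemma sum_mul_rpow_neg_half_le {f : ℕ → ℝ} (hf : ∀ n, 0 ≤ f n) {C : ℝ}
    (hC : ∀ n : ℕ, ∑ k ∈ Ioc 0 n, f k ≤ C * √n) {m M : ℕ} (hm : 0 < m) (hmM : m ≤ M) :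
    ∑ n ∈ Icc m M, f n * (n : ℝ) ^ (-(1 / 2) : ℝ) ≤
      C * (1 + (Real.log M - Real.log m) / 2) := by
  have hpow (n : ℕ) : (n : ℝ) ^ (-(1 / 2) : ℝ) = (√n)⁻¹ := by
    rw [Real.rpow_neg n.cast_nonneg, Real.sqrt_eq_rpow]
  simp_rw [hpow]
  have key : ∑ n ∈ Icc m M, f n * (√n)⁻¹ ≤
      (∑ k ∈ Ioc 0 M, f k) * (√M)⁻¹ + C * ((Real.log M - Real.log m) / 2) := by
    induction M, hmM using Nat.le_induction with
    | base =>
      rw [Icc_self, sum_singleton, sub_self, zero_div, mul_zero, add_zero]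
      gcongr
      exact single_le_sum (fun n _ ↦ hf n) (mem_Ioc.2 ⟨hm, le_rfl⟩)
    | succ M hmM ih =>
      rw [sum_Icc_succ_top (by omega), sum_Ioc_succ_top (by omega)]
      have hM : (0 : ℝ) < M := by exact_mod_cast hm.trans_le hmM
      have hM1 : (0 : ℝ) < (M + 1 : ℕ) := by positivity
      have hmono : (√(M + 1 : ℕ))⁻¹ ≤ (√M)⁻¹ := by
        gcongr
        simp
      have hstep : √M * ((√M)⁻¹ - (√(M + 1 : ℕ))⁻¹) ≤
          (Real.log (M + 1 : ℕ) - Real.log M) / 2 := by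
        have h := Real.one_sub_inv_le_log_of_pos (x := √(M + 1 : ℕ) / √M) (by positivity)
        rw [Real.log_div (by positivity) (by positivity), Real.log_sqrt hM1.le,
          Real.log_sqrt hM.le, inv_div] at h
        rw [mul_sub, mul_inv_cancel₀ (by positivity), ← div_eq_mul_inv]
        linarith
      have hC0 : 0 ≤ C := by
        have := (sum_nonneg fun k _ ↦ hf k).trans (hC 1)
        simpa using this
      have h1 : (∑ k ∈ Ioc 0 M, f k) * ((√M)⁻¹ - (√(M + 1 : ℕ))⁻¹) ≤
          C * ((Real.log (M + 1 : ℕ) - Real.log M) / 2) := by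
        calc _ ≤ C * √M * ((√M)⁻¹ - (√(M + 1 : ℕ))⁻¹) := by
              exact mul_le_mul_of_nonneg_right (hC M) (sub_nonneg.2 hmono)
          _ ≤ _ := by
              rw [mul_assoc]
              gcongr
      linarith
  have hM : (0 : ℝ) < M := by exact_mod_cast hm.trans_le hmM
  have : (∑ k ∈ Ioc 0 M, f k) * (√M)⁻¹ ≤ C := by
    rw [← div_eq_mul_inv, div_le_iff₀ (by positivity)]
    exact hC M
  linarith

lemma sum_log_primeFactors_le {d : ℕ} (hd : d ≠ 0) :
    ∑ p ∈ d.primeFactors, Real.log p ≤ Real.log d := by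
  rw [← Real.log_prod fun p hp ↦ by exact_mod_cast (Nat.prime_of_mem_primeFactors hp).ne_zero]
  have h := Nat.le_of_dvd (Nat.pos_of_ne_zero hd) d.prod_primeFactors_dvd
  refine Real.log_le_log ?_ (by rw [← Nat.cast_prod]; exact_mod_cast h)
  exact prod_pos fun p hp ↦ by exact_mod_cast (Nat.prime_of_mem_primeFactors hp).pos

/-- An upper bound for the sum over prime powers in the explicit formula when `χ` takes the value
`-1` at all primes less than `exp U` not dividing `2D`. -/
lemma sum_vonMangoldtMulOneAdd_mul_tent_le {N : ℕ} {χ : DirichletCharacter ℂ N} {D : ℤ}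
    (hD : D ≠ 0) {U : ℝ} (hU : 5 ≤ U)
    (hχ : ∀ p : ℕ, p.Prime → p ≠ 2 → ¬ (p : ℤ) ∣ D → (p : ℝ) < Real.exp U → χ p = -1) :
    ∑ n ∈ range ⌈Real.exp U⌉₊, vonMangoldtMulOneAdd χ n * (n : ℝ) ^ (-(1 / 2) : ℝ) *
      tent (Real.log n - (U - 2)) ≤
        2 * (Real.exp (2 - U / 2) * Real.log D.natAbs) + 29.46 := by
  set Y := Real.exp (U - 4) with hY
  set m := ⌊Y⌋₊ + 1 with hm
  set M := ⌊Real.exp U⌋₊ with hM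
  have hmY : Y < m := by
    rw [hm, Nat.cast_add_one]
    exact Nat.lt_floor_add_one Y
  have hY2 : 2 < Y := by
    have := Real.add_one_le_exp (U - 4)
    have h2 := Real.exp_one_gt_d9
    have : Real.exp 1 ≤ Y := Real.exp_le_exp.2 (by linarith)
    linarith
  have hmM : m ≤ M := by
    refine Nat.le_floor ?_
    have h1 : (⌊Y⌋₊ : ℝ) ≤ Y := Nat.floor_le (Real.exp_pos _).le
    have h2 : Real.exp U = Y * Real.exp 4 := by
      rw [hY, ← Real.exp_add]
      congr 1
      ring
    have h3 := Real.add_one_le_exp (4 : ℝ)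
    rw [h2, hm]
    push_cast
    nlinarith
  let f (n : ℕ) : ℝ := if n.Prime then 0 else vonMangoldt n
  let g (n : ℕ) : ℝ := if n.Prime ∧ (n : ℤ) ∣ D then Real.log n else 0
  have hf (n : ℕ) : 0 ≤ f n := by
    simp only [f]
    split_ifs
    exacts [le_rfl, vonMangoldt_nonneg]
  have hg (n : ℕ) : 0 ≤ g n := by
    simp only [g]
    split_ifs
    exacts [Real.log_natCast_nonneg n, le_rfl]
  have hfsum : ∑ n ∈ Icc m M, f n * (n : ℝ) ^ (-(1 / 2) : ℝ) ≤ 4.91 * 3 := by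
    refine (sum_mul_rpow_neg_half_le hf (C := 4.91) (fun n ↦ ?_) (Nat.succ_pos _) hmM).trans ?_
    · refine le_trans (le_of_eq ?_) (psi_sub_theta_le_const_mul_sqrt n)
      rw [psi_sub_theta_eq_sum_not_prime, Nat.floor_natCast, sum_filter]
      refine sum_congr rfl fun k _ ↦ ?_
      by_cases hk : k.Prime <;> simp [f, hk]
    · have h1 : Real.log M ≤ U := by
        rw [Real.log_le_iff_le_exp (by exact_mod_cast (Nat.succ_pos _).trans_le hmM)]
        exact Nat.floor_le (Real.exp_pos _).le
      have h2 : U - 4 ≤ Real.log m := by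
        rw [Real.le_log_iff_exp_le (by linarith)]
        exact hmY.le
      gcongr
      linarith
  have hgsum : ∑ n ∈ Icc m M, g n * (n : ℝ) ^ (-(1 / 2) : ℝ) ≤
      Real.exp (2 - U / 2) * Real.log D.natAbs := by
    calc ∑ n ∈ Icc m M, g n * (n : ℝ) ^ (-(1 / 2) : ℝ)
        ≤ ∑ n ∈ Icc m M, g n * Real.exp (2 - U / 2) := by
          refine sum_le_sum fun n hn ↦ mul_le_mul_of_nonneg_left ?_ (hg n)
          have h1 : Y ≤ n := hmY.le.trans (by exact_mod_cast (mem_Icc.1 hn).1)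
          refine (Real.rpow_le_rpow_of_nonpos (Real.exp_pos _) h1 (by norm_num)).trans_eq ?_
          rw [← Real.exp_mul]
          congr 1
          ring
      _ = Real.exp (2 - U / 2) *
            ∑ n ∈ Icc m M with Nat.Prime n ∧ ((n : ℕ) : ℤ) ∣ D, Real.log n := by
          rw [← sum_mul, mul_comm, sum_filter]
      _ ≤ Real.exp (2 - U / 2) * ∑ p ∈ D.natAbs.primeFactors, Real.log p := by
          gcongr
          intro p hp
          obtain ⟨-, hp, hpD⟩ := mem_filter.1 hp
          exact Nat.mem_primeFactors.2 ⟨hp, Int.natCast_dvd.1 hpD, Int.natAbs_ne_zero.2 hD⟩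
      _ ≤ _ := by
          gcongr
          exact sum_log_primeFactors_le (Int.natAbs_ne_zero.2 hD)
  have hterm (n : ℕ) (hnY : Y < n) (hnU : (n : ℝ) < Real.exp U) :
      vonMangoldtMulOneAdd χ n ≤ 2 * g n + 2 * f n := by
    by_cases hn : n.Prime
    · by_cases hnD : (n : ℤ) ∣ D
      · refine (vonMangoldtMulOneAdd_le χ n).trans_eq ?_
        simp [g, f, hn, hnD, vonMangoldt_apply_prime hn]
      · have h2 : n ≠ 2 := by
          rintro rfl
          norm_num at hnY
          linarith
        simp [vonMangoldtMulOneAdd, g, f, hn, hnD, hχ n hn h2 hnD hnU]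
    · simpa [g, f, hn] using vonMangoldtMulOneAdd_le χ n
  calc _ = ∑ n ∈ range ⌈Real.exp U⌉₊ with Y < ((n : ℕ) : ℝ), vonMangoldtMulOneAdd χ n *
          (n : ℝ) ^ (-(1 / 2) : ℝ) * tent (Real.log n - (U - 2)) := by
        refine (sum_filter_of_ne fun n hn h ↦ ?_).symm
        by_contra! hle
        refine h ?_
        rcases Nat.eq_zero_or_pos n with rfl | hn0
        · simp [vonMangoldtMulOneAdd]
        have hn0' : (0 : ℝ) < n := by exact_mod_cast hn0
        have hlog : Real.log n ≤ U - 4 := (Real.log_le_iff_le_exp hn0').2 hle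
        rw [tent_of_two_le_abs, mul_zero]
        rw [abs_of_nonpos (by linarith)]
        linarith
    _ ≤ ∑ n ∈ range ⌈Real.exp U⌉₊ with Y < ((n : ℕ) : ℝ),
          (2 * g n + 2 * f n) * (n : ℝ) ^ (-(1 / 2) : ℝ) := by
        refine sum_le_sum fun n hn ↦ ?_
        obtain ⟨hn, hnY⟩ := mem_filter.1 hn
        have hnU := Nat.lt_ceil.1 (mem_range.1 hn)
        refine (mul_le_of_le_one_right (mul_nonneg (vonMangoldtMulOneAdd_nonneg χ n)
          (by positivity)) (tent_le_one _)).trans ?_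
        gcongr
        exact hterm n hnY hnU
    _ ≤ ∑ n ∈ Icc m M, (2 * g n + 2 * f n) * (n : ℝ) ^ (-(1 / 2) : ℝ) := by
        refine sum_le_sum_of_subset_of_nonneg (fun n hn ↦ ?_) fun n _ _ ↦ ?_
        · obtain ⟨hn, hnY⟩ := mem_filter.1 hn
          have hnU := Nat.lt_ceil.1 (mem_range.1 hn)
          exact mem_Icc.2 ⟨(Nat.floor_lt (Real.exp_pos _).le).2 hnY, Nat.le_floor hnU.le⟩
        · have := hf n
          have := hg n
          positivity
    _ = 2 * ∑ n ∈ Icc m M, g n * (n : ℝ) ^ (-(1 / 2) : ℝ) +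
          2 * ∑ n ∈ Icc m M, f n * (n : ℝ) ^ (-(1 / 2) : ℝ) := by
        rw [mul_sum, mul_sum, ← sum_add_distrib]
        refine sum_congr rfl fun n _ ↦ ?_
        ring
    _ ≤ _ := by linarith

end

lemma const_add_lt_exp_half_mul_sinh_sq {U : ℝ} (hU : 10.17 ≤ U) :
    4 + (8 * U + 3.78) + (2 * (Real.exp (2 - U / 2) * (8 * U + 1.39)) + 29.46) <
      Real.exp ((U - 2) / 2) * (8 * Real.sinh (1 / 2) ^ 2) := by
  have he := Real.exp_one_gt_d9
  have he' := Real.exp_one_lt_d9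
  have hw0 : 59.3 ≤ Real.exp 4.085 := by
    have h1 : Real.exp 4.085 = Real.exp 1 ^ 4 * Real.exp 0.085 := by
      rw [← Real.exp_nat_mul, ← Real.exp_add]
      norm_num
    have h2 := Real.add_one_le_exp (0.085 : ℝ)
    have h3 : 54.54 ≤ Real.exp 1 ^ 4 := by
      refine le_trans ?_ (pow_le_pow_left₀ (by norm_num) he.le 4)
      norm_num
    have h4 := Real.quadratic_le_exp_of_nonneg (x := 0.085) (by norm_num)
    rw [h1]
    nlinarith
  have hw : 59.3 * (1 + (U - 10.17) / 2) ≤ Real.exp ((U - 2) / 2) := by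
    have h1 : Real.exp ((U - 2) / 2) = Real.exp 4.085 * Real.exp ((U - 10.17) / 2) := by
      rw [← Real.exp_add]
      congr 1
      ring
    have h2 := Real.add_one_le_exp ((U - 10.17) / 2)
    rw [h1]
    gcongr
    linarith
  have hinv : Real.exp (2 - U / 2) ≤ 0.046 := by
    have h1 : Real.exp (2 - U / 2) = Real.exp 1 / Real.exp ((U - 2) / 2) := by
      rw [← Real.exp_sub]
      congr 1
      ring
    rw [h1, div_le_iff₀ (Real.exp_pos _)]
    linarith
  have hs : 2.17 ≤ 8 * Real.sinh (1 / 2) ^ 2 := by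
    have h1 := Real.cosh_two_mul (1 / 2)
    have h2 := Real.cosh_sq (1 / 2)
    have h3 : (0.3678 : ℝ) ≤ Real.exp (-1) := by
      rw [Real.exp_neg, ← one_div, le_div_iff₀ (Real.exp_pos _)]
      linarith
    rw [mul_one_div_cancel two_ne_zero, Real.cosh_eq] at h1
    linarith
  calc _ ≤ 4 + (8 * U + 3.78) + (2 * (0.046 * (8 * U + 1.39)) + 29.46) := by
        gcongr
    _ < 59.3 * (1 + (U - 10.17) / 2) * 2.17 := by linarith
    _ ≤ _ := by gcongr

lemma le_log_of_le {x : ℝ} (hx : 2.225 * 10 ^ 35 ≤ x) : 81.36 ≤ Real.log x := by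
  rw [Real.le_log_iff_exp_le (lt_of_lt_of_le (by norm_num) hx)]
  have h1 : Real.exp 81.36 = Real.exp 1 ^ 81 * Real.exp 0.09 ^ 4 := by
    rw [← Real.exp_nat_mul, ← Real.exp_nat_mul, ← Real.exp_add]
    norm_num
  have h2 : Real.exp 0.09 ≤ 100 / 91 := by
    have h := Real.add_one_le_exp (-0.09 : ℝ)
    rw [Real.exp_neg] at h
    rw [← inv_inv (Real.exp 0.09), ← inv_div]
    exact inv_anti₀ (by norm_num) (by linarith)
  refine le_trans ?_ hx
  rw [h1]
  calc _ ≤ (2.7182818286 : ℝ) ^ 81 * (100 / 91) ^ 4 := by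
        gcongr
        exact Real.exp_one_lt_d9.le
    _ ≤ _ := by norm_num

/-- Assume ERH. Every fundamental discriminant `D < 0` whose class group has exponent at
most `8` satisfies `|D| ≤ 8.9·10^35`. -/
theorem abs_le_of_exponent_le_eight_of_ERH (herh : ERH)
    (D : ℤ) (hfund : IsFundamentalDiscriminant D) (hneg : D < 0)
    (hexp : ∀ (K : Type) [Field K] [NumberField K], Module.finrank ℚ K = 2 →
      NumberField.discr K = D → Monoid.exponent (ClassGroup (𝓞 K)) ≤ 8) :
    |(D : ℝ)| ≤ 8.9 * 10 ^ 35 := by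
  by_contra! hlt
  have hnat : ((D.natAbs : ℕ) : ℝ) = |(D : ℝ)| := by rw [Nat.cast_natAbs, Int.cast_abs]
  set d : ℝ := |(D : ℝ)| with hd
  have hd0 : 0 < d := lt_trans (by norm_num) hlt
  set U := Real.log (d / 4) / 8 with hU
  have hU10 : 10.17 ≤ U := by
    have := le_log_of_le (x := d / 4) (by linarith)
    rw [hU]
    linarith
  have hlog4 : Real.log 4 = 2 * Real.log 2 := by
    rw [show (4 : ℝ) = 2 ^ 2 by norm_num, Real.log_pow]
    norm_num
  have hlog2 := Real.log_two_lt_d9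
  have hlogd : Real.log d = 8 * U + Real.log 4 := by
    rw [hU, Real.log_div hd0.ne' (by norm_num)]
    ring
  have hdU : d = 4 * Real.exp U ^ 8 := by
    rw [← Real.exp_nat_mul, Nat.cast_ofNat, hU, mul_div_cancel₀ _ (by norm_num),
      Real.exp_log (by positivity)]
    ring
  obtain ⟨N, hN, χ, hNle, hprim, hodd, hinv, hχ⟩ := exists_isPrimitive_odd_eq_neg_one hneg
  have hχ' (p : ℕ) (hp : p.Prime) (hp2 : p ≠ 2) (hpD : ¬ (p : ℤ) ∣ D)
      (hpU : (p : ℝ) < Real.exp U) : χ p = -1 := by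
    refine hχ p hp hp2 hpD fun c hc ↦ ?_
    have h1 := hfund.neg_le_of_dvd_sq_sub hneg hexp hp hp2 hpD hc
    have h2 : d ≤ 4 * (p : ℝ) ^ 8 := by
      rw [hd, abs_of_neg (by exact_mod_cast hneg)]
      exact_mod_cast h1
    have h3 : (p : ℝ) ^ 8 < Real.exp U ^ 8 := pow_lt_pow_left₀ hpU p.cast_nonneg (by norm_num)
    linarith
  have hmain := exp_half_mul_le_of_ERH herh hprim hodd hinv (T := U - 2) (by linarith)
  rw [sub_add_cancel] at hmain
  have hsum := sum_vonMangoldtMulOneAdd_mul_tent_le (χ := χ) hneg.ne (by linarith) hχ'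
  have hlogN : Real.log N ≤ 8 * U + 4 * Real.log 2 := by
    calc Real.log N ≤ Real.log (4 * d) := by
          refine Real.log_le_log (by exact_mod_cast Nat.pos_of_ne_zero hN.ne) ?_
          rw [← hnat]
          exact_mod_cast hNle
      _ = _ := by
          rw [Real.log_mul (by norm_num) hd0.ne', hlogd, hlog4]
          ring
  have hpi : Real.log (2 * Real.pi) = Real.log 2 + Real.log Real.pi :=
    Real.log_mul (by norm_num) Real.pi_pos.ne'
  have hpi1 : 1 ≤ Real.log Real.pi := by
    rw [Real.le_log_iff_exp_le Real.pi_pos]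
    linarith [Real.exp_one_lt_d9, Real.pi_gt_three]
  have hlast : Real.exp (2 - U / 2) * Real.log D.natAbs ≤
      Real.exp (2 - U / 2) * (8 * U + 1.39) := by
    gcongr
    rw [hnat, hlogd]
    linarith
  have := const_add_lt_exp_half_mul_sinh_sq hU10
  linarith
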